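/- arXiv:1903.06331 — 3 statements merged into one kernel-verified Lean document; each statement's English description precedes it below -/
import Mathlib

section
/- Let χ > 0, assume (B) and (init), and let (u, v) be the maximal classical solution of the crime model on Ω̄ × [0, T_max). Let γ ∈ (0, 1/3) satisfy γ < 1/(1 + 2χ²). Then for all T > 0 there exists C(T) > 0 such that, with T̂_max := min{T, T_max} and τ := min{1, T_max/3}, the Hölder norm satisfies ‖u(·,t)‖_{C^γ(Ω̄)} ≤ C(T) for all t ∈ (τ, T̂_max), and sup_{T>0} C(T) < ∞ if hypothesis (H2) holds. -/
open Real MeasureTheory Filter Topology Set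
open scoped ENNReal NNReal

noncomputable section

/-- Partial derivative of a space-time function in the first (space) variable. -/
def pdx (f : ℝ → ℝ → ℝ) : ℝ → ℝ → ℝ := fun x t => deriv (fun y => f y t) x

/-- Partial derivative of a space-time function in the second (time) variable. -/
def pdt (f : ℝ → ℝ → ℝ) : ℝ → ℝ → ℝ := fun x t => deriv (fun s => f x s) t

/-- The time interval `[0, Tmax)` (with `Tmax ∈ (0,∞]`). -/
def It (Tmax : ℝ≥0∞) : Set ℝ := {t : ℝ | 0 ≤ t ∧ ENNReal.ofReal t < Tmax}

/-- The time interval `(0, Tmax)` (with `Tmax ∈ (0,∞]`). -/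
def It' (Tmax : ℝ≥0∞) : Set ℝ := {t : ℝ | 0 < t ∧ ENNReal.ofReal t < Tmax}

/-- The waiting time `τ := min{1, Tmax/3}`, as a real number. -/
def tauOf (Tmax : ℝ≥0∞) : ℝ := (min 1 (Tmax / 3)).toReal

/-- Hypothesis (B): `B` is nonnegative, bounded, and locally Hölder continuous on
`Ω̄ × [0,∞)` with some exponent `ϑ ∈ (0,1)`. -/
def HypB (a b : ℝ) (B : ℝ → ℝ → ℝ) : Prop :=
  (∀ x t : ℝ, 0 ≤ B x t) ∧ (∃ M : ℝ, ∀ x t : ℝ, B x t ≤ M) ∧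
  ∃ ϑ : ℝ, ϑ ∈ Set.Ioo (0:ℝ) 1 ∧
    ∀ K : Set (ℝ × ℝ), IsCompact K → K ⊆ (Set.Icc a b) ×ˢ (Set.Ici (0:ℝ)) →
      ∃ C : ℝ, ∀ p ∈ K, ∀ q ∈ K, |B p.1 p.2 - B q.1 q.2| ≤ C * dist p q ^ ϑ

/-- Hypothesis (init): `u0 ∈ C⁰(Ω̄)` nonnegative, `v0 ∈ W^{1,∞}(Ω)` (i.e. Lipschitz)
positive on `Ω̄`. -/
def HypInit (a b : ℝ) (u0 v0 : ℝ → ℝ) : Prop :=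
  ContinuousOn u0 (Set.Icc a b) ∧ (∀ x ∈ Set.Icc a b, 0 ≤ u0 x) ∧
  (∃ L : ℝ≥0, LipschitzOnWith L v0 (Set.Icc a b)) ∧ (∀ x ∈ Set.Icc a b, 0 < v0 x)

/-- Hypothesis (H1): `∫_0^∞ ∫_Ω B1 < ∞`. -/
def HypH1 (a b : ℝ) (B1 : ℝ → ℝ → ℝ) : Prop :=
  MeasureTheory.IntegrableOn (fun p : ℝ × ℝ => B1 p.1 p.2)
    ((Set.Ioo a b) ×ˢ (Set.Ioi (0:ℝ)))

/-- Hypothesis (H1'): `∫_t^{t+1} ∫_Ω B1 → 0` as `t → ∞`. -/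
def HypH1' (a b : ℝ) (B1 : ℝ → ℝ → ℝ) : Prop :=
  Filter.Tendsto (fun t : ℝ => ∫ s in t..(t+1), ∫ x in Set.Ioo a b, B1 x s)
    Filter.atTop (nhds 0)

/-- Hypothesis (H2): `inf_{t>0} ∫_Ω B2(·,t) > 0`. -/
def HypH2 (a b : ℝ) (B2 : ℝ → ℝ → ℝ) : Prop :=
  ∃ c : ℝ, 0 < c ∧ ∀ t : ℝ, 0 < t → c ≤ ∫ x in Set.Ioo a b, B2 x t

/-- Hypothesis (H3): `B2(·,t)` stabilizes to `B2inf ∈ L²(Ω)` in the averaged `L²` sense. -/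
def HypH3 (a b : ℝ) (B2 : ℝ → ℝ → ℝ) (B2inf : ℝ → ℝ) : Prop :=
  MeasureTheory.MemLp B2inf 2 (MeasureTheory.volume.restrict (Set.Ioo a b)) ∧
  Filter.Tendsto
    (fun t : ℝ => ∫ s in t..(t+1), ∫ x in Set.Ioo a b, (B2 x s - B2inf x)^2)
    Filter.atTop (nhds 0)

/-- A classical solution of the urban crime system
`u_t = u_xx − χ (u/v · v_x)_x − uv + B1`, `v_t = v_xx + uv − v + B2` on
`Ω̄ × [0, Tmax)`, `Ω = (a,b)`, with homogeneous Neumann boundary conditions and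
initial data `(u0, v0)`; `u, v` are positive on `Ω̄ × (0, Tmax)`, belong to
`C⁰(Ω̄ × [0,Tmax)) ∩ C^{2,1}(Ω̄ × (0,Tmax))` and `v(·,t)` lies in `W^{1,r}(Ω)`,
continuously in `t`, for every `r > 1`. -/
structure CrimeSol (a b χ : ℝ) (B1 B2 : ℝ → ℝ → ℝ) (u0 v0 : ℝ → ℝ)
    (u v : ℝ → ℝ → ℝ) (Tmax : ℝ≥0∞) : Prop where
  u_cont : ContinuousOn (fun p : ℝ × ℝ => u p.1 p.2) ((Set.Icc a b) ×ˢ It Tmax)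
  v_cont : ContinuousOn (fun p : ℝ × ℝ => v p.1 p.2) ((Set.Icc a b) ×ˢ It Tmax)
  u_init : ∀ x ∈ Set.Icc a b, u x 0 = u0 x
  v_init : ∀ x ∈ Set.Icc a b, v x 0 = v0 x
  u_pos : ∀ x ∈ Set.Icc a b, ∀ t ∈ It' Tmax, 0 < u x t
  v_pos : ∀ x ∈ Set.Icc a b, ∀ t ∈ It' Tmax, 0 < v x t
  u_reg : ∀ x ∈ Set.Icc a b, ∀ t ∈ It' Tmax,
    DifferentiableAt ℝ (fun y => u y t) x ∧
    DifferentiableAt ℝ (fun y => pdx u y t) x ∧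
    DifferentiableAt ℝ (fun s => u x s) t
  v_reg : ∀ x ∈ Set.Icc a b, ∀ t ∈ It' Tmax,
    DifferentiableAt ℝ (fun y => v y t) x ∧
    DifferentiableAt ℝ (fun y => pdx v y t) x ∧
    DifferentiableAt ℝ (fun s => v x s) t
  u_cont21 : ContinuousOn
    (fun p : ℝ × ℝ => (pdx u p.1 p.2, pdx (pdx u) p.1 p.2, pdt u p.1 p.2))
    ((Set.Icc a b) ×ˢ It' Tmax)
  v_cont21 : ContinuousOn
    (fun p : ℝ × ℝ => (pdx v p.1 p.2, pdx (pdx v) p.1 p.2, pdt v p.1 p.2))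
    ((Set.Icc a b) ×ˢ It' Tmax)
  v_W1r : ∀ r : ℝ, 1 < r →
    (∀ t ∈ It Tmax,
      MeasureTheory.IntegrableOn (fun x => |pdx v x t| ^ r) (Set.Ioo a b)) ∧
    ContinuousOn (fun t => ∫ x in Set.Ioo a b, |pdx v x t| ^ r) (It Tmax)
  u_eq : ∀ x ∈ Set.Ioo a b, ∀ t ∈ It' Tmax,
    pdt u x t = pdx (pdx u) x t
      - χ * pdx (fun y s => u y s / v y s * pdx v y s) x t
      - u x t * v x t + B1 x t
  v_eq : ∀ x ∈ Set.Ioo a b, ∀ t ∈ It' Tmax,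
    pdt v x t = pdx (pdx v) x t + u x t * v x t - v x t + B2 x t
  u_bc : ∀ t ∈ It' Tmax, pdx u a t = 0 ∧ pdx u b t = 0
  v_bc : ∀ t ∈ It' Tmax, pdx v a t = 0 ∧ pdx v b t = 0

/-- A classical solution of the stationary Neumann problem
`−w'' + w = B` in `Ω = (a,b)`, `w' = 0` on `∂Ω`. -/
def IsStationarySol (a b : ℝ) (B : ℝ → ℝ) (w : ℝ → ℝ) : Prop :=
  ContinuousOn w (Set.Icc a b) ∧
  (∀ x ∈ Set.Icc a b, DifferentiableAt ℝ w x ∧ DifferentiableAt ℝ (deriv w) x) ∧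
  (∀ x ∈ Set.Ioo a b, -(deriv (deriv w) x) + w x = B x) ∧
  deriv w a = 0 ∧ deriv w b = 0

/-- The branches `q^±(p) = (1−p)/2 · (1 ∓/± √(1 − pχ²))`. -/
def qminus (χ p : ℝ) : ℝ := (1 - p) / 2 * (1 - Real.sqrt (1 - p * χ^2))

def qplus (χ p : ℝ) : ℝ := (1 - p) / 2 * (1 + Real.sqrt (1 - p * χ^2))

/-- The auxiliary functions `φ₁, φ₂, φ₃` and the constant `p₀`. -/
def phi1 (p : ℝ) : ℝ := (p + 1) / (1 - p)

def phi2 (χ p : ℝ) : ℝ := (1 - p) / (2 * p) * (1 + Real.sqrt (1 - p * χ^2))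

def phi3 (χ p : ℝ) : ℝ := (1 - p) / (2 * p) * (1 - Real.sqrt (1 - p * χ^2))

def p0 : ℝ := (2 * Real.sqrt 3 - 3) / 3

namespace Cr

lemma ii {a b : ℝ} (hab : a ≤ b) {f : ℝ → ℝ} (hf : ContinuousOn f (Icc a b)) :
    IntervalIntegrable f volume a b :=
  ContinuousOn.intervalIntegrable (by rwa [uIcc_of_le hab])

lemma int_mono {a b : ℝ} (hab : a ≤ b) {f g : ℝ → ℝ} (hf : ContinuousOn f (Icc a b))
    (hg : ContinuousOn g (Icc a b)) (h : ∀ x ∈ Icc a b, f x ≤ g x) :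
    ∫ x in a..b, f x ≤ ∫ x in a..b, g x :=
  intervalIntegral.integral_mono_on hab (ii hab hf) (ii hab hg) h

lemma int_nonneg {a b : ℝ} (hab : a ≤ b) {f : ℝ → ℝ} (h : ∀ x ∈ Icc a b, 0 ≤ f x) :
    0 ≤ ∫ x in a..b, f x :=
  intervalIntegral.integral_nonneg hab h

lemma int_congr {a b : ℝ} (hab : a ≤ b) {f g : ℝ → ℝ}
    (h : ∀ x ∈ Icc a b, f x = g x) :
    ∫ x in a..b, f x = ∫ x in a..b, g x :=
  intervalIntegral.integral_congr (by rwa [uIcc_of_le hab])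

lemma int_add {a b : ℝ} (hab : a ≤ b) {f g : ℝ → ℝ} (hf : ContinuousOn f (Icc a b))
    (hg : ContinuousOn g (Icc a b)) :
    ∫ x in a..b, (f x + g x) = (∫ x in a..b, f x) + ∫ x in a..b, g x :=
  intervalIntegral.integral_add (ii hab hf) (ii hab hg)

lemma int_lin2 {a b : ℝ} (hab : a ≤ b) {f g : ℝ → ℝ} (c d : ℝ) (hf : ContinuousOn f (Icc a b))
    (hg : ContinuousOn g (Icc a b)) :
    ∫ x in a..b, (c * f x + d * g x) = c * (∫ x in a..b, f x) + d * ∫ x in a..b, g x := by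
  rw [int_add hab (by fun_prop) (by fun_prop), intervalIntegral.integral_const_mul,
    intervalIntegral.integral_const_mul]

lemma int_lin3 {a b : ℝ} (hab : a ≤ b) {f g h : ℝ → ℝ} (c d e : ℝ)
    (hf : ContinuousOn f (Icc a b))
    (hg : ContinuousOn g (Icc a b)) (hh : ContinuousOn h (Icc a b)) :
    ∫ x in a..b, (c * f x + d * g x + e * h x)
      = c * (∫ x in a..b, f x) + d * (∫ x in a..b, g x) + e * ∫ x in a..b, h x := by
  rw [int_add hab (by fun_prop) (by fun_prop), int_lin2 hab c d hf hg,
    intervalIntegral.integral_const_mul]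

lemma int_lin4 {a b : ℝ} (hab : a ≤ b) {f g h k : ℝ → ℝ} (c d e l : ℝ)
    (hf : ContinuousOn f (Icc a b))
    (hg : ContinuousOn g (Icc a b)) (hh : ContinuousOn h (Icc a b))
    (hk : ContinuousOn k (Icc a b)) :
    ∫ x in a..b, (c * f x + d * g x + e * h x + l * k x)
      = c * (∫ x in a..b, f x) + d * (∫ x in a..b, g x) + e * (∫ x in a..b, h x)
        + l * ∫ x in a..b, k x := by
  rw [int_add hab (by fun_prop) (by fun_prop), int_lin3 hab c d e hf hg hh,
    intervalIntegral.integral_const_mul]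

lemma int_one (a b : ℝ) : ∫ _x in a..b, (1:ℝ) = b - a := by simp

/-- Cauchy–Schwarz. -/
lemma cs {a b : ℝ} (hab : a ≤ b) {f g : ℝ → ℝ} (hf : ContinuousOn f (Icc a b))
    (hg : ContinuousOn g (Icc a b)) :
    (∫ x in a..b, f x * g x) ^ 2 ≤ (∫ x in a..b, f x ^ 2) * ∫ x in a..b, g x ^ 2 := by
  have key : ∀ s : ℝ, 0 ≤ (∫ x in a..b, g x ^ 2) * (s * s)
      + (2 * ∫ x in a..b, f x * g x) * s + ∫ x in a..b, f x ^ 2 := by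
    intro s
    have h1 : 0 ≤ ∫ x in a..b, (f x + s * g x) ^ 2 := int_nonneg hab (fun x _ => sq_nonneg _)
    have h2 : ∫ x in a..b, (f x + s * g x) ^ 2
        = ∫ x in a..b, (1 * f x ^ 2 + (2 * s) * (f x * g x) + (s * s) * g x ^ 2) :=
      int_congr hab (fun x _ => by ring)
    rw [h2, int_lin3 hab (f := fun x => f x ^ 2) (g := fun x => f x * g x)
      (h := fun x => g x ^ 2) 1 (2*s) (s*s) (by fun_prop) (by fun_prop) (by fun_prop)] at h1
    linarith
  have := discrim_le_zero key
  unfold discrim at this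
  nlinarith

/-- Integration by parts with vanishing flux. -/
lemma ibp {a b : ℝ} (hab : a ≤ b) {f f' g g' : ℝ → ℝ}
    (hf : ∀ x ∈ Icc a b, HasDerivAt f (f' x) x) (hg : ∀ x ∈ Icc a b, HasDerivAt g (g' x) x)
    (hf' : ContinuousOn f' (Icc a b)) (hg' : ContinuousOn g' (Icc a b))
    (ga : g a = 0) (gb : g b = 0) :
    ∫ x in a..b, f x * g' x = - ∫ x in a..b, f' x * g x := by
  rw [intervalIntegral.integral_mul_deriv_eq_deriv_mul
    (by rwa [uIcc_of_le hab]) (by rwa [uIcc_of_le hab]) (ii hab hf') (ii hab hg'), ga, gb]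
  ring

/-- Fundamental theorem: difference is bounded by the integral of the modulus of the derivative
over a larger interval. -/
lemma ftc_le {a b : ℝ} {f f' : ℝ → ℝ}
    (hf : ∀ x ∈ Icc a b, HasDerivAt f (f' x) x)
    (hf' : ContinuousOn f' (Icc a b)) {x y : ℝ} (hx : x ∈ Icc a b) (hy : y ∈ Icc a b) :
    |f x - f y| ≤ ∫ z in a..b, |f' z| := by
  wlog hxy : y ≤ x generalizing x y
  · rw [abs_sub_comm]; exact this hy hx (le_of_not_ge hxy)
  have hsub : Icc y x ⊆ Icc a b := Icc_subset_Icc hy.1 hx.2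
  have h1 : ∫ z in y..x, f' z = f x - f y :=
    intervalIntegral.integral_eq_sub_of_hasDerivAt
      (fun z hz => hf z (hsub (by rwa [uIcc_of_le hxy] at hz))) (ii hxy (hf'.mono hsub))
  rw [← h1]
  refine (intervalIntegral.abs_integral_le_integral_abs hxy).trans ?_
  exact intervalIntegral.integral_mono_interval hy.1 hxy hx.2
    (ae_of_all _ fun z => abs_nonneg _) (ii (hx.1.trans hx.2) hf'.abs)

/-- One-dimensional Sobolev embedding `W^{1,1} ⊂ L^∞`. -/
lemma sob1 {a b : ℝ} (hab : a < b) {f f' : ℝ → ℝ}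
    (hf : ∀ x ∈ Icc a b, HasDerivAt f (f' x) x)
    (hf' : ContinuousOn f' (Icc a b)) {x : ℝ} (hx : x ∈ Icc a b) :
    f x ≤ (b - a)⁻¹ * (∫ z in a..b, f z) + ∫ z in a..b, |f' z| := by
  have hl : 0 < b - a := sub_pos.2 hab
  have hfc : ContinuousOn f (Icc a b) := fun z hz => (hf z hz).continuousAt.continuousWithinAt
  set K := ∫ z in a..b, |f' z|
  have h1 : ∫ z in a..b, (f x - K) * 1 ≤ ∫ z in a..b, f z :=
    int_mono hab.le (by fun_prop) hfc (fun z hz => by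
      have := (abs_le.1 (ftc_le hf hf' hx hz)).2
      simp only [mul_one]; linarith)
  rw [intervalIntegral.integral_const_mul, int_one] at h1
  have : (b - a)⁻¹ * ((f x - K) * (b - a)) ≤ (b-a)⁻¹ * ∫ z in a..b, f z :=
    mul_le_mul_of_nonneg_left h1 (by positivity)
  have e : (b - a)⁻¹ * ((f x - K) * (b - a)) = f x - K := by field_simp
  linarith

/-- `f(x)² ≤ ℓ⁻¹ ∫ f² + 2 √(∫ f² ∫ f_x²)`, squared-free form. -/
lemma sob2 {a b : ℝ} (hab : a < b) {f f' : ℝ → ℝ}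
    (hf : ∀ x ∈ Icc a b, HasDerivAt f (f' x) x)
    (hf' : ContinuousOn f' (Icc a b)) {x : ℝ} (hx : x ∈ Icc a b) :
    f x ^ 2 ≤ (b - a)⁻¹ * (∫ z in a..b, f z ^ 2)
      + 2 * √((∫ z in a..b, f z ^ 2) * ∫ z in a..b, f' z ^ 2) := by
  have hfc : ContinuousOn f (Icc a b) := fun z hz => (hf z hz).continuousAt.continuousWithinAt
  have h := sob1 hab (f := fun z => f z ^ 2) (f' := fun z => 2 * (f z * f' z))
    (fun z hz => by
      exact ((hf z hz).pow 2).congr_deriv (by norm_num; ring)) (by fun_prop) hx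
  have h2 : ∫ z in a..b, |2 * (f z * f' z)| = 2 * ∫ z in a..b, |f z| * |f' z| := by
    rw [← intervalIntegral.integral_const_mul]
    exact int_congr hab.le (fun z _ => by rw [abs_mul, abs_mul]; norm_num)
  have h3 : ∫ z in a..b, |f z| * |f' z| ≤ √((∫ z in a..b, f z ^ 2) * ∫ z in a..b, f' z ^ 2) := by
    apply Real.le_sqrt_of_sq_le
    have := cs hab.le hfc.abs hf'.abs
    simpa only [sq_abs] using this
  simp only [h2] at h
  linarith

/-- `f(x)² ≤ (ℓ⁻¹ + ε⁻¹) ∫ f² + ε ∫ f_x²`. -/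
lemma sob3 {a b : ℝ} (hab : a < b) {f f' : ℝ → ℝ}
    (hf : ∀ x ∈ Icc a b, HasDerivAt f (f' x) x)
    (hf' : ContinuousOn f' (Icc a b)) {ε : ℝ} (hε : 0 < ε) {x : ℝ} (hx : x ∈ Icc a b) :
    f x ^ 2 ≤ ((b - a)⁻¹ + ε⁻¹) * (∫ z in a..b, f z ^ 2) + ε * ∫ z in a..b, f' z ^ 2 := by
  have h := sob2 hab hf hf' hx
  set p := ∫ z in a..b, f z ^ 2
  set q := ∫ z in a..b, f' z ^ 2
  have hp : 0 ≤ p := int_nonneg hab.le fun _ _ => sq_nonneg _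
  have hq : 0 ≤ q := int_nonneg hab.le fun _ _ => sq_nonneg _
  have : √(p * q) ≤ (ε⁻¹ * p + ε * q) / 2 := by
    apply Real.sqrt_le_iff.2
    refine ⟨by positivity, ?_⟩
    have e : ((ε⁻¹ * p + ε * q) / 2) ^ 2 - p * q = ((ε⁻¹ * p - ε * q) / 2) ^ 2 := by
      field_simp; ring
    nlinarith [sq_nonneg ((ε⁻¹ * p - ε * q) / 2)]
  linarith

/-- For nonnegative `f`: `f(x)² ≤ C (∫ f)² + 2 ε ∫ f_x²`. -/
lemma sob4 {a b : ℝ} (hab : a < b) {f f' : ℝ → ℝ}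
    (hf : ∀ x ∈ Icc a b, HasDerivAt f (f' x) x)
    (hf' : ContinuousOn f' (Icc a b)) (hpos : ∀ x ∈ Icc a b, 0 ≤ f x)
    {ε : ℝ} (hε : 0 < ε) {x : ℝ} (hx : x ∈ Icc a b) :
    f x ^ 2 ≤ ((b - a)⁻¹ + ε⁻¹) ^ 2 * (∫ z in a..b, f z) ^ 2 + 2 * ε * ∫ z in a..b, f' z ^ 2 := by
  have hfc : ContinuousOn f (Icc a b) := fun z hz => (hf z hz).continuousAt.continuousWithinAt
  obtain ⟨y, hy, hmax⟩ := isCompact_Icc.exists_isMaxOn (nonempty_Icc.2 hab.le) hfc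
  have h := sob3 hab hf hf' hε hy
  have h1 : ∫ z in a..b, f z ^ 2 ≤ ∫ z in a..b, f y * f z :=
    int_mono hab.le (by fun_prop) (by fun_prop) (fun z hz => by
      rw [sq]; exact mul_le_mul_of_nonneg_right (hmax hz) (hpos z hz))
  rw [intervalIntegral.integral_const_mul] at h1
  have hl : 0 < b - a := sub_pos.2 hab
  set c := (b - a)⁻¹ + ε⁻¹
  have hc : 0 < c := by positivity
  have h2 := mul_le_mul_of_nonneg_left h1 hc.le
  have h3 : f x ^ 2 ≤ f y ^ 2 := by
    have := hmax hx
    exact pow_le_pow_left₀ (hpos x hx) this 2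
  nlinarith [sq_nonneg (f y - c * ∫ z in a..b, f z)]

/-- Linear differential inequality. -/
lemma ode {J : Set ℝ} (hJ : J.OrdConnected) {F F' : ℝ → ℝ} {t0 c C : ℝ} (hc : 0 < c)
    (ht0 : t0 ∈ J) (hF : ∀ t ∈ J, HasDerivAt F (F' t) t)
    (hle : ∀ t ∈ J, t0 ≤ t → F' t ≤ - c * F t + C) {t : ℝ} (ht : t ∈ J) (h : t0 ≤ t) :
    F t ≤ max (F t0) (C / c) := by
  have hsub : Icc t0 t ⊆ J := hJ.out ht0 ht
  have hG : ∀ s ∈ J, HasDerivAt (fun s => (F s - C / c) * exp (c * s))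
      (F' s * exp (c * s) + (F s - C / c) * (exp (c * s) * (c * 1))) s := fun s hs =>
    ((hF s hs).sub_const _).mul (((hasDerivAt_id s).const_mul c).exp)
  have hanti : AntitoneOn (fun s => (F s - C / c) * exp (c * s)) (Icc t0 t) := by
    apply antitoneOn_of_deriv_nonpos (convex_Icc _ _)
    · exact fun s hs => (hG s (hsub hs)).continuousAt.continuousWithinAt
    · exact fun s hs => (hG s (hsub (interior_subset hs))).differentiableAt.differentiableWithinAt
    · intro s hs
      have hs' := interior_subset hs
      rw [(hG s (hsub hs')).deriv]
      have h1 := hle s (hsub hs') hs'.1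
      have e : F' s * exp (c * s) + (F s - C / c) * (exp (c * s) * (c * 1))
          = (F' s + c * F s - C) * exp (c * s) := by field_simp; ring
      rw [e]
      exact mul_nonpos_of_nonpos_of_nonneg (by linarith) (exp_pos _).le
  have h1 := hanti (left_mem_Icc.2 h) (right_mem_Icc.2 h) h
  simp only at h1
  by_contra hcon
  push Not at hcon
  obtain ⟨h2, h3⟩ := max_lt_iff.1 hcon
  have h4 : exp (c * t0) ≤ exp (c * t) := exp_le_exp.2 (by nlinarith)
  have h5 : (F t0 - C / c) * exp (c * t0) < (F t - C / c) * exp (c * t) := by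
    calc (F t0 - C / c) * exp (c * t0) < (F t - C / c) * exp (c * t0) :=
          mul_lt_mul_of_pos_right (by linarith) (exp_pos _)
      _ ≤ _ := mul_le_mul_of_nonneg_left h4 (by linarith)
  linarith

/-- Differentiation under the integral sign. -/
lemma deriv_int {a b : ℝ} (hab : a ≤ b) {J : Set ℝ} (hJ : IsOpen J) {F F' : ℝ → ℝ → ℝ}
    (hF : ContinuousOn (fun p : ℝ × ℝ => F p.1 p.2) (Icc a b ×ˢ J))
    (hF' : ContinuousOn (fun p : ℝ × ℝ => F' p.1 p.2) (Icc a b ×ˢ J))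
    (hd : ∀ x ∈ Icc a b, ∀ t ∈ J, HasDerivAt (fun s => F x s) (F' x t) t) {t : ℝ} (ht : t ∈ J) :
    HasDerivAt (fun s => ∫ x in a..b, F x s) (∫ x in a..b, F' x t) t := by
  obtain ⟨ε, hε, hball⟩ := Metric.nhds_basis_closedBall.mem_iff.1 (hJ.mem_nhds ht)
  have hslice : ∀ {G : ℝ → ℝ → ℝ}, ContinuousOn (fun p : ℝ × ℝ => G p.1 p.2) (Icc a b ×ˢ J) →
      ∀ s ∈ J, ContinuousOn (fun x => G x s) (Icc a b) := by
    intro G hG s hs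
    exact hG.comp (f := fun x => (x, s)) (by fun_prop) (fun x hx => ⟨hx, hs⟩)
  have hK : IsCompact (Icc a b ×ˢ Metric.closedBall t ε) :=
    isCompact_Icc.prod (isCompact_closedBall _ _)
  obtain ⟨C, hC⟩ := hK.exists_bound_of_continuousOn (hF'.mono (prod_mono_right hball))
  have hI : Set.uIoc a b ⊆ Icc a b := by rw [uIoc_of_le hab]; exact Ioc_subset_Icc_self
  refine (intervalIntegral.hasDerivAt_integral_of_dominated_loc_of_deriv_le
    (F := fun s x => F x s) (F' := fun s x => F' x s) (bound := fun _ => C)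
    (Metric.closedBall_mem_nhds t hε) ?_ ?_ ?_ ?_ ?_ ?_).2
  · filter_upwards [hJ.mem_nhds ht] with s hs
    exact ((hslice hF s hs).mono hI).aestronglyMeasurable measurableSet_uIoc
  · exact ii hab (hslice hF t ht)
  · exact ((hslice hF' t ht).mono hI).aestronglyMeasurable measurableSet_uIoc
  · exact ae_of_all _ fun x hx s hs => hC (x, s) ⟨hI hx, hs⟩
  · simp
  · exact ae_of_all _ fun x hx s hs => hd x (hI hx) s (hball hs)

end Cr

namespace Cr

/-- Regularity class `C^{2,1}` with Neumann boundary condition. -/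
structure Reg (a b : ℝ) (J : Set ℝ) (f fx fxx ft : ℝ → ℝ → ℝ) : Prop where
  dx : ∀ x ∈ Icc a b, ∀ t ∈ J, HasDerivAt (fun y => f y t) (fx x t) x
  dxx : ∀ x ∈ Icc a b, ∀ t ∈ J, HasDerivAt (fun y => fx y t) (fxx x t) x
  dt : ∀ x ∈ Icc a b, ∀ t ∈ J, HasDerivAt (fun s => f x s) (ft x t) t
  c0 : ContinuousOn (fun p : ℝ × ℝ => f p.1 p.2) (Icc a b ×ˢ J)
  c1 : ContinuousOn (fun p : ℝ × ℝ => fx p.1 p.2) (Icc a b ×ˢ J)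
  c2 : ContinuousOn (fun p : ℝ × ℝ => fxx p.1 p.2) (Icc a b ×ˢ J)
  ct : ContinuousOn (fun p : ℝ × ℝ => ft p.1 p.2) (Icc a b ×ˢ J)
  bca : ∀ t ∈ J, fx a t = 0
  bcb : ∀ t ∈ J, fx b t = 0
  pos : ∀ x ∈ Icc a b, ∀ t ∈ J, 0 < f x t

lemma slice {a b : ℝ} {J : Set ℝ} {G : ℝ → ℝ → ℝ}
    (hG : ContinuousOn (fun p : ℝ × ℝ => G p.1 p.2) (Icc a b ×ˢ J)) {s : ℝ} (hs : s ∈ J) :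
    ContinuousOn (fun x => G x s) (Icc a b) :=
  hG.comp (f := fun x => (x, s)) (by fun_prop) (fun _ hx => ⟨hx, hs⟩)

lemma tslice {a b : ℝ} {J : Set ℝ} {G : ℝ → ℝ → ℝ}
    (hG : ContinuousOn (fun p : ℝ × ℝ => G p.1 p.2) (Icc a b ×ˢ J)) {x : ℝ} (hx : x ∈ Icc a b) :
    ContinuousOn (fun s => G x s) J :=
  hG.comp (f := fun s => (x, s)) (by fun_prop) (fun _ hs => ⟨hx, hs⟩)

lemma h1_deriv {a b : ℝ} (hab : a ≤ b) {J : Set ℝ} (hJ : IsOpen J) {f fx fxx ft : ℝ → ℝ → ℝ}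
    (R : Reg a b J f fx fxx ft) {t : ℝ} (ht : t ∈ J) :
    HasDerivAt (fun s => ∫ x in a..b, fx x s ^ 2) (∫ x in a..b, -(2 * (ft x t * fxx x t))) t := by
  obtain ⟨ε, hε, hball⟩ := Metric.nhds_basis_closedBall.mem_iff.1 (hJ.mem_nhds ht)
  have hK : IsCompact (Icc a b ×ˢ Metric.closedBall t ε) :=
    isCompact_Icc.prod (isCompact_closedBall _ _)
  have htb : t ∈ Metric.closedBall t ε := Metric.mem_closedBall_self hε.le
  obtain ⟨C, hC⟩ := hK.exists_bound_of_continuousOn (R.ct.mono (prod_mono_right hball))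
  obtain ⟨D, hD⟩ := hK.exists_bound_of_continuousOn (R.c2.mono (prod_mono_right hball))
  have hI : Set.uIoc a b ⊆ Icc a b := by rw [uIoc_of_le hab]; exact Ioc_subset_Icc_self
  -- the difference formula
  have key : ∀ s ∈ J, (∫ x in a..b, fx x s ^ 2) - (∫ x in a..b, fx x t ^ 2)
      = ∫ x in a..b, (f x s - f x t) * (-(fxx x s + fxx x t)) := by
    intro s hs
    have i1 := ibp hab (f := fun x => f x s - f x t) (f' := fun x => fx x s - fx x t)
      (g := fun x => -(fx x s + fx x t)) (g' := fun x => -(fxx x s + fxx x t))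
      (fun x hx => (R.dx x hx s hs).sub (R.dx x hx t ht))
      (fun x hx => ((R.dxx x hx s hs).add (R.dxx x hx t ht)).neg)
      ((slice R.c1 hs).sub (slice R.c1 ht)) ((slice R.c2 hs).add (slice R.c2 ht)).neg
      (by simp [R.bca s hs, R.bca t ht]) (by simp [R.bcb s hs, R.bcb t ht])
    rw [i1, ← intervalIntegral.integral_neg,
      ← intervalIntegral.integral_sub (f := fun x => fx x s ^ 2) (g := fun x => fx x t ^ 2)
        (ii hab ((slice R.c1 hs).pow 2))
        (ii hab ((slice R.c1 ht).pow 2))]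
    exact int_congr hab fun x _ => by ring
  rw [hasDerivAt_iff_tendsto_slope]
  have hev : ∀ᶠ s in 𝓝[≠] t, s ∈ Metric.closedBall t ε ∧ s ≠ t := by
    refine (eventually_nhdsWithin_of_eventually_nhds
      (Metric.closedBall_mem_nhds t hε)).and ?_
    exact eventually_mem_nhdsWithin
  have hsl : (fun s => ∫ x in a..b, (slope (fun r => f x r) t s) * (-(fxx x s + fxx x t)))
      =ᶠ[𝓝[≠] t] slope (fun s => ∫ x in a..b, fx x s ^ 2) t := by
    filter_upwards [hev] with s hs
    rw [slope_def_field, key s (hball hs.1), div_eq_inv_mul,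
      ← intervalIntegral.integral_const_mul]
    refine int_congr hab fun x _ => ?_
    rw [slope_def_field]; ring
  refine Tendsto.congr' hsl ?_
  refine intervalIntegral.tendsto_integral_filter_of_dominated_convergence
    (fun _ => C * (D + D)) ?_ ?_ (by simp) ?_
  · filter_upwards [hev] with s hs
    have hsJ := hball hs.1
    have : ContinuousOn (fun x => slope (fun r => f x r) t s * (-(fxx x s + fxx x t)))
        (Icc a b) := by
      simp only [slope_def_field]
      exact (((slice R.c0 hsJ).sub (slice R.c0 ht)).div_const _).mul
        ((slice R.c2 hsJ).add (slice R.c2 ht)).neg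
    exact (this.mono hI).aestronglyMeasurable measurableSet_uIoc
  · filter_upwards [hev] with s hs
    refine ae_of_all _ fun x hx => ?_
    have hx' := hI hx
    have h1 : ‖f x s - f x t‖ ≤ C * ‖s - t‖ :=
      (convex_closedBall t ε).norm_image_sub_le_of_norm_hasDerivWithin_le
        (f := fun r => f x r) (f' := fun r => ft x r)
        (fun r hr => (R.dt x hx' r (hball hr)).hasDerivWithinAt)
        (fun r hr => hC (x, r) ⟨hx', hr⟩) htb hs.1
    have hne : 0 < ‖s - t‖ := norm_pos_iff.2 (sub_ne_zero.2 hs.2)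
    have h2 : ‖slope (fun r => f x r) t s‖ ≤ C := by
      rw [slope_def_field, norm_div, div_le_iff₀ hne]; exact h1
    have h3 : ‖-(fxx x s + fxx x t)‖ ≤ D + D := by
      rw [norm_neg]
      exact (norm_add_le _ _).trans (add_le_add (hD (x, s) ⟨hx', hs.1⟩) (hD (x, t) ⟨hx', htb⟩))
    rw [norm_mul]
    exact mul_le_mul h2 h3 (norm_nonneg _) ((norm_nonneg _).trans h2)
  · refine ae_of_all _ fun x hx => ?_
    have hx' := hI hx
    have h1 := hasDerivAt_iff_tendsto_slope.1 (R.dt x hx' t ht)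
    have h2 : Tendsto (fun s => fxx x s) (𝓝[≠] t) (𝓝 (fxx x t)) :=
      (((tslice R.c2 hx').continuousAt (hJ.mem_nhds ht)).tendsto).mono_left nhdsWithin_le_nhds
    have h3 := h1.mul (h2.add_const (fxx x t)).neg
    convert h3 using 2
    ring

/-- Generic energy identity. -/
lemma energy {a b : ℝ} (hab : a ≤ b) {J : Set ℝ} (hJ : IsOpen J) {f fx fxx ft : ℝ → ℝ → ℝ}
    (R : Reg a b J f fx fxx ft) {Φ Φ1 Φ2 : ℝ → ℝ}
    (h1 : ∀ s, 0 < s → HasDerivAt Φ (Φ1 s) s) (h2 : ∀ s, 0 < s → HasDerivAt Φ1 (Φ2 s) s)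
    (h3 : ContinuousOn Φ2 (Ioi 0)) {t : ℝ} (ht : t ∈ J) {j jx g : ℝ → ℝ}
    (hj : ∀ x ∈ Icc a b, HasDerivAt j (jx x) x) (hjx : ContinuousOn jx (Icc a b))
    (hg : ContinuousOn g (Icc a b)) (ja : j a = 0) (jb : j b = 0)
    (heq : ∀ x ∈ Icc a b, ft x t = jx x + g x) :
    HasDerivAt (fun s => ∫ x in a..b, Φ (f x s))
      (- (∫ x in a..b, Φ2 (f x t) * fx x t * j x) + ∫ x in a..b, Φ1 (f x t) * g x) t := by
  have c1 : ContinuousOn Φ (Ioi 0) := fun s hs => (h1 s hs).continuousAt.continuousWithinAt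
  have c2 : ContinuousOn Φ1 (Ioi 0) := fun s hs => (h2 s hs).continuousAt.continuousWithinAt
  have d := deriv_int hab hJ (F := fun x s => Φ (f x s)) (F' := fun x s => Φ1 (f x s) * ft x s)
    (c1.comp R.c0 (fun p hp => R.pos p.1 hp.1 p.2 hp.2))
    ((c2.comp R.c0 (fun p hp => R.pos p.1 hp.1 p.2 hp.2)).mul R.ct)
    (fun x hx s hs => (h1 _ (R.pos x hx s hs)).comp s (R.dt x hx s hs)) ht
  refine d.congr_deriv ?_
  have s1 : ContinuousOn (fun x => Φ1 (f x t)) (Icc a b) :=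
    c2.comp (slice R.c0 ht) (fun x hx => R.pos x hx t ht)
  have s2 : ContinuousOn (fun x => Φ2 (f x t)) (Icc a b) :=
    h3.comp (slice R.c0 ht) (fun x hx => R.pos x hx t ht)
  have e1 : ∫ x in a..b, Φ1 (f x t) * ft x t
      = ∫ x in a..b, (Φ1 (f x t) * jx x + Φ1 (f x t) * g x) :=
    int_congr hab fun x hx => by rw [heq x hx]; ring
  rw [e1, int_add hab (f := fun x => Φ1 (f x t) * jx x) (g := fun x => Φ1 (f x t) * g x)
    (s1.mul hjx) (s1.mul hg)]
  congr 1
  exact ibp hab (fun x hx => (h2 _ (R.pos x hx t ht)).comp x (R.dx x hx t ht)) hj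
    (s2.mul (slice R.c1 ht)) hjx ja jb

/-- The crime system on a time interval `J`, in expanded form on the closed interval. -/
structure Sys (a b χ M : ℝ) (J : Set ℝ) (u ux uxx ut v vx vxx vt b1 b2 : ℝ → ℝ → ℝ) : Prop where
  hab : a < b
  hJ : IsOpen J
  hJc : J.OrdConnected
  ru : Reg a b J u ux uxx ut
  rv : Reg a b J v vx vxx vt
  cb1 : ContinuousOn (fun p : ℝ × ℝ => b1 p.1 p.2) (Icc a b ×ˢ J)
  cb2 : ContinuousOn (fun p : ℝ × ℝ => b2 p.1 p.2) (Icc a b ×ˢ J)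
  hb1 : ∀ x ∈ Icc a b, ∀ t ∈ J, 0 ≤ b1 x t ∧ b1 x t ≤ M
  hb2 : ∀ x ∈ Icc a b, ∀ t ∈ J, 0 ≤ b2 x t ∧ b2 x t ≤ M
  ueq : ∀ x ∈ Icc a b, ∀ t ∈ J, ut x t = (uxx x t
    - χ * (ux x t / v x t * vx x t - u x t / v x t ^ 2 * vx x t ^ 2 + u x t / v x t * vxx x t))
    + (b1 x t - u x t * v x t)
  veq : ∀ x ∈ Icc a b, ∀ t ∈ J, vt x t = vxx x t + (u x t * v x t - v x t + b2 x t)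

section
variable {a b χ M : ℝ} {J : Set ℝ} {u ux uxx ut v vx vxx vt b1 b2 : ℝ → ℝ → ℝ}

lemma Sys.energy_v (S : Sys a b χ M J u ux uxx ut v vx vxx vt b1 b2) {Φ Φ1 Φ2 : ℝ → ℝ}
    (h1 : ∀ s, 0 < s → HasDerivAt Φ (Φ1 s) s) (h2 : ∀ s, 0 < s → HasDerivAt Φ1 (Φ2 s) s)
    (h3 : ContinuousOn Φ2 (Ioi 0)) {t : ℝ} (ht : t ∈ J) :
    HasDerivAt (fun s => ∫ x in a..b, Φ (v x s))
      (- (∫ x in a..b, Φ2 (v x t) * vx x t * vx x t)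
        + ∫ x in a..b, Φ1 (v x t) * (u x t * v x t - v x t + b2 x t)) t :=
  energy S.hab.le S.hJ S.rv h1 h2 h3 ht (fun x hx => S.rv.dxx x hx t ht) (slice S.rv.c2 ht)
    ((((slice S.ru.c0 ht).mul (slice S.rv.c0 ht)).sub (slice S.rv.c0 ht)).add (slice S.cb2 ht))
    (S.rv.bca t ht) (S.rv.bcb t ht) (fun x hx => S.veq x hx t ht)

lemma Sys.energy_u (S : Sys a b χ M J u ux uxx ut v vx vxx vt b1 b2) {Φ Φ1 Φ2 : ℝ → ℝ}
    (h1 : ∀ s, 0 < s → HasDerivAt Φ (Φ1 s) s) (h2 : ∀ s, 0 < s → HasDerivAt Φ1 (Φ2 s) s)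
    (h3 : ContinuousOn Φ2 (Ioi 0)) {t : ℝ} (ht : t ∈ J) :
    HasDerivAt (fun s => ∫ x in a..b, Φ (u x s))
      (- (∫ x in a..b, Φ2 (u x t) * ux x t * (ux x t - χ * (u x t / v x t * vx x t)))
        + ∫ x in a..b, Φ1 (u x t) * (b1 x t - u x t * v x t)) t := by
  have hv0 : ∀ x ∈ Icc a b, v x t ≠ 0 := fun x hx => (S.rv.pos x hx t ht).ne'
  have k0 := slice S.ru.c0 ht
  have k1 := slice S.ru.c1 ht
  have k2 := slice S.ru.c2 ht
  have l0 := slice S.rv.c0 ht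
  have l1 := slice S.rv.c1 ht
  have l2 := slice S.rv.c2 ht
  have m1 := slice S.cb1 ht
  refine energy S.hab.le S.hJ S.ru h1 h2 h3 ht
    (j := fun x => ux x t - χ * (u x t / v x t * vx x t))
    (jx := fun x => uxx x t
      - χ * (ux x t / v x t * vx x t - u x t / v x t ^ 2 * vx x t ^ 2 + u x t / v x t * vxx x t))
    (g := fun x => b1 x t - u x t * v x t) ?_ ?_ ?_
    (by simp [S.rv.bca t ht, S.ru.bca t ht]) (by simp [S.rv.bcb t ht, S.ru.bcb t ht])
    (fun x hx => S.ueq x hx t ht)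
  · intro x hx
    have := hv0 x hx
    refine ((S.ru.dxx x hx t ht).sub ((((S.ru.dx x hx t ht).div (S.rv.dx x hx t ht) this).mul
      (S.rv.dxx x hx t ht)).const_mul χ)).congr_deriv ?_
    simp only [Pi.div_apply]
    field_simp
  · have : ∀ x ∈ Icc a b, v x t ^ 2 ≠ 0 := fun x hx => pow_ne_zero 2 (hv0 x hx)
    have q1 := k1.div l0 hv0
    have q2 := k0.div (l0.pow 2) this
    have q3 := k0.div l0 hv0
    exact k2.sub ((((q1.mul l1).sub (q2.mul (l1.pow 2))).add (q3.mul l2)).const_mul χ)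
  · exact m1.sub (k0.mul l0)

end

end Cr

namespace Cr

section
variable {a b χ M : ℝ} {J : Set ℝ} {u ux uxx ut v vx vxx vt b1 b2 : ℝ → ℝ → ℝ}

lemma Sys.deriv_mass_u (S : Sys a b χ M J u ux uxx ut v vx vxx vt b1 b2) {t : ℝ} (ht : t ∈ J) :
    HasDerivAt (fun s => ∫ x in a..b, u x s)
      (∫ x in a..b, (b1 x t - u x t * v x t)) t := by
  have := S.energy_u (Φ := fun s => s) (Φ1 := fun _ => 1) (Φ2 := fun _ => 0)
    (fun s _ => hasDerivAt_id s) (fun s _ => hasDerivAt_const s 1) continuousOn_const ht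
  simpa using this

lemma Sys.deriv_mass_v (S : Sys a b χ M J u ux uxx ut v vx vxx vt b1 b2) {t : ℝ} (ht : t ∈ J) :
    HasDerivAt (fun s => ∫ x in a..b, v x s)
      (∫ x in a..b, (u x t * v x t - v x t + b2 x t)) t := by
  have := S.energy_v (Φ := fun s => s) (Φ1 := fun _ => 1) (Φ2 := fun _ => 0)
    (fun s _ => hasDerivAt_id s) (fun s _ => hasDerivAt_const s 1) continuousOn_const ht
  simpa using this

lemma Sys.mass_u (S : Sys a b χ M J u ux uxx ut v vx vxx vt b1 b2) {δ : ℝ} (hδ : 0 < δ)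
    (hv : ∀ x ∈ Icc a b, ∀ t ∈ J, δ ≤ v x t) {t0 : ℝ} (ht0 : t0 ∈ J) :
    ∃ C : ℝ, 0 < C ∧ ∀ t ∈ J, t0 ≤ t → ∫ x in a..b, u x t ≤ C := by
  have hab := S.hab.le
  refine ⟨max (∫ x in a..b, u x t0) (M * (b - a) / δ) ⊔ 1, by positivity, fun t ht h =>
    le_sup_of_le_left ?_⟩
  refine ode S.hJc hδ ht0 (fun s hs => S.deriv_mass_u hs) (fun s hs _ => ?_) ht h
  have k0 := slice S.ru.c0 hs
  have l0 := slice S.rv.c0 hs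
  have m1 := slice S.cb1 hs
  have : ∫ x in a..b, (b1 x s - u x s * v x s) ≤ ∫ x in a..b, (M * 1 + (-δ) * u x s) := by
    refine int_mono hab (by fun_prop) (by fun_prop) fun x hx => ?_
    have h1 := (S.hb1 x hx s hs).2
    have h2 := mul_le_mul_of_nonneg_left (hv x hx s hs) (S.ru.pos x hx s hs).le
    linarith
  rw [int_lin2 hab M (-δ) (f := fun _ => 1) (by fun_prop) k0, int_one] at this
  linarith

lemma Sys.mass_v (S : Sys a b χ M J u ux uxx ut v vx vxx vt b1 b2) {δ : ℝ} (hδ : 0 < δ)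
    (hv : ∀ x ∈ Icc a b, ∀ t ∈ J, δ ≤ v x t) {t0 : ℝ} (ht0 : t0 ∈ J) :
    ∃ C : ℝ, 0 < C ∧ ∀ t ∈ J, t0 ≤ t → ∫ x in a..b, v x t ≤ C := by
  have hab := S.hab.le
  obtain ⟨C1, hC1, h1⟩ := S.mass_u hδ hv ht0
  refine ⟨max ((∫ x in a..b, u x t0) + ∫ x in a..b, v x t0) ((C1 + 2 * M * (b - a)) / 1) ⊔ 1,
    by positivity, fun t ht h => le_sup_of_le_left ?_⟩
  have key := ode S.hJc (F := fun s => (∫ x in a..b, u x s) + ∫ x in a..b, v x s) (c := 1)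
    (C := C1 + 2 * M * (b - a)) one_pos ht0
    (fun s hs => (S.deriv_mass_u hs).add (S.deriv_mass_v hs)) (fun s hs h => ?_) ht h
  · have : 0 ≤ ∫ x in a..b, u x t := int_nonneg hab fun x hx => (S.ru.pos x hx t ht).le
    linarith
  have k0 := slice S.ru.c0 hs
  have l0 := slice S.rv.c0 hs
  have m1 := slice S.cb1 hs
  have m2 := slice S.cb2 hs
  rw [← int_add hab (by fun_prop) (by fun_prop)]
  have : ∫ x in a..b, (b1 x s - u x s * v x s + (u x s * v x s - v x s + b2 x s))
      ≤ ∫ x in a..b, ((2 * M) * 1 + (-1) * v x s) := by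
    refine int_mono hab (by fun_prop) (by fun_prop) fun x hx => ?_
    have h1 := (S.hb1 x hx s hs).2
    have h2 := (S.hb2 x hx s hs).2
    linarith
  rw [int_lin2 hab (2*M) (-1) (f := fun _ => 1) (by fun_prop) l0, int_one] at this
  have := h1 s hs h
  linarith

lemma Sys.l2_v (S : Sys a b χ M J u ux uxx ut v vx vxx vt b1 b2) {δ : ℝ} (hδ : 0 < δ)
    (hv : ∀ x ∈ Icc a b, ∀ t ∈ J, δ ≤ v x t) {t0 : ℝ} (ht0 : t0 ∈ J) :
    ∃ C : ℝ, 0 < C ∧ ∀ t ∈ J, t0 ≤ t → ∫ x in a..b, v x t ^ 2 ≤ C := by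
  have hab := S.hab.le
  have hM : 0 ≤ M := (S.hb1 a (left_mem_Icc.2 hab) t0 ht0).1.trans
    (S.hb1 a (left_mem_Icc.2 hab) t0 ht0).2
  obtain ⟨C1, hC1, h1⟩ := S.mass_u hδ hv ht0
  obtain ⟨C2, hC2, h2⟩ := S.mass_v hδ hv ht0
  set ε := (2 * C1)⁻¹ with hε
  have hε0 : 0 < ε := by positivity
  set K := ((b - a)⁻¹ + ε⁻¹) ^ 2 * C2 ^ 2 with hK
  refine ⟨max (∫ x in a..b, v x t0 ^ 2) ((2 * C1 * K + 2 * M * C2) / 2) ⊔ 1, by positivity,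
    fun t ht h => le_sup_of_le_left ?_⟩
  refine ode S.hJc (F := fun s => ∫ x in a..b, v x s ^ 2) two_pos ht0 (fun s hs => S.energy_v
    (Φ := fun s => s ^ 2) (Φ1 := fun s => 2 * s) (Φ2 := fun _ => 2)
    (fun s _ => (hasDerivAt_pow 2 s).congr_deriv (by norm_num))
    (fun s _ => ((hasDerivAt_id s).const_mul 2).congr_deriv (by norm_num))
    continuousOn_const hs) (fun s hs h => ?_) ht h
  have k0 := slice S.ru.c0 hs
  have l0 := slice S.rv.c0 hs
  have l1 := slice S.rv.c1 hs
  have m2 := slice S.cb2 hs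
  set D := ∫ x in a..b, vx x s ^ 2 with hD
  have hD0 : 0 ≤ D := int_nonneg hab fun _ _ => sq_nonneg _
  have hvv : 0 ≤ ∫ x in a..b, v x s := int_nonneg hab fun x hx => (S.rv.pos x hx s hs).le
  have hsup : ∀ x ∈ Icc a b, v x s ^ 2 ≤ K + 2 * ε * D := by
    intro x hx
    refine (sob4 S.hab (fun x hx => S.rv.dx x hx s hs) l1
      (fun x hx => (S.rv.pos x hx s hs).le) hε0 hx).trans ?_
    rw [hK]
    gcongr
    exact h2 s hs h
  have e1 : ∫ x in a..b, (2:ℝ) * vx x s * vx x s = 2 * D := by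
    rw [hD, ← intervalIntegral.integral_const_mul]
    exact int_congr hab fun x _ => by ring
  have e2 : ∫ x in a..b, 2 * v x s * (u x s * v x s - v x s + b2 x s)
      ≤ ∫ x in a..b, (2 * (K + 2 * ε * D) * u x s + (-2) * v x s ^ 2 + (2 * M) * v x s) := by
    refine int_mono hab (by fun_prop) (by fun_prop) fun x hx => ?_
    have q1 := mul_le_mul_of_nonneg_left (hsup x hx) (S.ru.pos x hx s hs).le
    have q2 := mul_le_mul_of_nonneg_left (S.hb2 x hx s hs).2 (S.rv.pos x hx s hs).le
    linarith
  rw [int_lin3 hab (2 * (K + 2 * ε * D)) (-2) (2*M) (f := fun x => u x s)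
    (g := fun x => v x s ^ 2) (h := fun x => v x s) (by fun_prop) (by fun_prop) (by fun_prop)] at e2
  rw [e1]
  have e3 : 2 * (K + 2 * ε * D) * (∫ x in a..b, u x s) ≤ 2 * (K + 2 * ε * D) * C1 :=
    mul_le_mul_of_nonneg_left (h1 s hs h) (by positivity)
  have e4 : 2 * M * (∫ x in a..b, v x s) ≤ 2 * M * C2 :=
    mul_le_mul_of_nonneg_left (h2 s hs h) (by positivity)
  have e5 : 2 * (2 * ε * D) * C1 = 2 * D := by rw [hε]; field_simp
  have e6 : 2 * (K + 2 * ε * D) * C1 = 2 * C1 * K + 2 * (2 * ε * D) * C1 := by ring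
  linarith

end

end Cr

namespace Cr

section
variable {a b χ M : ℝ} {J : Set ℝ} {u ux uxx ut v vx vxx vt b1 b2 : ℝ → ℝ → ℝ}

/-- Interpolation `∫ f_x² ≤ ε ∫ f_xx² + (4ε)⁻¹ ∫ f²`. -/
lemma Reg.interp {f fx fxx ft : ℝ → ℝ → ℝ} (hab : a ≤ b) (R : Reg a b J f fx fxx ft) {t : ℝ}
    (ht : t ∈ J) {ε : ℝ} (hε : 0 < ε) :
    ∫ x in a..b, fx x t ^ 2
      ≤ ε * (∫ x in a..b, fxx x t ^ 2) + (4 * ε)⁻¹ * ∫ x in a..b, f x t ^ 2 := by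
  have k0 := slice R.c0 ht
  have k1 := slice R.c1 ht
  have k2 := slice R.c2 ht
  have i1 := ibp hab (f := fun x => f x t) (f' := fun x => fx x t)
      (g := fun x => fx x t) (g' := fun x => fxx x t)
      (fun x hx => R.dx x hx t ht) (fun x hx => R.dxx x hx t ht) k1 k2 (R.bca t ht) (R.bcb t ht)
  have e1 : ∫ x in a..b, fx x t ^ 2 = ∫ x in a..b, -1 * (f x t * fxx x t) := by
    rw [intervalIntegral.integral_const_mul, i1]
    simp [sq]
  rw [e1, ← int_lin2 hab ε (4 * ε)⁻¹ (f := fun x => fxx x t ^ 2) (g := fun x => f x t ^ 2)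
    (by fun_prop) (by fun_prop)]
  refine int_mono hab (by fun_prop) (by fun_prop) fun x _ => ?_
  have : ε * fxx x t ^ 2 + (4 * ε)⁻¹ * f x t ^ 2 - -1 * (f x t * fxx x t)
      = ε * (fxx x t + (2 * ε)⁻¹ * f x t) ^ 2 := by field_simp; ring
  nlinarith [mul_nonneg hε.le (sq_nonneg (fxx x t + (2 * ε)⁻¹ * f x t))]

lemma Sys.f2 (S : Sys a b χ M J u ux uxx ut v vx vxx vt b1 b2) {δ : ℝ} (hδ : 0 < δ)
    (hv : ∀ x ∈ Icc a b, ∀ t ∈ J, δ ≤ v x t) {t0 : ℝ} (ht0 : t0 ∈ J) {ε : ℝ} (hε : 0 < ε) :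
    ∃ K : ℝ, 0 < K ∧ ∀ t ∈ J, t0 ≤ t →
      ∫ x in a..b, vx x t ^ 2 ≤ ε * (∫ x in a..b, vxx x t ^ 2) + K := by
  obtain ⟨C3, hC3, h3⟩ := S.l2_v hδ hv ht0
  refine ⟨(4 * ε)⁻¹ * C3, by positivity, fun t ht h => ?_⟩
  refine (S.rv.interp S.hab.le ht hε).trans ?_
  gcongr
  exact h3 t ht h

lemma Sys.f1 (S : Sys a b χ M J u ux uxx ut v vx vxx vt b1 b2) {δ : ℝ} (hδ : 0 < δ)
    (hv : ∀ x ∈ Icc a b, ∀ t ∈ J, δ ≤ v x t) {t0 : ℝ} (ht0 : t0 ∈ J) {ε : ℝ} (hε : 0 < ε) :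
    ∃ K : ℝ, 0 < K ∧ ∀ t ∈ J, t0 ≤ t → ∀ x ∈ Icc a b,
      vx x t ^ 2 ≤ ε * (∫ x in a..b, vxx x t ^ 2) + K := by
  have hl : 0 < b - a := sub_pos.2 S.hab
  set c := (b - a)⁻¹ + (ε/2)⁻¹ with hc
  have hc0 : 0 < c := by positivity
  obtain ⟨K, hK, h2⟩ := S.f2 hδ hv ht0 (ε := ε / 2 / c) (by positivity)
  refine ⟨c * K, by positivity, fun t ht h x hx => ?_⟩
  have h1 := sob3 S.hab (fun x hx => S.rv.dxx x hx t ht) (slice S.rv.c2 ht)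
    (ε := ε / 2) (by positivity) hx
  have h3 := mul_le_mul_of_nonneg_left (h2 t ht h) hc0.le
  have e : c * (ε / 2 / c * (∫ x in a..b, vxx x t ^ 2) + K)
      = ε / 2 * (∫ x in a..b, vxx x t ^ 2) + c * K := by field_simp
  rw [e] at h3
  linarith

lemma Sys.supu (S : Sys a b χ M J u ux uxx ut v vx vxx vt b1 b2) {δ : ℝ} (hδ : 0 < δ)
    (hv : ∀ x ∈ Icc a b, ∀ t ∈ J, δ ≤ v x t) {t0 : ℝ} (ht0 : t0 ∈ J) :
    ∃ K : ℝ, 0 < K ∧ ∀ t ∈ J, t0 ≤ t → ∀ x ∈ Icc a b,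
      u x t ^ 2 ≤ K * (∫ x in a..b, ux x t ^ 2 / u x t) + K := by
  have hl : 0 < b - a := sub_pos.2 S.hab
  have hab := S.hab.le
  obtain ⟨C1, hC1, h1⟩ := S.mass_u hδ hv ht0
  refine ⟨2 * C1 + 2 * ((b - a)⁻¹ * C1) ^ 2, by positivity, fun t ht h x hx => ?_⟩
  have k0 := slice S.ru.c0 ht
  have k1 := slice S.ru.c1 ht
  have up : ∀ x ∈ Icc a b, 0 < u x t := fun x hx => S.ru.pos x hx t ht
  have s1 := sob1 S.hab (fun x hx => S.ru.dx x hx t ht) k1 hx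
  have sq0 : ContinuousOn (fun x => √(u x t)) (Icc a b) := k0.sqrt
  have s2 := cs hab (f := fun x => √(u x t)) (g := fun x => |ux x t| / √(u x t)) sq0
    (k1.abs.div sq0 fun x hx => (sqrt_pos.2 (up x hx)).ne')
  have e1 : ∫ x in a..b, √(u x t) * (|ux x t| / √(u x t)) = ∫ x in a..b, |ux x t| :=
    int_congr hab fun x hx => mul_div_cancel₀ _ (sqrt_pos.2 (up x hx)).ne'
  have e2 : ∫ x in a..b, √(u x t) ^ 2 = ∫ x in a..b, u x t :=
    int_congr hab fun x hx => sq_sqrt (up x hx).le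
  have e3 : ∫ x in a..b, (|ux x t| / √(u x t)) ^ 2 = ∫ x in a..b, ux x t ^ 2 / u x t :=
    int_congr hab fun x hx => by rw [div_pow, sq_sqrt (up x hx).le, sq_abs]
  simp only [e1, e2, e3] at s2
  set I := ∫ x in a..b, ux x t ^ 2 / u x t with hI
  have hI0 : 0 ≤ I := int_nonneg hab fun x hx => div_nonneg (sq_nonneg _) (up x hx).le
  set A := ∫ x in a..b, |ux x t| with hA
  have hA0 : 0 ≤ A := int_nonneg hab fun x hx => abs_nonneg _
  have s3 : A ^ 2 ≤ C1 * I := s2.trans (mul_le_mul_of_nonneg_right (h1 t ht h) hI0)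
  have s4 : u x t ≤ (b - a)⁻¹ * C1 + A :=
    s1.trans (by gcongr; exact h1 t ht h)
  have s5 : u x t ^ 2 ≤ ((b - a)⁻¹ * C1 + A) ^ 2 := pow_le_pow_left₀ (up x hx).le s4 2
  nlinarith [sq_nonneg ((b - a)⁻¹ * C1 - A), mul_nonneg (sq_nonneg ((b - a)⁻¹ * C1)) hI0]

lemma Sys.f4 (S : Sys a b χ M J u ux uxx ut v vx vxx vt b1 b2) {δ : ℝ} (hδ : 0 < δ)
    (hv : ∀ x ∈ Icc a b, ∀ t ∈ J, δ ≤ v x t) {t0 : ℝ} (ht0 : t0 ∈ J) :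
    ∃ K : ℝ, 0 < K ∧ ∀ t ∈ J, t0 ≤ t →
      ∫ x in a..b, u x t ^ 2 ≤ (∫ x in a..b, ux x t ^ 2 / u x t) + K := by
  have hab := S.hab.le
  obtain ⟨C1, hC1, h1⟩ := S.mass_u hδ hv ht0
  obtain ⟨K, hK, h2⟩ := S.supu hδ hv ht0
  set β := (C1 * K)⁻¹ with hβ
  have hβ0 : 0 < β := by positivity
  refine ⟨C1 * (β * K + (4 * β)⁻¹), by positivity, fun t ht h => ?_⟩
  have k0 := slice S.ru.c0 ht
  have up : ∀ x ∈ Icc a b, 0 < u x t := fun x hx => S.ru.pos x hx t ht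
  set I := ∫ x in a..b, ux x t ^ 2 / u x t with hI
  have hI0 : 0 ≤ I := int_nonneg hab fun x hx => div_nonneg (sq_nonneg _) (up x hx).le
  have e1 : ∫ x in a..b, u x t ^ 2 ≤ ∫ x in a..b, (β * (K * I + K) + (4 * β)⁻¹) * u x t := by
    refine int_mono hab (by fun_prop) (by fun_prop) fun x hx => ?_
    have q1 : u x t ≤ β * u x t ^ 2 + (4 * β)⁻¹ := by
      have : β * u x t ^ 2 + (4 * β)⁻¹ - u x t = β * (u x t - (2 * β)⁻¹) ^ 2 := by
        field_simp; ring
      nlinarith [mul_nonneg hβ0.le (sq_nonneg (u x t - (2 * β)⁻¹))]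
    have q2 := mul_le_mul_of_nonneg_left (h2 t ht h x hx) hβ0.le
    rw [sq]
    exact mul_le_mul_of_nonneg_right (by linarith) (up x hx).le
  rw [intervalIntegral.integral_const_mul] at e1
  have e2 : (β * (K * I + K) + (4 * β)⁻¹) * (∫ x in a..b, u x t)
      ≤ (β * (K * I + K) + (4 * β)⁻¹) * C1 :=
    mul_le_mul_of_nonneg_left (h1 t ht h) (by positivity)
  have e3 : (β * (K * I + K) + (4 * β)⁻¹) * C1 = I + C1 * (β * K + (4 * β)⁻¹) := by
    have : β * (K * I) * C1 = I := by rw [hβ]; field_simp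
    linear_combination this
  linarith

lemma Sys.supv4 (S : Sys a b χ M J u ux uxx ut v vx vxx vt b1 b2) {δ : ℝ} (hδ : 0 < δ)
    (hv : ∀ x ∈ Icc a b, ∀ t ∈ J, δ ≤ v x t) {t0 : ℝ} (ht0 : t0 ∈ J) :
    ∃ K : ℝ, 0 < K ∧ ∀ t ∈ J, t0 ≤ t → ∀ x ∈ Icc a b,
      v x t ^ 4 ≤ K * (∫ x in a..b, vx x t ^ 2) + K := by
  have hl : 0 < b - a := sub_pos.2 S.hab
  have hab := S.hab.le
  obtain ⟨C3, hC3, h3⟩ := S.l2_v hδ hv ht0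
  refine ⟨8 * C3 + 2 * ((b - a)⁻¹ * C3) ^ 2, by positivity, fun t ht h x hx => ?_⟩
  have s1 := sob2 S.hab (fun x hx => S.rv.dx x hx t ht) (slice S.rv.c1 ht) hx
  set D := ∫ x in a..b, vx x t ^ 2
  have hD0 : 0 ≤ D := int_nonneg hab fun _ _ => sq_nonneg _
  have s2 : v x t ^ 2 ≤ (b - a)⁻¹ * C3 + 2 * √(C3 * D) := by
    refine s1.trans ?_
    have := h3 t ht h
    gcongr
  have s3 : (v x t ^ 2) ^ 2 ≤ ((b - a)⁻¹ * C3 + 2 * √(C3 * D)) ^ 2 :=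
    pow_le_pow_left₀ (sq_nonneg _) s2 2
  have s4 : √(C3 * D) ^ 2 = C3 * D := sq_sqrt (by positivity)
  nlinarith [sq_nonneg ((b - a)⁻¹ * C3 - 2 * √(C3 * D)),
    mul_nonneg (sq_nonneg ((b - a)⁻¹ * C3)) hD0]

lemma Sys.f3 (S : Sys a b χ M J u ux uxx ut v vx vxx vt b1 b2) {δ : ℝ} (hδ : 0 < δ)
    (hv : ∀ x ∈ Icc a b, ∀ t ∈ J, δ ≤ v x t) {t0 : ℝ} (ht0 : t0 ∈ J) {ε : ℝ} (hε : 0 < ε) :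
    ∃ K : ℝ, 0 < K ∧ ∀ t ∈ J, t0 ≤ t →
      ∫ x in a..b, (u x t * v x t) ^ 2 ≤ ε * (∫ x in a..b, ux x t ^ 2 / u x t)
        + ε * (∫ x in a..b, vxx x t ^ 2) + K := by
  have hab := S.hab.le
  obtain ⟨C1, hC1, h1⟩ := S.mass_u hδ hv ht0
  obtain ⟨Ku, hKu, hu⟩ := S.supu hδ hv ht0
  obtain ⟨Kv, hKv, hv4⟩ := S.supv4 hδ hv ht0
  set α := ε / (C1 * Ku) with hα
  have hα0 : 0 < α := by positivity
  obtain ⟨Kd, hKd, hd⟩ := S.f2 hδ hv ht0 (ε := ε / (C1 * (α⁻¹ * Kv))) (by positivity)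
  refine ⟨C1 * (α * Ku + α⁻¹ * (Kv * Kd + Kv)), by positivity, fun t ht h => ?_⟩
  have k0 := slice S.ru.c0 ht
  have l0 := slice S.rv.c0 ht
  have up : ∀ x ∈ Icc a b, 0 < u x t := fun x hx => S.ru.pos x hx t ht
  set I := ∫ x in a..b, ux x t ^ 2 / u x t with hI
  have hI0 : 0 ≤ I := int_nonneg hab fun x hx => div_nonneg (sq_nonneg _) (up x hx).le
  set D := ∫ x in a..b, vx x t ^ 2 with hD
  have hD0 : 0 ≤ D := int_nonneg hab fun _ _ => sq_nonneg _
  set H := ∫ x in a..b, vxx x t ^ 2 with hH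
  set Q := α * (Ku * I + Ku) + α⁻¹ * (Kv * D + Kv) with hQ
  have e1 : ∫ x in a..b, (u x t * v x t) ^ 2 ≤ ∫ x in a..b, Q * u x t := by
    refine int_mono hab (by fun_prop) (by fun_prop) fun x hx => ?_
    have q1 : u x t * v x t ^ 2 ≤ α * u x t ^ 2 + α⁻¹ * v x t ^ 4 := by
      have : α * u x t ^ 2 + α⁻¹ * v x t ^ 4 - u x t * v x t ^ 2
        = α * (u x t - (2 * α)⁻¹ * v x t ^ 2) ^ 2 + 3 / 4 * (α⁻¹ * v x t ^ 4) := by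
        field_simp; ring
      have p1 := mul_nonneg hα0.le (sq_nonneg (u x t - (2 * α)⁻¹ * v x t ^ 2))
      have p2 : 0 ≤ 3 / 4 * (α⁻¹ * v x t ^ 4) := by positivity
      linarith
    have q2 := mul_le_mul_of_nonneg_left (hu t ht h x hx) hα0.le
    have q3 := mul_le_mul_of_nonneg_left (hv4 t ht h x hx) (inv_pos.2 hα0).le
    have q4 : (u x t * v x t) ^ 2 = (u x t * v x t ^ 2) * u x t := by ring
    rw [q4]
    exact mul_le_mul_of_nonneg_right (by linarith) (up x hx).le
  rw [intervalIntegral.integral_const_mul] at e1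
  have e2 : Q * (∫ x in a..b, u x t) ≤ Q * C1 :=
    mul_le_mul_of_nonneg_left (h1 t ht h) (by positivity)
  have e3 : C1 * (α⁻¹ * Kv) * D ≤ C1 * (α⁻¹ * Kv) * (ε / (C1 * (α⁻¹ * Kv)) * H + Kd) :=
    mul_le_mul_of_nonneg_left (hd t ht h) (by positivity)
  have e4 : C1 * (α⁻¹ * Kv) * (ε / (C1 * (α⁻¹ * Kv)) * H + Kd)
      = ε * H + C1 * (α⁻¹ * Kv) * Kd := by
    have : C1 * (α⁻¹ * Kv) ≠ 0 := by positivity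
    generalize C1 * (α⁻¹ * Kv) = z at *
    field_simp
  have e5 : α * (Ku * I) * C1 = ε * I := by rw [hα]; field_simp
  have e6 : Q * C1 = α * (Ku * I) * C1 + C1 * (α⁻¹ * Kv) * D
    + C1 * (α * Ku + α⁻¹ * Kv) := by rw [hQ]; ring
  rw [e4] at e3
  linarith

end

end Cr

namespace Cr

section
variable {a b χ M : ℝ} {J : Set ℝ} {u ux uxx ut v vx vxx vt b1 b2 : ℝ → ℝ → ℝ}

lemma Sys.nonneg_M (S : Sys a b χ M J u ux uxx ut v vx vxx vt b1 b2) {t0 : ℝ} (ht0 : t0 ∈ J) :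
    0 ≤ M :=
  (S.hb1 a (left_mem_Icc.2 S.hab.le) t0 ht0).1.trans (S.hb1 a (left_mem_Icc.2 S.hab.le) t0 ht0).2

lemma Sys.ent1 (S : Sys a b χ M J u ux uxx ut v vx vxx vt b1 b2) {δ : ℝ} (hδ : 0 < δ)
    (hv : ∀ x ∈ Icc a b, ∀ t ∈ J, δ ≤ v x t) (hχ : 0 < χ) {t0 : ℝ} (ht0 : t0 ∈ J) :
    ∃ (Y Y' : ℝ → ℝ) (C : ℝ), 0 < C ∧ (∀ t ∈ J, HasDerivAt Y (Y' t) t) ∧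
      (∀ t ∈ J, Y t = ∫ x in a..b, u x t * log (u x t)) ∧
      ∀ t ∈ J, t0 ≤ t → Y' t ≤ - (1/2) * (∫ x in a..b, ux x t ^ 2 / u x t)
        + 1/8 * (∫ x in a..b, vxx x t ^ 2) + C := by
  have hab := S.hab.le
  have hM := S.nonneg_M ht0
  obtain ⟨C1, hC1, h1⟩ := S.mass_u hδ hv ht0
  obtain ⟨C2, hC2, h2⟩ := S.mass_v hδ hv ht0
  set c := χ ^ 2 / (2 * δ ^ 2) with hc
  have hc0 : 0 < c := by positivity
  obtain ⟨K, hK, hf1⟩ := S.f1 hδ hv ht0 (ε := 1 / (8 * (c * C1))) (by positivity)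
  refine ⟨fun s => ∫ x in a..b, u x s * log (u x s), _, c * C1 * K + M * C1 + C2, by positivity,
    fun s hs => S.energy_u (Φ := fun s => s * log s) (Φ1 := fun s => log s + 1)
      (Φ2 := fun s => s⁻¹) (fun s hs => (hasDerivAt_mul_log hs.ne'))
      (fun s hs => (hasDerivAt_log hs.ne').add_const 1)
      (continuousOn_id.inv₀ fun s hs => (ne_of_gt hs)) hs, fun _ _ => rfl, fun s hs h => ?_⟩
  have k0 := slice S.ru.c0 hs
  have k1 := slice S.ru.c1 hs
  have l0 := slice S.rv.c0 hs
  have l1 := slice S.rv.c1 hs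
  have m1 := slice S.cb1 hs
  have up : ∀ x ∈ Icc a b, 0 < u x s := fun x hx => S.ru.pos x hx s hs
  have vp : ∀ x ∈ Icc a b, 0 < v x s := fun x hx => S.rv.pos x hx s hs
  have up' : ∀ x ∈ Icc a b, u x s ≠ 0 := fun x hx => (up x hx).ne'
  have vp' : ∀ x ∈ Icc a b, v x s ≠ 0 := fun x hx => (vp x hx).ne'
  set H := ∫ x in a..b, vxx x s ^ 2 with hH
  set B := 1 / (8 * (c * C1)) * H + K with hB
  have hH0 : 0 ≤ H := int_nonneg hab fun _ _ => sq_nonneg _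
  have hB0 : 0 ≤ B := by positivity
  have ci : ContinuousOn (fun x => (u x s)⁻¹) (Icc a b) := k0.inv₀ up'
  have cvi : ContinuousOn (fun x => (v x s)⁻¹) (Icc a b) := l0.inv₀ vp'
  have cl : ContinuousOn (fun x => log (u x s)) (Icc a b) := k0.log up'
  have e1 : ∫ x in a..b, ((1/2) * (ux x s ^ 2 / u x s) + (-(c * B)) * u x s)
      ≤ ∫ x in a..b, (u x s)⁻¹ * ux x s * (ux x s - χ * (u x s / v x s * vx x s)) := by
    simp only [div_eq_mul_inv]
    refine int_mono hab (by fun_prop) (by fun_prop) fun x hx => ?_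
    have hu := up x hx
    have hvx := vp x hx
    have q1 : c * vx x s ^ 2 ≤ c * B := mul_le_mul_of_nonneg_left (hf1 s hs h x hx) hc0.le
    have q2 : χ ^ 2 / (2 * v x s ^ 2) ≤ c := by
      rw [hc]
      have := hv x hx s hs
      gcongr
    have q3 := mul_le_mul_of_nonneg_right q2 (sq_nonneg (vx x s))
    have q4 : χ ^ 2 / (2 * v x s ^ 2) * vx x s ^ 2 * u x s ≤ c * B * u x s :=
      mul_le_mul_of_nonneg_right (q3.trans q1) hu.le
    have e : (u x s)⁻¹ * ux x s * (ux x s - χ * (u x s * (v x s)⁻¹ * vx x s))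
        - (1 * 2⁻¹ * (ux x s ^ 2 * (u x s)⁻¹) - χ ^ 2 / (2 * v x s ^ 2) * vx x s ^ 2 * u x s)
        = (u x s)⁻¹ / 2 * (ux x s - χ * u x s * vx x s * (v x s)⁻¹) ^ 2 := by
      field_simp; ring
    have q5 : 0 ≤ (u x s)⁻¹ / 2 * (ux x s - χ * u x s * vx x s * (v x s)⁻¹) ^ 2 := by positivity
    linarith
  have cI : ContinuousOn (fun x => ux x s ^ 2 / u x s) (Icc a b) := (k1.pow 2).div k0 up'
  rw [int_lin2 hab (1/2) (-(c*B)) cI k0] at e1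
  have e2 : ∫ x in a..b, (log (u x s) + 1) * (b1 x s - u x s * v x s)
      ≤ ∫ x in a..b, (M * u x s + 1 * v x s) := by
    refine int_mono hab (by fun_prop) (by fun_prop) fun x hx => ?_
    have hu := up x hx
    have hvx := vp x hx
    have q1 : log (u x s) + 1 ≤ u x s := by linarith [log_le_sub_one_of_pos hu]
    have q2 : -(u x s * (log (u x s) + 1)) ≤ 1 := by
      have := log_le_sub_one_of_pos (inv_pos.2 hu)
      rw [log_inv] at this
      have h3 := mul_le_mul_of_nonneg_left this hu.le
      rw [mul_sub, mul_inv_cancel₀ hu.ne'] at h3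
      linarith
    have q3 := mul_le_mul_of_nonneg_right q1 (S.hb1 x hx s hs).1
    have q4 := mul_le_mul_of_nonneg_left (S.hb1 x hx s hs).2 hu.le
    have q5 := mul_le_mul_of_nonneg_right q2 hvx.le
    linarith
  rw [int_lin2 hab M 1 k0 l0] at e2
  have e3 : c * B * (∫ x in a..b, u x s) ≤ c * B * C1 :=
    mul_le_mul_of_nonneg_left (h1 s hs h) (by positivity)
  have e4 : M * (∫ x in a..b, u x s) ≤ M * C1 := mul_le_mul_of_nonneg_left (h1 s hs h) hM
  have e5 : c * B * C1 = 1/8 * H + c * C1 * K := by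
    rw [hB]
    field_simp
  have := h2 s hs h
  linarith

lemma Sys.ent2 (S : Sys a b χ M J u ux uxx ut v vx vxx vt b1 b2) {δ : ℝ} (hδ : 0 < δ)
    (hv : ∀ x ∈ Icc a b, ∀ t ∈ J, δ ≤ v x t) {t0 : ℝ} (ht0 : t0 ∈ J) :
    ∃ C : ℝ, 0 < C ∧ 
      ∀ t ∈ J, t0 ≤ t → ∫ x in a..b, -(2 * (vt x t * vxx x t)) ≤
        1/4 * (∫ x in a..b, ux x t ^ 2 / u x t)
        - 3/4 * (∫ x in a..b, vxx x t ^ 2) + C := by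
  have hab := S.hab.le
  have hl : 0 < b - a := sub_pos.2 S.hab
  have hM := S.nonneg_M ht0
  obtain ⟨C3, hC3, h3⟩ := S.l2_v hδ hv ht0
  obtain ⟨K, hK, hf3⟩ := S.f3 hδ hv ht0 (ε := 1 / 12) (by positivity)
  refine ⟨3 * K + 3 * C3 + 3 * M ^ 2 * (b - a), by positivity, fun s hs h => ?_⟩
  have k0 := slice S.ru.c0 hs
  have l0 := slice S.rv.c0 hs
  have l2 := slice S.rv.c2 hs
  have lt := slice S.rv.ct hs
  have m1 := slice S.cb1 hs
  have e1 : ∫ x in a..b, -(2 * (vt x s * vxx x s)) ≤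
      ∫ x in a..b, ((-1) * vxx x s ^ 2 + 3 * (u x s * v x s) ^ 2 + 3 * v x s ^ 2
        + (3 * M ^ 2) * 1) := by
    refine int_mono hab (by fun_prop) (by fun_prop) fun x hx => ?_
    rw [S.veq x hx s hs]
    obtain ⟨p1, p2⟩ := S.hb2 x hx s hs
    have p3 : b2 x s ^ 2 ≤ M ^ 2 := pow_le_pow_left₀ p1 p2 2
    generalize u x s * v x s = w
    nlinarith [sq_nonneg (vxx x s + (w - v x s + b2 x s)), sq_nonneg (w + v x s),
      sq_nonneg (w - b2 x s), sq_nonneg (v x s + b2 x s)]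
  rw [int_lin4 hab (-1) 3 3 (3 * M^2) (f := fun x => vxx x s ^ 2)
    (g := fun x => (u x s * v x s)^2) (h := fun x => v x s ^ 2) (k := fun _ => 1) (by fun_prop)
    (by fun_prop) (by fun_prop) (by fun_prop), int_one] at e1
  have := hf3 s hs h
  have := h3 s hs h
  linarith

lemma Sys.ent (S : Sys a b χ M J u ux uxx ut v vx vxx vt b1 b2) {δ : ℝ} (hδ : 0 < δ)
    (hv : ∀ x ∈ Icc a b, ∀ t ∈ J, δ ≤ v x t) (hχ : 0 < χ) {t0 : ℝ} (ht0 : t0 ∈ J) :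
    ∃ (Y Y' : ℝ → ℝ) (C : ℝ), 0 < C ∧ (∀ t ∈ J, HasDerivAt Y (Y' t) t) ∧
      (∀ t ∈ J, t0 ≤ t → Y' t ≤ - (1/16) * Y t - 1/16 * (∫ x in a..b, vxx x t ^ 2) + C) ∧
      (∀ t ∈ J, 1/2 * (∫ x in a..b, vx x t ^ 2) - (b - a) ≤ Y t) := by
  have hab := S.hab.le
  obtain ⟨Y, Y', C1, hC1, hY, hYe, hY'⟩ := S.ent1 hδ hv hχ ht0
  obtain ⟨C2, hC2, h2⟩ := S.ent2 hδ hv ht0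
  obtain ⟨C3, hC3, h3⟩ := S.f2 hδ hv ht0 (ε := 1) one_pos
  obtain ⟨C4, hC4, h4⟩ := S.f4 hδ hv ht0
  refine ⟨fun s => Y s + 1/2 * ∫ x in a..b, vx x s ^ 2,
    fun s => Y' s + 1/2 * ∫ x in a..b, -(2 * (vt x s * vxx x s)), C1 + C2 + C3 + C4, by positivity,
    fun s hs => (hY s hs).add ((h1_deriv hab S.hJ S.rv hs).const_mul _), fun s hs h => ?_,
    fun s hs => ?_⟩
  · have up : ∀ x ∈ Icc a b, 0 < u x s := fun x hx => S.ru.pos x hx s hs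
    have k0 := slice S.ru.c0 hs
    have cl : ContinuousOn (fun x => log (u x s)) (Icc a b) := k0.log fun x hx => (up x hx).ne'
    have e1 : Y s ≤ ∫ x in a..b, u x s ^ 2 := by
      rw [hYe s hs]
      refine int_mono hab (by fun_prop) (by fun_prop) fun x hx => ?_
      rw [sq]
      exact mul_le_mul_of_nonneg_left (by linarith [log_le_sub_one_of_pos (up x hx)]) (up x hx).le
    have a1 := hY' s hs h
    have a2 := h2 s hs h
    have a3 := h3 s hs h
    have a4 := h4 s hs h
    have hI0 : 0 ≤ ∫ x in a..b, ux x s ^ 2 / u x s :=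
      int_nonneg hab fun x hx => div_nonneg (sq_nonneg _) (up x hx).le
    have hH0 : 0 ≤ ∫ x in a..b, vxx x s ^ 2 := int_nonneg hab fun _ _ => sq_nonneg _
    simp only
    linarith
  · have up : ∀ x ∈ Icc a b, 0 < u x s := fun x hx => S.ru.pos x hx s hs
    have k0 := slice S.ru.c0 hs
    have cl : ContinuousOn (fun x => log (u x s)) (Icc a b) := k0.log fun x hx => (up x hx).ne'
    have e1 : ∫ x in a..b, (-1) * (1:ℝ) ≤ Y s := by
      rw [hYe s hs]
      refine int_mono hab (by fun_prop) (by fun_prop) fun x hx => ?_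
      have hu := up x hx
      have := log_le_sub_one_of_pos (inv_pos.2 hu)
      rw [log_inv] at this
      have h3 := mul_le_mul_of_nonneg_left this hu.le
      rw [mul_sub, mul_inv_cancel₀ hu.ne'] at h3
      linarith
    rw [intervalIntegral.integral_const_mul, int_one] at e1
    simp only
    linarith

/-- `L²` bound for `v_x` and `L^∞` bound for `v`. -/
lemma Sys.grad_v (S : Sys a b χ M J u ux uxx ut v vx vxx vt b1 b2) {δ : ℝ} (hδ : 0 < δ)
    (hv : ∀ x ∈ Icc a b, ∀ t ∈ J, δ ≤ v x t) (hχ : 0 < χ) {t0 : ℝ} (ht0 : t0 ∈ J) :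
    ∃ C : ℝ, 0 < C ∧ ∀ t ∈ J, t0 ≤ t → ∫ x in a..b, vx x t ^ 2 ≤ C := by
  obtain ⟨Y, Y', C, hC, hY, hY', hYl⟩ := S.ent hδ hv hχ ht0
  refine ⟨(2 * (max (Y t0) (C / (1/16)) + (b - a))) ⊔ 1, by positivity,
    fun t ht h => le_sup_of_le_left ?_⟩
  have := ode S.hJc (c := 1/16) (C := C) (by norm_num) ht0 hY (fun s hs h => by
    have hH0 : 0 ≤ ∫ x in a..b, vxx x s ^ 2 := int_nonneg S.hab.le fun _ _ => sq_nonneg _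
    linarith [hY' s hs h]) ht h
  linarith [hYl t ht]

lemma Sys.sup_v (S : Sys a b χ M J u ux uxx ut v vx vxx vt b1 b2) {δ : ℝ} (hδ : 0 < δ)
    (hv : ∀ x ∈ Icc a b, ∀ t ∈ J, δ ≤ v x t) (hχ : 0 < χ) {t0 : ℝ} (ht0 : t0 ∈ J) :
    ∃ C : ℝ, 0 < C ∧ ∀ t ∈ J, t0 ≤ t → ∀ x ∈ Icc a b, v x t ^ 2 ≤ C := by
  have hl : 0 < b - a := sub_pos.2 S.hab
  obtain ⟨C, hC, h1⟩ := S.grad_v hδ hv hχ ht0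
  obtain ⟨C3, hC3, h3⟩ := S.l2_v hδ hv ht0
  refine ⟨((b - a)⁻¹ + 1⁻¹) * C3 + 1 * C, by positivity, fun t ht h x hx => ?_⟩
  refine (sob3 S.hab (fun x hx => S.rv.dx x hx t ht) (slice S.rv.c1 ht) one_pos hx).trans ?_
  have := h1 t ht h
  have := h3 t ht h
  gcongr

/-- `L²` bound for `u`. -/
lemma Sys.l2_u (S : Sys a b χ M J u ux uxx ut v vx vxx vt b1 b2) {δ : ℝ} (hδ : 0 < δ)
    (hv : ∀ x ∈ Icc a b, ∀ t ∈ J, δ ≤ v x t) (hχ : 0 < χ) {t0 : ℝ} (ht0 : t0 ∈ J) :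
    ∃ C : ℝ, 0 < C ∧ ∀ t ∈ J, t0 ≤ t → ∫ x in a..b, u x t ^ 2 ≤ C := by
  have hab := S.hab.le
  have hl : 0 < b - a := sub_pos.2 S.hab
  have hM := S.nonneg_M ht0
  obtain ⟨C1, hC1, h1⟩ := S.mass_u hδ hv ht0
  obtain ⟨C4, hC4, h4⟩ := S.grad_v hδ hv hχ ht0
  set c := χ ^ 2 / δ ^ 2 with hc
  have hc0 : 0 < c := by positivity
  set L := c * C4 + (b - a) with hL
  have hL0 : 0 < L := by positivity
  set ε := (2 * L)⁻¹ with hε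
  have hε0 : 0 < ε := by positivity
  set K := ((b - a)⁻¹ + ε⁻¹) ^ 2 * C1 ^ 2 with hK
  refine ⟨max (∫ x in a..b, u x t0 ^ 2) ((L * K + 2 * M * C1) / 1) ⊔ 1, by positivity,
    fun t ht h => le_sup_of_le_left ?_⟩
  refine ode S.hJc (F := fun s => ∫ x in a..b, u x s ^ 2) one_pos ht0 (fun s hs => S.energy_u
    (Φ := fun s => s ^ 2) (Φ1 := fun s => 2 * s) (Φ2 := fun _ => 2)
    (fun s _ => (hasDerivAt_pow 2 s).congr_deriv (by norm_num))
    (fun s _ => ((hasDerivAt_id s).const_mul 2).congr_deriv (by norm_num))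
    continuousOn_const hs) (fun s hs h => ?_) ht h
  have k0 := slice S.ru.c0 hs
  have k1 := slice S.ru.c1 hs
  have l0 := slice S.rv.c0 hs
  have l1 := slice S.rv.c1 hs
  have m1 := slice S.cb1 hs
  have up : ∀ x ∈ Icc a b, 0 < u x s := fun x hx => S.ru.pos x hx s hs
  have vp : ∀ x ∈ Icc a b, 0 < v x s := fun x hx => S.rv.pos x hx s hs
  have cvi : ContinuousOn (fun x => (v x s)⁻¹) (Icc a b) := l0.inv₀ fun x hx => (vp x hx).ne'
  set Z := ∫ x in a..b, ux x s ^ 2 with hZ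
  have hZ0 : 0 ≤ Z := int_nonneg hab fun _ _ => sq_nonneg _
  have hm0 : 0 ≤ ∫ x in a..b, u x s := int_nonneg hab fun x hx => (up x hx).le
  set Q := K + 2 * ε * Z with hQ
  have hQ0 : 0 ≤ Q := by positivity
  have hsup : ∀ x ∈ Icc a b, u x s ^ 2 ≤ Q := by
    intro x hx
    refine (sob4 S.hab (fun x hx => S.ru.dx x hx s hs) k1
      (fun x hx => (up x hx).le) hε0 hx).trans ?_
    rw [hQ, hK]
    gcongr
    exact h1 s hs h
  have e1 : ∫ x in a..b, (1 * ux x s ^ 2 + (-(c * Q)) * vx x s ^ 2)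
      ≤ ∫ x in a..b, 2 * ux x s * (ux x s - χ * (u x s / v x s * vx x s)) := by
    simp only [div_eq_mul_inv]
    refine int_mono hab (by fun_prop) (by fun_prop) fun x hx => ?_
    have q2 : χ ^ 2 / v x s ^ 2 ≤ c := by
      rw [hc]
      have := hv x hx s hs
      gcongr
    have q3 : χ ^ 2 / v x s ^ 2 * u x s ^ 2 ≤ c * Q :=
      mul_le_mul q2 (hsup x hx) (sq_nonneg _) hc0.le
    have q4 := mul_le_mul_of_nonneg_right q3 (sq_nonneg (vx x s))
    have := (vp x hx).ne'
    have e : 2 * ux x s * (ux x s - χ * (u x s * (v x s)⁻¹ * vx x s))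
        - (1 * ux x s ^ 2 - χ ^ 2 / v x s ^ 2 * u x s ^ 2 * vx x s ^ 2)
        = (ux x s - χ * u x s * vx x s * (v x s)⁻¹) ^ 2 := by
      field_simp; ring
    nlinarith [sq_nonneg (ux x s - χ * u x s * vx x s * (v x s)⁻¹)]
  rw [int_lin2 hab 1 (-(c*Q)) (f := fun x => ux x s ^ 2) (g := fun x => vx x s ^ 2)
    (by fun_prop) (by fun_prop)] at e1
  have e2 : ∫ x in a..b, 2 * u x s * (b1 x s - u x s * v x s)
      ≤ ∫ x in a..b, (2 * M) * u x s := by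
    refine int_mono hab (by fun_prop) (by fun_prop) fun x hx => ?_
    have hu := up x hx
    have hvx := vp x hx
    have q4 := mul_le_mul_of_nonneg_left (S.hb1 x hx s hs).2 hu.le
    have : 0 ≤ u x s * u x s * v x s := by positivity
    linarith
  rw [intervalIntegral.integral_const_mul] at e2
  have e3 : ∫ x in a..b, u x s ^ 2 ≤ ∫ x in a..b, Q * 1 :=
    int_mono hab (by fun_prop) (by fun_prop) fun x hx => by linarith [hsup x hx]
  rw [intervalIntegral.integral_const_mul, int_one] at e3
  have e4 : c * Q * (∫ x in a..b, vx x s ^ 2) ≤ c * Q * C4 :=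
    mul_le_mul_of_nonneg_left (h4 s hs h) (by positivity)
  have e5 : 2 * M * (∫ x in a..b, u x s) ≤ 2 * M * C1 :=
    mul_le_mul_of_nonneg_left (h1 s hs h) (by positivity)
  have e6 : c * Q * C4 + Q * (b - a) = L * K + Z := by
    have : L * (2 * ε * Z) = Z := by rw [hε]; field_simp
    have h' : c * Q * C4 + Q * (b - a) = L * K + L * (2 * ε * Z) := by rw [hQ, hL]; ring
    rw [h', this]
  linarith

end

end Cr

namespace Cr

section
variable {a b χ M : ℝ} {J : Set ℝ} {u ux uxx ut v vx vxx vt b1 b2 : ℝ → ℝ → ℝ}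

lemma Sys.sup_u_R (S : Sys a b χ M J u ux uxx ut v vx vxx vt b1 b2) {δ : ℝ} (hδ : 0 < δ)
    (hv : ∀ x ∈ Icc a b, ∀ t ∈ J, δ ≤ v x t) (hχ : 0 < χ) {t0 : ℝ} (ht0 : t0 ∈ J) :
    ∃ C : ℝ, 0 < C ∧ ∀ t ∈ J, t0 ≤ t → ∀ x ∈ Icc a b,
      u x t ^ 2 ≤ C * √(1 + ∫ x in a..b, ux x t ^ 2) := by
  have hl : 0 < b - a := sub_pos.2 S.hab
  have hab := S.hab.le
  obtain ⟨C5, hC5, h5⟩ := S.l2_u hδ hv hχ ht0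
  refine ⟨(b - a)⁻¹ * C5 + 2 * √C5, by positivity, fun t ht h x hx => ?_⟩
  have s1 := sob2 S.hab (fun x hx => S.ru.dx x hx t ht) (slice S.ru.c1 ht) hx
  set Z := ∫ x in a..b, ux x t ^ 2 with hZ
  have hZ0 : 0 ≤ Z := int_nonneg hab fun _ _ => sq_nonneg _
  have r1 : 1 ≤ √(1 + Z) := by rw [one_le_sqrt]; linarith
  have r2 : √Z ≤ √(1 + Z) := sqrt_le_sqrt (by linarith)
  have s2 : u x t ^ 2 ≤ (b - a)⁻¹ * C5 + 2 * √(C5 * Z) := by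
    refine s1.trans ?_
    have := h5 t ht h
    gcongr
  rw [sqrt_mul hC5.le] at s2
  have p1 : (b - a)⁻¹ * C5 * 1 ≤ (b - a)⁻¹ * C5 * √(1 + Z) :=
    mul_le_mul_of_nonneg_left r1 (by positivity)
  have p2 : √C5 * √Z ≤ √C5 * √(1 + Z) := mul_le_mul_of_nonneg_left r2 (by positivity)
  linarith

lemma aux7 (p w : ℝ) : -(2 * ((p - w) * p)) ≤ (-1) * p ^ 2 + w ^ 2 := by
  nlinarith [sq_nonneg (p - w)]

lemma aux8 {L P X1 X2 X3 X4 X5 W c S d N V x y z m : ℝ}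
    (p1 : X1 ≤ c * S * x) (p2 : X2 ≤ d * x) (p3 : X3 ≤ N * y)
    (p4 : X4 ≤ m) (p5 : X5 ≤ V * z) (p6 : W ≤ 5 * (X1 + X2 + X3 + X4 + X5))
    (p7 : L ≤ P + W) :
    L ≤ P + (5 * (c * S + d)) * x + (5 * N) * y + (1 * (5 * m) + (5 * V) * z) := by
  linarith

lemma sq5 (p q r s w : ℝ) :
    (p + q + r + s + w) ^ 2 ≤ 5 * (p ^ 2 + q ^ 2 + r ^ 2 + s ^ 2 + w ^ 2) := by
  nlinarith [sq_nonneg (p - q), sq_nonneg (p - r), sq_nonneg (p - s), sq_nonneg (p - w),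
    sq_nonneg (q - r), sq_nonneg (q - s), sq_nonneg (q - w), sq_nonneg (r - s), sq_nonneg (r - w),
    sq_nonneg (s - w)]

set_option maxHeartbeats 2000000 in
lemma Sys.gradu_ineq (S : Sys a b χ M J u ux uxx ut v vx vxx vt b1 b2) {δ : ℝ} (hδ : 0 < δ)
    (hv : ∀ x ∈ Icc a b, ∀ t ∈ J, δ ≤ v x t) (hχ : 0 < χ) {t0 : ℝ} (ht0 : t0 ∈ J) :
    ∃ C : ℝ, 0 < C ∧ ∀ t ∈ J, t0 ≤ t → ∫ x in a..b, -(2 * (ut x t * uxx x t)) ≤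
      -(1 + ∫ x in a..b, ux x t ^ 2)
        + C * (√(1 + ∫ x in a..b, ux x t ^ 2) * (1 + ∫ x in a..b, vxx x t ^ 2)) := by
  have hl : 0 < b - a := sub_pos.2 S.hab
  have hab := S.hab.le
  have hM := S.nonneg_M ht0
  obtain ⟨C4, hC4, h4⟩ := S.grad_v hδ hv hχ ht0
  obtain ⟨V, hV, hvs⟩ := S.sup_v hδ hv hχ ht0
  obtain ⟨C5, hC5, h5⟩ := S.l2_u hδ hv hχ ht0
  obtain ⟨Ku, hKu, hsu⟩ := S.sup_u_R hδ hv hχ ht0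
  obtain ⟨Kv, hKv, hsv⟩ := S.f1 hδ hv ht0 (ε := 1) one_pos
  set c := χ ^ 2 / δ ^ 2 with hc
  have hc0 : 0 < c := by positivity
  set ε := (10 * c * C4)⁻¹ with hε
  have hε0 : 0 < ε := by positivity
  set k := 5 * c * C4 * ((b - a)⁻¹ + ε⁻¹) with hk
  have hk0 : 0 < k := by positivity
  set η := (2 * (k + 1))⁻¹ with hη
  have hη0 : 0 < η := by positivity
  set A0 := (k + 1) * ((4 * η)⁻¹ * C5) + 5 * (M ^ 2 * (b - a)) + 5 * (V * C5) + 1 with hA0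
  have hA00 : 0 < A0 := by positivity
  set A1 := 5 * (c / δ ^ 2) * Ku * C4 with hA1
  have hA10 : 0 < A1 := by positivity
  set A2 := 5 * c * Ku with hA2
  have hA20 : 0 < A2 := by positivity
  refine ⟨A0 + A1 * (1 + Kv) + A2, by positivity, fun s hs h => ?_⟩
  have k0 := slice S.ru.c0 hs
  have k1 := slice S.ru.c1 hs
  have k2 := slice S.ru.c2 hs
  have kt := slice S.ru.ct hs
  have l0 := slice S.rv.c0 hs
  have l1 := slice S.rv.c1 hs
  have l2 := slice S.rv.c2 hs
  have m1 := slice S.cb1 hs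
  have up : ∀ x ∈ Icc a b, 0 < u x s := fun x hx => S.ru.pos x hx s hs
  have vp : ∀ x ∈ Icc a b, 0 < v x s := fun x hx => S.rv.pos x hx s hs
  have hU := S.ru.interp hab hs hη0
  have hsx : ∀ x ∈ Icc a b, _ := fun x hx => sob3 S.hab (fun x hx => S.ru.dxx x hx s hs) k2 hε0 hx
  have hsu := hsu s hs h
  have hsv := hsv s hs h
  have hvs := hvs s hs h
  have h4 := h4 s hs h
  have h5 := h5 s hs h
  set Z := ∫ x in a..b, ux x s ^ 2 with hZ
  have hZ0 : 0 ≤ Z := int_nonneg hab fun _ _ => sq_nonneg _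
  set U := ∫ x in a..b, uxx x s ^ 2 with hU'
  have hU0 : 0 ≤ U := int_nonneg hab fun _ _ => sq_nonneg _
  set H := ∫ x in a..b, vxx x s ^ 2 with hH
  have hH0 : 0 ≤ H := int_nonneg hab fun _ _ => sq_nonneg _
  set R := √(1 + Z) with hR
  have r1 : 1 ≤ R := by rw [hR, one_le_sqrt]; linarith
  set Sx := ((b - a)⁻¹ + ε⁻¹) * Z + ε * U with hSx
  have hSx0 : 0 ≤ Sx := by positivity
  have e1 : ∫ x in a..b, -(2 * (ut x s * uxx x s)) ≤
      ∫ x in a..b, ((-1) * uxx x s ^ 2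
        + (5 * (c * Sx + c / δ ^ 2 * (Ku * R) * (1 * H + Kv))) * vx x s ^ 2
        + (5 * (c * (Ku * R))) * vxx x s ^ 2
        + (1 * (5 * M ^ 2) + (5 * V) * u x s ^ 2)) := by
    refine int_mono hab (by fun_prop) (by fun_prop) fun x hx => ?_
    have hvx := vp x hx
    have w1 : χ ^ 2 / v x s ^ 2 ≤ c := by
      rw [hc]
      have := hv x hx s hs
      gcongr
    have w2 : χ ^ 2 / v x s ^ 4 ≤ c / δ ^ 2 := by
      have e : c / δ ^ 2 = χ ^ 2 / δ ^ 4 := by rw [hc]; field_simp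
      rw [e]
      have := hv x hx s hs
      gcongr
    have p1 : (χ * (ux x s / v x s * vx x s)) ^ 2 ≤ c * Sx * vx x s ^ 2 := by
      have e : (χ * (ux x s / v x s * vx x s)) ^ 2
        = (χ ^ 2 / v x s ^ 2) * ux x s ^ 2 * vx x s ^ 2 := by field_simp
      rw [e]
      exact mul_le_mul_of_nonneg_right (mul_le_mul w1 (hsx x hx) (sq_nonneg _) hc0.le)
        (sq_nonneg _)
    have p2 : (-(χ * (u x s / v x s ^ 2 * vx x s ^ 2))) ^ 2
        ≤ c / δ ^ 2 * (Ku * R) * (1 * H + Kv) * vx x s ^ 2 := by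
      have e : (-(χ * (u x s / v x s ^ 2 * vx x s ^ 2))) ^ 2
        = (χ ^ 2 / v x s ^ 4) * u x s ^ 2 * vx x s ^ 2 * vx x s ^ 2 := by field_simp
      rw [e]
      refine mul_le_mul_of_nonneg_right (mul_le_mul (mul_le_mul w2 (hsu x hx) (sq_nonneg _)
        (by positivity)) (hsv x hx) (sq_nonneg _) (by positivity)) (sq_nonneg _)
    have p3 : (χ * (u x s / v x s * vxx x s)) ^ 2 ≤ c * (Ku * R) * vxx x s ^ 2 := by
      have e : (χ * (u x s / v x s * vxx x s)) ^ 2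
        = (χ ^ 2 / v x s ^ 2) * u x s ^ 2 * vxx x s ^ 2 := by field_simp
      rw [e]
      exact mul_le_mul_of_nonneg_right (mul_le_mul w1 (hsu x hx) (sq_nonneg _) hc0.le)
        (sq_nonneg _)
    have p4 : (-b1 x s) ^ 2 ≤ M ^ 2 := by
      rw [neg_sq]
      exact pow_le_pow_left₀ (S.hb1 x hx s hs).1 (S.hb1 x hx s hs).2 2
    have p5 : (u x s * v x s) ^ 2 ≤ V * u x s ^ 2 := by
      rw [mul_pow, mul_comm]
      exact mul_le_mul_of_nonneg_right (hvs x hx) (sq_nonneg _)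
    have p6 := sq5 (χ * (ux x s / v x s * vx x s)) (-(χ * (u x s / v x s ^ 2 * vx x s ^ 2)))
      (χ * (u x s / v x s * vxx x s)) (-b1 x s) (u x s * v x s)
    have p7 : -(2 * (ut x s * uxx x s)) ≤ (-1) * uxx x s ^ 2
      + (χ * (ux x s / v x s * vx x s) + (-(χ * (u x s / v x s ^ 2 * vx x s ^ 2)))
      + (χ * (u x s / v x s * vxx x s)) + (-b1 x s) + (u x s * v x s)) ^ 2 := by
      rw [S.ueq x hx s hs]
      set W := (χ * (ux x s / v x s * vx x s) + (-(χ * (u x s / v x s ^ 2 * vx x s ^ 2)))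
      + (χ * (u x s / v x s * vxx x s)) + (-b1 x s) + (u x s * v x s)) with hW
      have : (uxx x s - χ * (ux x s / v x s * vx x s - u x s / v x s ^ 2 * vx x s ^ 2
          + u x s / v x s * vxx x s)) + (b1 x s - u x s * v x s) = uxx x s - W := by
        rw [hW]; ring
      rw [this]
      exact aux7 _ _
    exact aux8 p1 p2 p3 p4 p5 p6 p7

  rw [int_add hab (f := fun x => (-1) * uxx x s ^ 2
        + (5 * (c * Sx + c / δ ^ 2 * (Ku * R) * (1 * H + Kv))) * vx x s ^ 2
        + (5 * (c * (Ku * R))) * vxx x s ^ 2)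
      (g := fun x => 1 * (5 * M ^ 2) + (5 * V) * u x s ^ 2) (by fun_prop) (by fun_prop),
    int_lin3 hab _ _ _ (f := fun x => uxx x s ^ 2) (g := fun x => vx x s ^ 2)
      (h := fun x => vxx x s ^ 2) (by fun_prop) (by fun_prop) (by fun_prop),
    int_lin2 hab _ _ (f := fun x => 5 * M ^ 2) (g := fun x => u x s ^ 2)
      (by fun_prop) (by fun_prop), intervalIntegral.integral_const, smul_eq_mul] at e1
  rw [← hU', ← hH] at e1
  have d1 : (5 * (c * Sx + c / δ ^ 2 * (Ku * R) * (1 * H + Kv))) * (∫ x in a..b, vx x s ^ 2)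
      ≤ (5 * (c * Sx + c / δ ^ 2 * (Ku * R) * (1 * H + Kv))) * C4 :=
    mul_le_mul_of_nonneg_left h4 (by positivity)
  have d2 : 5 * V * (∫ x in a..b, u x s ^ 2) ≤ 5 * V * C5 :=
    mul_le_mul_of_nonneg_left h5 (by positivity)
  have d3 : 5 * (c * Sx) * C4 = k * Z + 1/2 * U := by
    have q : 5 * c * C4 * (ε * U) = 1/2 * U := by
      have e : ε * (10 * c * C4) = 1 := by rw [hε]; exact inv_mul_cancel₀ (by positivity)
      calc 5 * c * C4 * (ε * U) = 1/2 * (ε * (10 * c * C4)) * U := by ring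
        _ = _ := by rw [e]; ring
    have q2 : 5 * (c * Sx) * C4 = k * Z + 5 * c * C4 * (ε * U) := by rw [hSx, hk]; ring
    rw [q2, q]
  have d4 : (k + 1) * Z ≤ 1/2 * U + (k + 1) * ((4 * η)⁻¹ * C5) := by
    have q1 : (k + 1) * Z ≤ (k + 1) * (η * U + (4 * η)⁻¹ * C5) := by
      refine mul_le_mul_of_nonneg_left (hU.trans ?_) (by positivity)
      gcongr
    have q2 : (k + 1) * (η * U) = 1/2 * U := by
      have e : η * (2 * (k + 1)) = 1 := by rw [hη]; exact inv_mul_cancel₀ (by positivity)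
      calc (k + 1) * (η * U) = 1/2 * (η * (2 * (k + 1))) * U := by ring
        _ = _ := by rw [e]; ring
    linarith
  have d5 : 5 * (c / δ ^ 2 * (Ku * R) * (1 * H + Kv)) * C4 = A1 * (R * (H + Kv)) := by
    rw [hA1]; ring
  have d6 : 5 * (c * (Ku * R)) * H = A2 * (R * H) := by rw [hA2]; ring
  have hRH : 1 ≤ R * (1 + H) := by nlinarith
  have d7 : A0 * 1 ≤ A0 * (R * (1 + H)) := mul_le_mul_of_nonneg_left hRH hA00.le
  have d8 : A1 * (R * (H + Kv)) ≤ A1 * (1 + Kv) * (R * (1 + H)) := by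
    have : R * (H + Kv) ≤ (1 + Kv) * (R * (1 + H)) := by
      have : 0 ≤ R * (1 + Kv * H) := by positivity
      nlinarith
    calc A1 * (R * (H + Kv)) ≤ A1 * ((1 + Kv) * (R * (1 + H))) :=
          mul_le_mul_of_nonneg_left this hA10.le
      _ = _ := by ring
  have d9 : A2 * (R * H) ≤ A2 * (R * (1 + H)) :=
    mul_le_mul_of_nonneg_left (by nlinarith) hA20.le
  have d10 : (A0 + A1 * (1 + Kv) + A2) * (R * (1 + H)) = A0 * (R * (1 + H))
    + A1 * (1 + Kv) * (R * (1 + H)) + A2 * (R * (1 + H)) := by ring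
  rw [d10]
  linarith

lemma Sys.grad_u (S : Sys a b χ M J u ux uxx ut v vx vxx vt b1 b2) {δ : ℝ} (hδ : 0 < δ)
    (hv : ∀ x ∈ Icc a b, ∀ t ∈ J, δ ≤ v x t) (hχ : 0 < χ) {t0 : ℝ} (ht0 : t0 ∈ J) :
    ∃ C : ℝ, 0 < C ∧ ∀ t ∈ J, t0 ≤ t → ∫ x in a..b, ux x t ^ 2 ≤ C := by
  have hl : 0 < b - a := sub_pos.2 S.hab
  have hab := S.hab.le
  obtain ⟨C, hC, hg⟩ := S.gradu_ineq hδ hv hχ ht0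
  obtain ⟨Y, Y', D, hD, hY, hY', hYl⟩ := S.ent hδ hv hχ ht0
  set K := 8 * C with hK
  set R := fun s => √(1 + ∫ x in a..b, ux x s ^ 2) with hR
  have hZ0 : ∀ s, 0 ≤ ∫ x in a..b, ux x s ^ 2 := fun s => int_nonneg hab fun _ _ => sq_nonneg _
  have hR1 : ∀ s, 1 ≤ R s := fun s => by
    simp only [hR]; rw [one_le_sqrt]; linarith [hZ0 s]
  have hRsq : ∀ s, R s ^ 2 = 1 + ∫ x in a..b, ux x s ^ 2 := fun s =>
    sq_sqrt (by linarith [hZ0 s])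
  have hRd : ∀ s ∈ J, HasDerivAt R ((∫ x in a..b, -(2 * (ut x s * uxx x s))) / (2 * R s)) s :=
    fun s hs => ((h1_deriv hab S.hJ S.ru hs).const_add 1).sqrt (by linarith [hZ0 s])
  set B := max (R t0 + K * Y t0) ((C + K * D) / (1/16)) with hB
  refine ⟨(B + K * (b - a)) ^ 2, ?_, ?_⟩
  swap
  · intro t ht h
    have key := ode S.hJc (F := fun s => R s + K * Y s) (c := 1/16) (C := C + K * D)
      (by norm_num) ht0 (fun s hs => (hRd s hs).add ((hY s hs).const_mul K)) (fun s hs h => ?_)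
      ht h
    · have y1 := hYl t ht
      have y2 : K * (-(b - a)) ≤ K * Y t :=
        mul_le_mul_of_nonneg_left (by
          have : 0 ≤ ∫ x in a..b, vx x t ^ 2 := int_nonneg hab fun _ _ => sq_nonneg _
          linarith) (by positivity)
      have y3 : R t ≤ B + K * (b - a) := by
        linarith
      have y4 : R t ^ 2 ≤ (B + K * (b - a)) ^ 2 :=
        pow_le_pow_left₀ (by linarith [hR1 t]) y3 2
      linarith [hRsq t]
    · have g1 := hg s hs h
      have g2 := hY' s hs h
      have hRp : 0 < R s := by linarith [hR1 s]
      have hH0 : 0 ≤ ∫ x in a..b, vxx x s ^ 2 := int_nonneg hab fun _ _ => sq_nonneg _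
      rw [← hRsq s] at g1
      have g3 : (∫ x in a..b, -(2 * (ut x s * uxx x s))) / (2 * R s)
          ≤ - (1/2) * R s + C / 2 * (1 + ∫ x in a..b, vxx x s ^ 2) := by
        rw [div_le_iff₀ (by positivity)]
        refine g1.trans (le_of_eq ?_)
        rw [sqrt_sq hRp.le]
        ring
      have g4 : K * Y' s ≤ K * (- (1/16) * Y s - 1/16 * (∫ x in a..b, vxx x s ^ 2) + D) :=
        mul_le_mul_of_nonneg_left g2 (by positivity)
      have g5 : K * (1/16 * (∫ x in a..b, vxx x s ^ 2)) = C / 2 * ∫ x in a..b, vxx x s ^ 2 := by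
        rw [hK]; ring
      linarith
  · have y1 := hYl t0 ht0
    have y2 : K * (-(b - a)) ≤ K * Y t0 :=
      mul_le_mul_of_nonneg_left (by
        have : 0 ≤ ∫ x in a..b, vx x t0 ^ 2 := int_nonneg hab fun _ _ => sq_nonneg _
        linarith) (by positivity)
    have : 0 < B + K * (b - a) := by
      have := le_max_left (R t0 + K * Y t0) ((C + K * D) / (1/16))
      linarith [hR1 t0]
    positivity

/-- Final bound: sup and Hölder-1/2 type bound. -/
lemma Sys.final (S : Sys a b χ M J u ux uxx ut v vx vxx vt b1 b2) {δ : ℝ} (hδ : 0 < δ)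
    (hv : ∀ x ∈ Icc a b, ∀ t ∈ J, δ ≤ v x t) (hχ : 0 < χ) {t0 : ℝ} (ht0 : t0 ∈ J)
    {γ : ℝ} (hγ0 : 0 < γ) (hγ : γ ≤ 1/2) :
    ∃ C : ℝ, 0 < C ∧ ∀ t ∈ J, t0 ≤ t → (∀ x ∈ Icc a b, |u x t| ≤ C) ∧
      ∀ x ∈ Icc a b, ∀ y ∈ Icc a b, |u x t - u y t| ≤ C * |x - y| ^ γ := by
  have hl : 0 < b - a := sub_pos.2 S.hab
  have hab := S.hab.le
  obtain ⟨C, hC, h1⟩ := S.grad_u hδ hv hχ ht0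
  obtain ⟨K, hK, h2⟩ := S.sup_u_R hδ hv hχ ht0
  refine ⟨√(K * √(1 + C)) + √C * (b - a) ^ (1/2 - γ), by positivity, fun t ht h => ⟨?_, ?_⟩⟩
  · intro x hx
    have q : u x t ^ 2 ≤ K * √(1 + C) := by
      refine (h2 t ht h x hx).trans ?_
      have := h1 t ht h
      gcongr
    refine (Real.abs_le_sqrt q).trans ?_
    have : 0 ≤ √C * (b - a) ^ (1/2 - γ) := by positivity
    linarith
  · intro x hx y hy
    have hw : ∀ x ∈ Icc a b, ∀ y ∈ Icc a b, y ≤ x → |u x t - u y t| ≤ √C * √(x - y) := by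
      intro x hx y hy hxy
      have hsub : Icc y x ⊆ Icc a b := Icc_subset_Icc hy.1 hx.2
      have k1 := slice S.ru.c1 ht
      have f1 := ftc_le (a := y) (b := x) (fun z hz => S.ru.dx z (hsub hz) t ht) (k1.mono hsub)
        (right_mem_Icc.2 hxy) (left_mem_Icc.2 hxy)
      have f2 := cs hxy (f := fun z => |ux z t|) (g := fun _ => 1) (k1.mono hsub).abs
        continuousOn_const
      simp only [mul_one, sq_abs, one_pow, int_one] at f2
      have f3 : ∫ z in y..x, ux z t ^ 2 ≤ ∫ z in a..b, ux z t ^ 2 :=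
        intervalIntegral.integral_mono_interval hy.1 hxy hx.2
          (ae_of_all _ fun z => sq_nonneg _) (ii hab (k1.pow 2))
      refine f1.trans ?_
      rw [← sqrt_mul hC.le]
      refine Real.le_sqrt_of_sq_le (f2.trans ?_)
      exact mul_le_mul_of_nonneg_right (f3.trans (h1 t ht h)) (by linarith)
    have hw2 : |u x t - u y t| ≤ √C * √|x - y| := by
      rcases le_total y x with hxy | hxy
      · rw [abs_of_nonneg (sub_nonneg.2 hxy)]; exact hw x hx y hy hxy
      · rw [abs_sub_comm, abs_sub_comm x y, abs_of_nonneg (sub_nonneg.2 hxy)]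
        exact hw y hy x hx hxy
    refine hw2.trans ?_
    have hxy : |x - y| ≤ b - a := abs_sub_le_iff.2 ⟨by linarith [hx.2, hy.1], by linarith [hx.1, hy.2]⟩
    have e1 : √|x - y| = |x - y| ^ (1/2 - γ) * |x - y| ^ γ := by
      rw [sqrt_eq_rpow]
      by_cases h0 : |x - y| = 0
      · rw [h0, zero_rpow hγ0.ne', mul_zero, zero_rpow (by norm_num)]
      · rw [← rpow_add (lt_of_le_of_ne (abs_nonneg _) (Ne.symm h0))]
        congr 1; ring
    have e2 : |x - y| ^ (1/2 - γ) ≤ (b - a) ^ (1/2 - γ) :=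
      rpow_le_rpow (abs_nonneg _) hxy (by linarith)
    rw [e1]
    have p : 0 ≤ |x - y| ^ γ := by positivity
    calc √C * (|x - y| ^ (1/2 - γ) * |x - y| ^ γ)
        ≤ √C * ((b - a) ^ (1/2 - γ) * |x - y| ^ γ) := by gcongr
      _ = √C * (b - a) ^ (1/2 - γ) * |x - y| ^ γ := by ring
      _ ≤ _ := mul_le_mul_of_nonneg_right (by
          have : 0 ≤ √(K * √(1 + C)) := by positivity
          linarith) p

end

end Cr

namespace Cr

lemma pp_deriv (n : ℕ) (r : ℝ) :
    HasDerivAt (fun r : ℝ => max 0 r ^ (n + 2)) ((n + 2) * max 0 r ^ (n + 1)) r := by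
  rcases lt_trichotomy r 0 with h | h | h
  · have e : (fun r : ℝ => max 0 r ^ (n + 2)) =ᶠ[𝓝 r] fun _ => 0 := by
      filter_upwards [Iio_mem_nhds h] with s hs
      rw [max_eq_left (le_of_lt hs)]; simp
    rw [max_eq_left h.le]
    simpa using (hasDerivAt_const r (0:ℝ)).congr_of_eventuallyEq e
  · subst h
    have : HasDerivAt (fun r : ℝ => max 0 r ^ (n + 2)) 0 0 := by
      rw [hasDerivAt_iff_isLittleO]
      simp only [max_self, sub_zero, smul_zero, ne_eq, Nat.add_eq_zero_iff, OfNat.ofNat_ne_zero,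
        and_false, not_false_eq_true, zero_pow]
      have h1 : (fun r : ℝ => max 0 r ^ (n + 2)) =O[𝓝 0] fun r : ℝ => r ^ (n + 2) := by
        refine Asymptotics.IsBigO.of_bound 1 (Eventually.of_forall fun r => ?_)
        rw [one_mul, norm_pow, norm_pow]
        refine pow_le_pow_left₀ (norm_nonneg _) ?_ _
        rw [norm_eq_abs, norm_eq_abs, abs_of_nonneg (le_max_left _ _)]
        exact max_le (abs_nonneg _) (le_abs_self _)
      refine h1.trans_isLittleO ?_
      have := Asymptotics.isLittleO_pow_pow (𝕜 := ℝ) (m := 1) (n := n + 2) (by omega)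
      simpa using this
    simpa using this
  · have e : (fun r : ℝ => max 0 r ^ (n + 2)) =ᶠ[𝓝 r] fun s => s ^ (n + 2) := by
      filter_upwards [Ioi_mem_nhds h] with s hs
      rw [max_eq_right (le_of_lt hs)]
    rw [max_eq_right h.le]
    refine ((hasDerivAt_pow (n + 2) r).congr_of_eventuallyEq e).congr_deriv ?_
    push_cast
    rfl

lemma zero_of_int {a b : ℝ} (hab : a < b) {f : ℝ → ℝ} (hf : ContinuousOn f (Icc a b))
    (h0 : ∀ x ∈ Icc a b, 0 ≤ f x) (hi : ∫ x in a..b, f x ≤ 0) {x : ℝ} (hx : x ∈ Icc a b) :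
    f x ≤ 0 := by
  by_contra hc
  push Not at hc
  have := intervalIntegral.integral_pos hab hf (fun x hx => h0 x (Ioc_subset_Icc_self hx))
    ⟨x, hx, hc⟩
  linarith

section
variable {a b χ M : ℝ} {J : Set ℝ} {u ux uxx ut v vx vxx vt b1 b2 : ℝ → ℝ → ℝ}

lemma Sys.compare (S : Sys a b χ M J u ux uxx ut v vx vxx vt b1 b2) {s t m : ℝ}
    (hs : s ∈ J) (ht : t ∈ J) (hst : s ≤ t) (hm : ∀ x ∈ Icc a b, m ≤ v x s)
    {x : ℝ} (hx : x ∈ Icc a b) : m * exp (-(t - s)) ≤ v x t := by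
  have hab := S.hab.le
  have ec : ContinuousOn (fun p : ℝ × ℝ => exp (p.2 - s)) (Icc a b ×ˢ J) :=
    (by fun_prop : Continuous fun p : ℝ × ℝ => exp (p.2 - s)).continuousOn
  have R : Reg a b J (fun x r => exp (r - s) * v x r) (fun x r => exp (r - s) * vx x r)
      (fun x r => exp (r - s) * vxx x r)
      (fun x r => exp (r - s) * v x r + exp (r - s) * vt x r) := by
    refine ⟨fun x hx t ht => (S.rv.dx x hx t ht).const_mul _,
      fun x hx t ht => (S.rv.dxx x hx t ht).const_mul _, fun x hx t ht => ?_,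
      ec.mul S.rv.c0, ec.mul S.rv.c1, ec.mul S.rv.c2, (ec.mul S.rv.c0).add (ec.mul S.rv.ct),
      fun t ht => ?_, fun t ht => ?_, fun x hx t ht => ?_⟩
    · have h1 : HasDerivAt (fun r => exp (r - s)) (exp (t - s)) t := by
        simpa using ((hasDerivAt_id t).sub_const s).exp
      exact h1.mul (S.rv.dt x hx t ht)
    · simp [S.rv.bca t ht]
    · simp [S.rv.bcb t ht]
    · exact mul_pos (exp_pos _) (S.rv.pos x hx t ht)
  have d1 : ∀ r : ℝ, HasDerivAt (fun r : ℝ => m - r) (-1) r := fun r => by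
    simpa using (hasDerivAt_id r).const_sub m
  have hd : ∀ r ∈ J, HasDerivAt (fun r => ∫ x in a..b, max 0 (m - exp (r - s) * v x r) ^ 3)
      _ r := fun r hr => energy hab S.hJ R (Φ := fun q => max 0 (m - q) ^ 3)
      (Φ1 := fun q => -(3 * max 0 (m - q) ^ 2)) (Φ2 := fun q => 6 * max 0 (m - q))
      (fun q _ => ((pp_deriv 1 (m - q)).comp q (d1 q)).congr_deriv (by push_cast; ring))
      (fun q _ => ((((pp_deriv 0 (m - q)).comp q (d1 q)).const_mul 3).neg).congr_deriv
        (by push_cast; ring))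
      (by fun_prop) hr (j := fun x => exp (r - s) * vx x r) (jx := fun x => exp (r - s) * vxx x r)
      (g := fun x => exp (r - s) * (u x r * v x r + b2 x r))
      (fun x hx => R.dxx x hx r hr) (slice (G := fun x r => exp (r - s) * vxx x r) R.c2 hr)
      ((((slice S.ru.c0 hr).mul (slice S.rv.c0 hr)).add (slice S.cb2 hr)).const_mul _)
      (R.bca r hr) (R.bcb r hr) (fun x hx => by simp only [S.veq x hx r hr]; ring)
  have hsub : Icc s t ⊆ J := S.hJc.out hs ht
  have anti : AntitoneOn (fun r => ∫ x in a..b, max 0 (m - exp (r - s) * v x r) ^ 3) (Icc s t) := by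
    refine antitoneOn_of_hasDerivWithinAt_nonpos (convex_Icc s t)
      (fun r hr => (hd r (hsub hr)).continuousAt.continuousWithinAt)
      (fun r hr => (hd r (hsub (interior_subset hr))).hasDerivWithinAt) (fun r hr => ?_)
    have hr := hsub (interior_subset hr)
    have k1 : 0 ≤ ∫ x in a..b, 6 * max 0 (m - exp (r - s) * v x r) * (exp (r - s) * vx x r)
        * (exp (r - s) * vx x r) := int_nonneg hab fun x hx => by
      rw [mul_assoc]
      exact mul_nonneg (mul_nonneg (by norm_num) (le_max_left _ _)) (mul_self_nonneg _)
    have k2 : 0 ≤ ∫ x in a..b, -(-(3 * max 0 (m - exp (r - s) * v x r) ^ 2)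
        * (exp (r - s) * (u x r * v x r + b2 x r))) := int_nonneg hab fun x hx => by
      have := S.ru.pos x hx r hr
      have := S.rv.pos x hx r hr
      have := (S.hb2 x hx r hr).1
      rw [neg_mul, neg_neg]
      positivity
    rw [intervalIntegral.integral_neg] at k2
    linarith
  have h0 := anti (left_mem_Icc.2 hst) (right_mem_Icc.2 hst) hst
  have h1 : ∫ x in a..b, max 0 (m - exp (s - s) * v x s) ^ 3 = 0 := by
    rw [int_congr hab (g := fun _ => (0:ℝ)) (fun x hx => ?_)]
    · simp
    · rw [max_eq_left (by simpa using hm x hx)]; norm_num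
  have cz := slice (G := fun x r => exp (r - s) * v x r) R.c0 ht
  have h2 := zero_of_int S.hab (f := fun x => max 0 (m - exp (t - s) * v x t) ^ 3)
    (by fun_prop) (fun x hx => pow_nonneg (le_max_left _ _) _) (by simp only at h0; linarith) hx
  have h3 : m - exp (t - s) * v x t ≤ 0 := by
    by_contra hc
    push Not at hc
    have : 0 < max 0 (m - exp (t - s) * v x t) ^ 3 := pow_pos (lt_max_of_lt_right hc) 3
    exact absurd h2 (not_le.2 this)
  rw [exp_neg, ← div_eq_mul_inv, div_le_iff₀ (exp_pos _)]
  linarith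

end

end Cr

namespace Cr

lemma phi_aux1 {s p : ℝ} (hs : 0 < s) :
    (p / (1 + s) - p / s) ^ 2 ≤ (-((1 + s) ^ 2)⁻¹ + (s ^ 2)⁻¹) * p * p := by
  have e1 : (p / (1 + s) - p / s) ^ 2 = p ^ 2 * (1 / (s ^ 2 * (1 + s) ^ 2)) := by
    field_simp; ring
  have e2 : (-((1 + s) ^ 2)⁻¹ + (s ^ 2)⁻¹) * p * p
      = p ^ 2 * ((1 + 2 * s) / (s ^ 2 * (1 + s) ^ 2)) := by
    field_simp; ring
  rw [e1, e2]
  gcongr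
  linarith

lemma phi_aux2 {s u B : ℝ} (hs : 0 < s) (hu : 0 < u) (hB : 0 ≤ B) {q : ℝ}
    (hq : q ≤ log (1 + s) - log s) :
    ((1 + s)⁻¹ - s⁻¹) * (u * s - s + B) ≤ 1 * 1 + (1 - q) * B := by
  have h1 : log (1 + s) - log s ≤ s⁻¹ := by
    rw [← log_div (by positivity) hs.ne']
    have := log_le_sub_one_of_pos (show 0 < (1 + s) / s by positivity)
    have e : (1 + s) / s - 1 = s⁻¹ := by field_simp; ring
    linarith
  have h2 : (1 + s)⁻¹ ≤ 1 := inv_le_one_of_one_le₀ (by linarith)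
  have h3 : (1 + s)⁻¹ - s⁻¹ ≤ 0 := by
    have : (1 + s)⁻¹ ≤ s⁻¹ := inv_anti₀ hs (by linarith)
    linarith
  have h4 : ((1 + s)⁻¹ - s⁻¹) * (u * s) ≤ 0 :=
    mul_nonpos_of_nonpos_of_nonneg h3 (by positivity)
  have h5 : ((1 + s)⁻¹ - s⁻¹) * s = (1 + s)⁻¹ * s - 1 := by field_simp
  have h6 : 0 ≤ (1 + s)⁻¹ * s := by positivity
  have h7 : ((1 + s)⁻¹ - s⁻¹) * B ≤ (1 - q) * B :=
    mul_le_mul_of_nonneg_right (by linarith) hB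
  calc ((1 + s)⁻¹ - s⁻¹) * (u * s - s + B) = ((1 + s)⁻¹ - s⁻¹) * (u * s)
      - ((1 + s)⁻¹ - s⁻¹) * s + ((1 + s)⁻¹ - s⁻¹) * B := by ring
    _ ≤ _ := by linarith

section
variable {a b χ M : ℝ} {J : Set ℝ} {u ux uxx ut v vx vxx vt b1 b2 : ℝ → ℝ → ℝ}

lemma Sys.w_deriv (S : Sys a b χ M J u ux uxx ut v vx vxx vt b1 b2) {t : ℝ} (ht : t ∈ J) {x : ℝ}
    (hx : x ∈ Icc a b) : HasDerivAt (fun x => log (1 + v x t) - log (v x t))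
      (vx x t / (1 + v x t) - vx x t / v x t) x := by
  have hp := S.rv.pos x hx t ht
  exact (((S.rv.dx x hx t ht).const_add 1).log (by positivity)).sub
    ((S.rv.dx x hx t ht).log hp.ne')

lemma Sys.wx_cont (S : Sys a b χ M J u ux uxx ut v vx vxx vt b1 b2) {t : ℝ} (ht : t ∈ J) :
    ContinuousOn (fun x => vx x t / (1 + v x t) - vx x t / v x t) (Icc a b) := by
  have l0 := slice S.rv.c0 ht
  have l1 := slice S.rv.c1 ht
  have h : ∀ x ∈ Icc a b, v x t ≠ 0 := fun x hx => (S.rv.pos x hx t ht).ne'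
  have h' : ∀ x ∈ Icc a b, 1 + v x t ≠ 0 := fun x hx => by
    have := S.rv.pos x hx t ht
    positivity
  exact (l1.div (by fun_prop) h').sub (l1.div l0 h)

lemma Sys.low_ineq (S : Sys a b χ M J u ux uxx ut v vx vxx vt b1 b2) {c : ℝ} (hc : 0 < c)
    (hb : ∀ t ∈ J, c ≤ ∫ x in a..b, b2 x t) :
    ∃ L' : ℝ → ℝ, ∃ K : ℝ, 0 < K ∧
      (∀ t ∈ J, HasDerivAt (fun t => ∫ x in a..b, (log (1 + v x t) - log (v x t))) (L' t) t) ∧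
      (∀ t ∈ J, L' t ≤ -(c / (b - a)) * (∫ x in a..b, (log (1 + v x t) - log (v x t)))
        - 1/2 * (∫ x in a..b, (vx x t / (1 + v x t) - vx x t / v x t) ^ 2) + K) := by
  have hab := S.hab.le
  have hl : 0 < b - a := sub_pos.2 S.hab
  have hd := fun t (ht : t ∈ J) => S.energy_v (Φ := fun s => log (1 + s) - log s)
    (Φ1 := fun s => (1 + s)⁻¹ - s⁻¹) (Φ2 := fun s => -((1 + s) ^ 2)⁻¹ + (s ^ 2)⁻¹)
    (fun s hs => ((((hasDerivAt_id s).const_add 1).log (by simp only [id]; positivity)).sub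
      (hasDerivAt_log hs.ne')).congr_deriv (by simp))
    (fun s hs => ((((hasDerivAt_id s).const_add 1).inv (by simp only [id]; positivity)).sub
      (hasDerivAt_inv hs.ne')).congr_deriv (by simp only [id]; ring))
    (by
      have h1 : ∀ s ∈ Ioi (0:ℝ), s ^ 2 ≠ 0 := fun s hs => pow_ne_zero 2 (ne_of_gt hs)
      have h2 : ∀ s ∈ Ioi (0:ℝ), (1 + s) ^ 2 ≠ 0 := fun s hs => by
        have : 0 < s := hs
        positivity
      exact (ContinuousOn.inv₀ (by fun_prop) h2).neg.add (ContinuousOn.inv₀ (by fun_prop) h1)) ht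
  have hM : 0 ≤ M ∨ J = ∅ := by
    rcases J.eq_empty_or_nonempty with h | ⟨t, ht⟩
    · exact Or.inr h
    · have := S.hb2 a (left_mem_Icc.2 hab) t ht
      exact Or.inl (this.1.trans this.2)
  refine ⟨_, (b - a) + |M| * (b - a) + |M| ^ 2 * (b - a) ^ 3 / 2, by positivity, hd, fun t ht => ?_⟩
  have hM : 0 ≤ M := hM.resolve_right (fun h => by rw [h] at ht; exact ht)
  rw [abs_of_nonneg hM]
  have l0 := slice S.rv.c0 ht
  have l1 := slice S.rv.c1 ht
  have k0 := slice S.ru.c0 ht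
  have m2 := slice S.cb2 ht
  have vp : ∀ x ∈ Icc a b, 0 < v x t := fun x hx => S.rv.pos x hx t ht
  have wc := S.wx_cont ht
  have h0 : ∀ x ∈ Icc a b, v x t ≠ 0 := fun x hx => (vp x hx).ne'
  have h2 : ∀ x ∈ Icc a b, v x t ^ 2 ≠ 0 := fun x hx => pow_ne_zero 2 (h0 x hx)
  have h1 : ∀ x ∈ Icc a b, 1 + v x t ≠ 0 := fun x hx => by
    have := vp x hx
    positivity
  have h3 : ∀ x ∈ Icc a b, (1 + v x t) ^ 2 ≠ 0 := fun x hx => pow_ne_zero 2 (h1 x hx)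
  have i0 := l0.inv₀ h0
  have i1 := ContinuousOn.inv₀ (f := fun x => 1 + v x t) (by fun_prop) h1
  have i2 := ContinuousOn.inv₀ (f := fun x => v x t ^ 2) (by fun_prop) h2
  have i3 := ContinuousOn.inv₀ (f := fun x => (1 + v x t) ^ 2) (by fun_prop) h3
  have e1 : ∫ x in a..b, (vx x t / (1 + v x t) - vx x t / v x t) ^ 2 ≤
      ∫ x in a..b, (-((1 + v x t) ^ 2)⁻¹ + (v x t ^ 2)⁻¹) * vx x t * vx x t :=
    int_mono hab (wc.pow 2) (((i3.neg.add i2).mul l1).mul l1) fun x hx => phi_aux1 (vp x hx)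
  set L := ∫ x in a..b, (log (1 + v x t) - log (v x t)) with hL
  set G := ∫ x in a..b, (vx x t / (1 + v x t) - vx x t / v x t) ^ 2 with hG
  set A := ∫ x in a..b, |vx x t / (1 + v x t) - vx x t / v x t| with hA
  have low : ∀ x ∈ Icc a b, (b - a)⁻¹ * L - A ≤ log (1 + v x t) - log (v x t) := by
    intro x hx
    have := sob1 S.hab (f := fun x => -(log (1 + v x t) - log (v x t)))
      (fun x hx => (S.w_deriv ht hx).neg) wc.neg hx
    simp only [Pi.neg_apply, abs_neg] at this
    rw [intervalIntegral.integral_neg, ← hL, ← hA] at this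
    linarith
  have e2 : ∫ x in a..b, ((1 + v x t)⁻¹ - (v x t)⁻¹) * (u x t * v x t - v x t + b2 x t) ≤
      ∫ x in a..b, (1 * 1 + (1 - ((b - a)⁻¹ * L - A)) * b2 x t) :=
    int_mono hab ((i1.sub i0).mul (((k0.mul l0).sub l0).add m2)) (by fun_prop) fun x hx =>
      phi_aux2 (vp x hx) (S.ru.pos x hx t ht) (S.hb2 x hx t ht).1 (low x hx)
  rw [int_lin2 hab _ _ (f := fun _ => 1) (g := fun x => b2 x t) (by fun_prop) m2, int_one] at e2
  have hB1 := hb t ht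
  have hB2 : ∫ x in a..b, b2 x t ≤ ∫ x in a..b, M :=
    int_mono hab m2 (by fun_prop) fun x hx => (S.hb2 x hx t ht).2
  rw [intervalIntegral.integral_const, smul_eq_mul] at hB2
  set B := ∫ x in a..b, b2 x t with hB
  have hL0 : 0 ≤ L := int_nonneg hab fun x hx => by
    have := vp x hx
    have := log_le_log this (show v x t ≤ 1 + v x t by linarith)
    linarith
  have hA0 : 0 ≤ A := int_nonneg hab fun _ _ => abs_nonneg _
  have hcs : A ^ 2 ≤ G * (b - a) := by
    have := cs hab (f := fun x => |vx x t / (1 + v x t) - vx x t / v x t|) (g := fun _ => 1)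
      wc.abs continuousOn_const
    simpa only [mul_one, sq_abs, one_pow, int_one] using this
  have f1 : c * ((b - a)⁻¹ * L) ≤ B * ((b - a)⁻¹ * L) :=
    mul_le_mul_of_nonneg_right hB1 (by positivity)
  have f2 : B * (1 + A) ≤ (b - a) * M * (1 + A) :=
    mul_le_mul_of_nonneg_right hB2 (by positivity)
  have f3 : (b - a) * M * A ≤ G / 2 + M ^ 2 * (b - a) ^ 3 / 2 := by
    have g1 : 0 ≤ (A - M * (b - a) ^ 2) ^ 2 := sq_nonneg _
    have g2 : ((b - a) * M * A) * (b - a) ≤ (G / 2 + M ^ 2 * (b - a) ^ 3 / 2) * (b - a) := by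
      nlinarith
    exact le_of_mul_le_mul_right g2 hl
  have f4 : -(c / (b - a)) * L = - (c * ((b - a)⁻¹ * L)) := by ring
  rw [f4]
  nlinarith

lemma Sys.lower (S : Sys a b χ M J u ux uxx ut v vx vxx vt b1 b2) {c : ℝ} (hc : 0 < c)
    (hb : ∀ t ∈ J, c ≤ ∫ x in a..b, b2 x t) {t0 : ℝ} (ht0 : t0 ∈ J) :
    ∃ δ : ℝ, 0 < δ ∧ ∀ t ∈ J, t0 ≤ t → ∀ x ∈ Icc a b, δ ≤ v x t := by
  have hab := S.hab.le
  have hl : 0 < b - a := sub_pos.2 S.hab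
  obtain ⟨L', K, hK, hd, hle⟩ := S.low_ineq hc hb
  set L := fun t => ∫ x in a..b, (log (1 + v x t) - log (v x t)) with hL
  have hG0 : ∀ t, 0 ≤ ∫ x in a..b, (vx x t / (1 + v x t) - vx x t / v x t) ^ 2 := fun t =>
    int_nonneg hab fun _ _ => sq_nonneg _
  have hL0 : ∀ t ∈ J, 0 ≤ L t := fun t ht => int_nonneg hab fun x hx => by
    have hp := S.rv.pos x hx t ht
    have := log_le_log hp (show v x t ≤ 1 + v x t by linarith)
    linarith
  set Lm := max (L t0) (K / (c / (b - a))) with hLm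
  have hLb : ∀ t ∈ J, t0 ≤ t → L t ≤ Lm := fun t ht h =>
    ode S.hJc (F := L) (F' := L') (c := c / (b - a)) (C := K) (by positivity) ht0 hd
      (fun s hs _ => by
        have h1 := hle s hs
        have h2 := hG0 s
        change L' s ≤ -(c / (b - a)) * L s + K
        change L' s ≤ -(c / (b - a)) * L s - _ + K at h1
        linarith) ht h
  have hLm0 : 0 ≤ Lm := (hL0 t0 ht0).trans (le_max_left _ _)
  set W := (b - a)⁻¹ * Lm + (1 + 2 * (K + Lm) * (b - a)) with hW
  -- lower bound at t0
  obtain ⟨y, hy, hmin⟩ := isCompact_Icc.exists_isMinOn (nonempty_Icc.2 hab) (slice S.rv.c0 ht0)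
  have hm0 : 0 < v y t0 := S.rv.pos y hy t0 ht0
  refine ⟨min (v y t0) (exp (-W)) * exp (-1), by positivity, fun t ht h x hx => ?_⟩
  set m := min (v y t0) (exp (-W)) with hm
  have hmp : 0 < m := by positivity
  -- enough: a comparison time
  obtain ⟨s, hs, hst, hts, hms⟩ : ∃ s ∈ J, s ≤ t ∧ t ≤ s + 1 ∧ ∀ x ∈ Icc a b, m ≤ v x s := by
    rcases le_or_gt t (t0 + 1) with h1 | h1
    · exact ⟨t0, ht0, h, h1, fun x hx => (min_le_left _ _).trans (hmin hx)⟩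
    · have hsub : Icc (t - 1) t ⊆ J := fun r hr =>
        S.hJc.out ht0 ht ⟨by linarith [hr.1], hr.2⟩
      obtain ⟨s, hs, he⟩ := exists_hasDerivAt_eq_slope L L' (show t - 1 < t by linarith)
        (fun r hr => (hd r (hsub hr)).continuousAt.continuousWithinAt)
        (fun r hr => hd r (hsub (Ioo_subset_Icc_self hr)))
      have hsJ := hsub (Ioo_subset_Icc_self hs)
      refine ⟨s, hsJ, hs.2.le, by linarith [hs.1], fun x hx => (min_le_right _ _).trans ?_⟩
      have q1 := hle s hsJ
      have q2 : L' s = L t - L (t - 1) := by rw [he]; simp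
      have q3 := hLb (t - 1) (hsub ⟨le_rfl, by linarith⟩) (by linarith)
      have q4 := hL0 t ht
      have q5 := hL0 s hsJ
      have q6 := hLb s hsJ (by linarith [hs.1])
      have wc := S.wx_cont hsJ
      have hw := sob1 S.hab (fun x hx => S.w_deriv hsJ hx) wc hx
      have hcs := cs hab (f := fun x => |vx x s / (1 + v x s) - vx x s / v x s|)
        (g := fun _ => 1) wc.abs continuousOn_const
      simp only [mul_one, sq_abs, one_pow, int_one] at hcs
      change L' s ≤ -(c / (b - a)) * L s - _ + K at q1
      set G := ∫ x in a..b, (vx x s / (1 + v x s) - vx x s / v x s) ^ 2 with hG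
      set A := ∫ x in a..b, |vx x s / (1 + v x s) - vx x s / v x s| with hA
      change _ ≤ (b - a)⁻¹ * L s + A at hw
      have q7 : 0 ≤ (c / (b - a)) * L s := by positivity
      have q8 : G ≤ 2 * (K + Lm) := by linarith
      have q9 : A ≤ 1 + A ^ 2 := by nlinarith [sq_nonneg (A - 1)]
      have q10 : G * (b - a) ≤ 2 * (K + Lm) * (b - a) := mul_le_mul_of_nonneg_right q8 hl.le
      have q11 : (b - a)⁻¹ * L s ≤ (b - a)⁻¹ * Lm := mul_le_mul_of_nonneg_left q6 (by positivity)
      have hp := S.rv.pos x hx s hsJ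
      have q12 : -log (v x s) ≤ W := by
        have := log_nonneg (show 1 ≤ 1 + v x s by linarith)
        linarith
      rw [← le_log_iff_exp_le hp]
      linarith
  refine le_trans ?_ (S.compare hs ht hst hms hx)
  refine mul_le_mul_of_nonneg_left (exp_le_exp.2 (by linarith)) hmp.le

end

end Cr

namespace Cr

lemma It'_open (S : ℝ≥0∞) : IsOpen (It' S) :=
  isOpen_Ioi.inter (isOpen_Iio.preimage ENNReal.continuous_ofReal)

lemma It'_conn (S : ℝ≥0∞) : (It' S).OrdConnected :=
  ⟨fun _ hx _ hy _ hz => ⟨lt_of_lt_of_le hx.1 hz.1,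
    lt_of_le_of_lt (ENNReal.ofReal_le_ofReal hz.2) hy.2⟩⟩

lemma clos {a b M : ℝ} (hab : a < b) {f : ℝ → ℝ} (hf : ContinuousOn f (Icc a b))
    (h : ∀ x ∈ Ioo a b, f x ∈ Icc 0 M) : ∀ x ∈ Icc a b, f x ∈ Icc 0 M := by
  intro x hx
  have hc : closure (Ioo a b) = Icc a b := closure_Ioo hab.ne
  have h1 := ContinuousOn.image_closure (s := Ioo a b) (by rwa [hc])
  have h2 : f x ∈ closure (f '' Ioo a b) := h1 ⟨x, by rwa [hc], rfl⟩
  have h3 : f '' Ioo a b ⊆ Icc 0 M := by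
    rintro _ ⟨z, hz, rfl⟩
    exact h z hz
  exact closure_minimal h3 isClosed_Icc h2

/-- Residual of the first equation. -/
def res1 (χ : ℝ) (u v : ℝ → ℝ → ℝ) : ℝ → ℝ → ℝ := fun x t =>
  pdt u x t - (pdx (pdx u) x t
    - χ * (pdx u x t / v x t * pdx v x t - u x t / v x t ^ 2 * pdx v x t ^ 2
      + u x t / v x t * pdx (pdx v) x t)) + u x t * v x t

/-- Residual of the second equation. -/
def res2 (u v : ℝ → ℝ → ℝ) : ℝ → ℝ → ℝ := fun x t =>
  pdt v x t - pdx (pdx v) x t - u x t * v x t + v x t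

section
variable {a b χ : ℝ} {B1 B2 : ℝ → ℝ → ℝ} {u0 v0 : ℝ → ℝ} {u v : ℝ → ℝ → ℝ} {Tmax : ℝ≥0∞}

lemma res1_eq (h : CrimeSol a b χ B1 B2 u0 v0 u v Tmax) {x t : ℝ} (hx : x ∈ Ioo a b)
    (ht : t ∈ It' Tmax) : res1 χ u v x t = B1 x t := by
  have hx' := Ioo_subset_Icc_self hx
  have hv := (h.v_pos x hx' t ht).ne'
  obtain ⟨du, -, -⟩ := h.u_reg x hx' t ht
  obtain ⟨dv, dvx, -⟩ := h.v_reg x hx' t ht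
  have e : pdx (fun y s => u y s / v y s * pdx v y s) x t
      = pdx u x t / v x t * pdx v x t - u x t / v x t ^ 2 * pdx v x t ^ 2
        + u x t / v x t * pdx (pdx v) x t := by
    have hd := (du.hasDerivAt.div dv.hasDerivAt hv).mul dvx.hasDerivAt
    have := hd.deriv
    change deriv (fun y => u y t / v y t * pdx v y t) x = _
    refine Eq.trans this ?_
    change ((pdx u x t * v x t - u x t * pdx v x t) / v x t ^ 2) * pdx v x t
      + u x t / v x t * pdx (pdx v) x t = _
    field_simp
  have := h.u_eq x hx t ht
  rw [e] at this
  simp only [res1]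
  linarith

lemma res2_eq (h : CrimeSol a b χ B1 B2 u0 v0 u v Tmax) {x t : ℝ} (hx : x ∈ Ioo a b)
    (ht : t ∈ It' Tmax) : res2 u v x t = B2 x t := by
  have := h.v_eq x hx t ht
  simp only [res2]
  linarith

lemma It'_sub : It' Tmax ⊆ It Tmax := fun _ h => ⟨h.1.le, h.2⟩

lemma build (hab : a < b) (h : CrimeSol a b χ B1 B2 u0 v0 u v Tmax) {M : ℝ}
    (h1 : ∀ x t, 0 ≤ B1 x t ∧ B1 x t ≤ M) (h2 : ∀ x t, 0 ≤ B2 x t ∧ B2 x t ≤ M)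
    {J : Set ℝ} (hJ : IsOpen J) (hJc : J.OrdConnected) (hs : J ⊆ It' Tmax) :
    Sys a b χ M J u (pdx u) (pdx (pdx u)) (pdt u) v (pdx v) (pdx (pdx v)) (pdt v)
      (res1 χ u v) (res2 u v) := by
  have cu := h.u_cont.mono (prod_mono_right (s := Icc a b) (hs.trans It'_sub))
  have cv := h.v_cont.mono (prod_mono_right (s := Icc a b) (hs.trans It'_sub))
  have c3u := h.u_cont21.mono (prod_mono_right (s := Icc a b) hs)
  have c3v := h.v_cont21.mono (prod_mono_right (s := Icc a b) hs)
  have u1 := c3u.fst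
  have u2 := c3u.snd.fst
  have u3 := c3u.snd.snd
  have v1 := c3v.fst
  have v2 := c3v.snd.fst
  have v3 := c3v.snd.snd
  have vne : ∀ p ∈ Icc a b ×ˢ J, v p.1 p.2 ≠ 0 := fun p hp =>
    (h.v_pos p.1 hp.1 p.2 (hs hp.2)).ne'
  have vne2 : ∀ p ∈ Icc a b ×ˢ J, v p.1 p.2 ^ 2 ≠ 0 := fun p hp => pow_ne_zero 2 (vne p hp)
  have cr1 : ContinuousOn (fun p : ℝ × ℝ => res1 χ u v p.1 p.2) (Icc a b ×ˢ J) := by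
    have q1 := u1.div cv vne
    have q2 := cu.div (cv.pow 2) vne2
    have q3 := cu.div cv vne
    exact (u3.sub (u2.sub ((((q1.mul v1).sub (q2.mul (v1.pow 2))).add (q3.mul v2)).const_mul χ))).add
      (cu.mul cv)
  have cr2 : ContinuousOn (fun p : ℝ × ℝ => res2 u v p.1 p.2) (Icc a b ×ˢ J) :=
    ((v3.sub v2).sub (cu.mul cv)).add cv
  refine ⟨hab, hJ, hJc, ?_, ?_, cr1, cr2, ?_, ?_, ?_, ?_⟩
  · exact ⟨fun x hx t ht => (h.u_reg x hx t (hs ht)).1.hasDerivAt,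
      fun x hx t ht => (h.u_reg x hx t (hs ht)).2.1.hasDerivAt,
      fun x hx t ht => (h.u_reg x hx t (hs ht)).2.2.hasDerivAt, cu, u1, u2, u3,
      fun t ht => (h.u_bc t (hs ht)).1, fun t ht => (h.u_bc t (hs ht)).2,
      fun x hx t ht => h.u_pos x hx t (hs ht)⟩
  · exact ⟨fun x hx t ht => (h.v_reg x hx t (hs ht)).1.hasDerivAt,
      fun x hx t ht => (h.v_reg x hx t (hs ht)).2.1.hasDerivAt,
      fun x hx t ht => (h.v_reg x hx t (hs ht)).2.2.hasDerivAt, cv, v1, v2, v3,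
      fun t ht => (h.v_bc t (hs ht)).1, fun t ht => (h.v_bc t (hs ht)).2,
      fun x hx t ht => h.v_pos x hx t (hs ht)⟩
  · intro x hx t ht
    exact clos hab (slice cr1 ht) (fun y hy => by rw [res1_eq h hy (hs ht)]; exact h1 y t) x hx
  · intro x hx t ht
    exact clos hab (slice cr2 ht) (fun y hy => by rw [res2_eq h hy (hs ht)]; exact h2 y t) x hx
  · intro x hx t ht
    simp only [res1]
    ring
  · intro x hx t ht
    simp only [res2]
    ring

lemma tau_lt (hT : 0 < Tmax) : 0 < tauOf Tmax ∧ ENNReal.ofReal (tauOf Tmax) < Tmax := by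
  have hne : min 1 (Tmax / 3) ≠ ⊤ := ne_top_of_le_ne_top ENNReal.one_ne_top (min_le_left _ _)
  have h0 : min 1 (Tmax / 3) ≠ 0 := by
    refine ne_of_gt (lt_min one_pos (ENNReal.div_pos hT.ne' (by norm_num)))
  refine ⟨ENNReal.toReal_pos h0 hne, ?_⟩
  rw [tauOf, ENNReal.ofReal_toReal hne]
  by_cases h : Tmax = ⊤
  · rw [h]; exact lt_of_le_of_lt (min_le_left _ _) ENNReal.one_lt_top
  · refine lt_of_le_of_lt (min_le_right _ _) (ENNReal.div_lt_of_lt_mul ?_)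
    lift Tmax to ℝ≥0 using h
    have : 0 < Tmax := by exact_mod_cast hT
    have h2 : Tmax < Tmax * 3 := by
      have : (0:ℝ) < Tmax := this
      rw [← NNReal.coe_lt_coe]; push_cast; linarith
    exact_mod_cast h2

/-- Conclusion from a positive lower bound of `v`. -/
lemma concl (hab : a < b) (hχ : 0 < χ) (h : CrimeSol a b χ B1 B2 u0 v0 u v Tmax) {M : ℝ}
    (h1 : ∀ x t, 0 ≤ B1 x t ∧ B1 x t ≤ M) (h2 : ∀ x t, 0 ≤ B2 x t ∧ B2 x t ≤ M)
    {S : ℝ≥0∞} (hS : S ≤ Tmax) {τ : ℝ} (hτ : 0 < τ) (hτS : ENNReal.ofReal τ < S)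
    {δ : ℝ} (hδ : 0 < δ) (hv : ∀ t ∈ It' S, τ / 2 ≤ t → ∀ x ∈ Icc a b, δ ≤ v x t)
    {γ : ℝ} (hγ0 : 0 < γ) (hγ : γ ≤ 1/2) :
    ∃ C : ℝ, 0 < C ∧ ∀ t : ℝ, τ < t → ENNReal.ofReal t < S → (∀ x ∈ Icc a b, |u x t| ≤ C) ∧
      ∀ x ∈ Icc a b, ∀ y ∈ Icc a b, |u x t - u y t| ≤ C * |x - y| ^ γ := by
  have sub : It' S ∩ Ioi (τ / 2) ⊆ It' Tmax := fun t ht => ⟨ht.1.1, lt_of_lt_of_le ht.1.2 hS⟩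
  have Sy := build hab h h1 h2 (J := It' S ∩ Ioi (τ / 2)) ((It'_open S).inter isOpen_Ioi)
    ((It'_conn S).inter ordConnected_Ioi) sub
  have hτ2 : τ / 2 < τ := by linarith
  obtain ⟨C, hC, hb⟩ := Sy.final hδ (fun x hx t ht => hv t ht.1 (le_of_lt ht.2) x hx) hχ
    (t0 := τ) ⟨⟨hτ, hτS⟩, hτ2⟩ hγ0 hγ
  exact ⟨C, hC, fun t ht hts => hb t ⟨⟨hτ.trans ht, hts⟩, hτ2.trans ht⟩ ht.le⟩

lemma res2_int (hab : a < b) (h : CrimeSol a b χ B1 B2 u0 v0 u v Tmax) {t : ℝ}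
    (ht : t ∈ It' Tmax) : ∫ x in a..b, res2 u v x t = ∫ x in Ioo a b, B2 x t := by
  rw [intervalIntegral.integral_of_le hab.le, integral_Ioc_eq_integral_Ioo]
  exact setIntegral_congr_fun measurableSet_Ioo fun x hx => res2_eq h hx ht

end

end Cr

/-- Lemma 4.3 (Hölder bound for `u(·,t)`, uniform in time under (H2)):
the bound `C` controls both `sup_Ω̄ |u(·,t)|` and the Hölder seminorm of
exponent `γ` of `u(·,t)` on `Ω̄`. -/
theorem Holder_bound_for_u
    (a b χ : ℝ) (hab : a < b) (hχ : 0 < χ)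
    (B1 B2 : ℝ → ℝ → ℝ) (hB1 : HypB a b B1) (hB2 : HypB a b B2)
    (u0 v0 : ℝ → ℝ) (hinit : HypInit a b u0 v0)
    (Tmax : ℝ≥0∞) (hT : 0 < Tmax)
    (u v : ℝ → ℝ → ℝ) (hsol : CrimeSol a b χ B1 B2 u0 v0 u v Tmax)
    (γ : ℝ) (hγ : γ ∈ Set.Ioo (0:ℝ) (1/3)) (hγχ : γ < 1 / (1 + 2 * χ^2)) :
    (∀ T : ℝ, 0 < T → ∃ C : ℝ, 0 < C ∧
      ∀ t : ℝ, tauOf Tmax < t →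
        ENNReal.ofReal t < min (ENNReal.ofReal T) Tmax →
        (∀ x ∈ Set.Icc a b, |u x t| ≤ C) ∧
        (∀ x ∈ Set.Icc a b, ∀ y ∈ Set.Icc a b,
          |u x t - u y t| ≤ C * |x - y| ^ γ)) ∧
    (HypH2 a b B2 → ∃ C : ℝ, 0 < C ∧
      ∀ t : ℝ, tauOf Tmax < t → ENNReal.ofReal t < Tmax →
        (∀ x ∈ Set.Icc a b, |u x t| ≤ C) ∧
        (∀ x ∈ Set.Icc a b, ∀ y ∈ Set.Icc a b,
          |u x t - u y t| ≤ C * |x - y| ^ γ)) := by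
  have main : ∃ M : ℝ, (∀ x t, 0 ≤ B1 x t ∧ B1 x t ≤ M) ∧ (∀ x t, 0 ≤ B2 x t ∧ B2 x t ≤ M) := by
    obtain ⟨p1, ⟨M1, q1⟩, -⟩ := hB1
    obtain ⟨p2, ⟨M2, q2⟩, -⟩ := hB2
    exact ⟨max M1 M2, fun x t => ⟨p1 x t, (q1 x t).trans (le_max_left _ _)⟩,
      fun x t => ⟨p2 x t, (q2 x t).trans (le_max_right _ _)⟩⟩
  obtain ⟨M, h1, h2⟩ := main
  obtain ⟨hτ, hτT⟩ := Cr.tau_lt hT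
  set τ := tauOf Tmax with hτd
  have hγ0 : 0 < γ := hγ.1
  have hγ2 : γ ≤ 1/2 := by linarith [hγ.2]
  have Sy := Cr.build hab hsol h1 h2 (Cr.It'_open Tmax) (Cr.It'_conn Tmax) Subset.rfl
  have hτ2 : τ / 2 ∈ It' Tmax :=
    ⟨by linarith, lt_of_le_of_lt (ENNReal.ofReal_le_ofReal (by linarith)) hτT⟩
  refine ⟨fun T hT0 => ?_, fun ⟨c, hc, hH⟩ => ?_⟩
  · by_cases hS : ENNReal.ofReal τ < min (ENNReal.ofReal T) Tmax
    · obtain ⟨y, hy, hmin⟩ := isCompact_Icc.exists_isMinOn (nonempty_Icc.2 hab.le)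
        (Cr.slice Sy.rv.c0 hτ2)
      have hm0 : 0 < v y (τ / 2) := hsol.v_pos y hy _ hτ2
      refine Cr.concl hab hχ hsol h1 h2 (min_le_right _ _) hτ hS
        (δ := v y (τ / 2) * exp (-T)) (by positivity) (fun t ht htτ x hx => ?_) hγ0 hγ2
      have htT : t < T := by
        have := lt_of_lt_of_le ht.2 (min_le_left _ _)
        exact (ENNReal.ofReal_lt_ofReal_iff hT0).1 this
      refine le_trans ?_ (Sy.compare hτ2 ⟨ht.1, lt_of_lt_of_le ht.2 (min_le_right _ _)⟩ htτ
        (fun x hx => hmin hx) hx)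
      exact mul_le_mul_of_nonneg_left (exp_le_exp.2 (by linarith)) hm0.le
    · refine ⟨1, one_pos, fun t ht hts => absurd ?_ hS⟩
      exact lt_of_le_of_lt (ENNReal.ofReal_le_ofReal ht.le) hts
  · obtain ⟨δ, hδ, hv⟩ := Sy.lower hc
      (fun t ht => by rw [Cr.res2_int hab hsol ht]; exact hH t ht.1) hτ2
    exact Cr.concl hab hχ hsol h1 h2 le_rfl hτ hτT hδ hv hγ0 hγ2
end
end

section
/- Let χ > 0, assume (B) and (init), and let (u, v) be the global classical solution of the crime model on Ω̄ × [0, ∞). If hypotheses (H2) and (H1') are satisfied, then ∫_Ω u(·,t) → 0 as t → ∞. -/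
open Real MeasureTheory Filter Topology Set
open scoped ENNReal NNReal

noncomputable section

lemma cd_slice {a b : ℝ} {F : ℝ → ℝ → ℝ}
    (hF : ContinuousOn (fun p : ℝ × ℝ => F p.1 p.2) (Set.Icc a b ×ˢ Set.Ioi (0:ℝ)))
    {t : ℝ} (ht : 0 < t) : ContinuousOn (fun x => F x t) (Set.Icc a b) := by
  have : ContinuousOn (fun x : ℝ => ((x, t) : ℝ × ℝ)) (Set.Icc a b) := by fun_prop
  exact hF.comp this (fun x hx => ⟨hx, ht⟩)

lemma cd_bound {a b : ℝ} {F : ℝ → ℝ → ℝ}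
    (hF : ContinuousOn (fun p : ℝ × ℝ => F p.1 p.2) (Set.Icc a b ×ˢ Set.Ioi (0:ℝ)))
    {t : ℝ} (ht : 0 < t) :
    ∃ C : ℝ, ∀ s ∈ Set.Icc (t/2) (t+1), ∀ x ∈ Set.Icc a b, ‖F x s‖ ≤ C := by
  have hK : IsCompact (Set.Icc a b ×ˢ Set.Icc (t/2) (t+1)) := isCompact_Icc.prod isCompact_Icc
  obtain ⟨C, hC⟩ := hK.exists_bound_of_continuousOn (hF.mono (by
    rintro ⟨x, s⟩ ⟨hx, hs⟩
    exact ⟨hx, by simp only [Set.mem_Ioi]; linarith [hs.1]⟩))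
  exact ⟨C, fun s hs x hx => hC (x, s) ⟨hx, hs⟩⟩

lemma cd_nhds {t : ℝ} (ht : 0 < t) : Set.Icc (t/2) (t+1) ∈ 𝓝 t :=
  Icc_mem_nhds (by linarith) (by linarith)

lemma cd_meas {a b : ℝ} (hab : a < b) {f : ℝ → ℝ} (hf : ContinuousOn f (Set.Icc a b)) :
    AEStronglyMeasurable f (volume.restrict (Set.uIoc a b)) := by
  have h1 : IntervalIntegrable f volume a b :=
    ContinuousOn.intervalIntegrable (by rwa [Set.uIcc_of_le hab.le])
  rw [intervalIntegrable_iff] at h1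
  exact h1.aestronglyMeasurable

lemma cd_int {a b : ℝ} (hab : a < b) {f : ℝ → ℝ} (hf : ContinuousOn f (Set.Icc a b)) :
    IntervalIntegrable f volume a b :=
  ContinuousOn.intervalIntegrable (by rwa [Set.uIcc_of_le hab.le])

/-- differentiation under the integral sign -/
lemma cd_deriv {a b : ℝ} (hab : a < b) {F F' : ℝ → ℝ → ℝ}
    (hF : ContinuousOn (fun p : ℝ × ℝ => F p.1 p.2) (Set.Icc a b ×ˢ Set.Ioi (0:ℝ)))
    (hF' : ContinuousOn (fun p : ℝ × ℝ => F' p.1 p.2) (Set.Icc a b ×ˢ Set.Ioi (0:ℝ)))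
    (hd : ∀ x ∈ Set.Icc a b, ∀ t, 0 < t → HasDerivAt (fun s => F x s) (F' x t) t)
    {t : ℝ} (ht : 0 < t) :
    HasDerivAt (fun s => ∫ x in a..b, F x s) (∫ x in a..b, F' x t) t := by
  obtain ⟨C, hC⟩ := cd_bound hF' ht
  have hsub : ∀ x ∈ Set.uIoc a b, x ∈ Set.Icc a b := fun x hx => by
    rw [Set.uIoc_of_le hab.le] at hx; exact Set.Ioc_subset_Icc_self hx
  refine (intervalIntegral.hasDerivAt_integral_of_dominated_loc_of_deriv_le
    (F := fun s x => F x s) (F' := fun s x => F' x s) (bound := fun _ => C)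
    (cd_nhds ht) ?_ ?_ ?_ ?_ ?_ ?_).2
  · filter_upwards [cd_nhds ht] with s hs
    exact cd_meas hab (cd_slice hF (by linarith [hs.1]))
  · exact cd_int hab (cd_slice hF ht)
  · exact cd_meas hab (cd_slice hF' ht)
  · exact Filter.Eventually.of_forall fun x hx s hs => hC s hs x (hsub x hx)
  · exact intervalIntegrable_const
  · exact Filter.Eventually.of_forall fun x hx s hs => hd x (hsub x hx) s (by linarith [hs.1])

lemma cd_cont {a b : ℝ} (hab : a < b) {F : ℝ → ℝ → ℝ}
    (hF : ContinuousOn (fun p : ℝ × ℝ => F p.1 p.2) (Set.Icc a b ×ˢ Set.Ioi (0:ℝ)))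
    {t : ℝ} (ht : 0 < t) :
    ContinuousAt (fun s => ∫ x in a..b, F x s) t := by
  obtain ⟨C, hC⟩ := cd_bound hF ht
  have hsub : ∀ x ∈ Set.uIoc a b, x ∈ Set.Icc a b := fun x hx => by
    rw [Set.uIoc_of_le hab.le] at hx; exact Set.Ioc_subset_Icc_self hx
  refine intervalIntegral.continuousAt_of_dominated_interval
    (F := fun s x => F x s) (bound := fun _ => C) ?_ ?_ intervalIntegrable_const ?_
  · filter_upwards [cd_nhds ht] with s hs
    exact cd_meas hab (cd_slice hF (by linarith [hs.1]))
  · filter_upwards [cd_nhds ht] with s hs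
    exact Filter.Eventually.of_forall fun x hx => hC s hs x (hsub x hx)
  · refine Filter.Eventually.of_forall fun x hx => ?_
    have h1 : ContinuousOn (fun s => F x s) (Set.Ioi 0) :=
      hF.comp (f := fun s : ℝ => ((x, s) : ℝ × ℝ)) (by fun_prop) (fun s hs => ⟨hsub x hx, hs⟩)
    exact h1.continuousAt (Ioi_mem_nhds ht)

/-- linear differential inequality -/
lemma cd_barrier {f f' : ℝ → ℝ} {A k : ℝ} (hk : 0 < k)
    (hd : ∀ t, 0 < t → HasDerivAt f (f' t) t) (h : ∀ t, 1 ≤ t → A - k * f t ≤ f' t)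
    {t : ℝ} (ht : 1 ≤ t) : min (f 1) (A / k) ≤ f t := by
  have hD : ∀ s, 0 < s → HasDerivAt (fun s => Real.exp (k * s) * (f s - A / k))
      (Real.exp (k * s) * k * (f s - A / k) + Real.exp (k * s) * f' s) s := by
    intro s hs
    have h1 : HasDerivAt (fun s => Real.exp (k * s)) (Real.exp (k * s) * k) s := by
      simpa using ((hasDerivAt_id s).const_mul k).exp
    exact h1.mul ((hd s hs).sub_const _)
  have hm : MonotoneOn (fun s => Real.exp (k * s) * (f s - A / k)) (Set.Ici 1) := by
    refine monotoneOn_of_deriv_nonneg (convex_Ici 1) ?_ ?_ ?_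
    · intro s hs
      exact (hD s (by linarith [Set.mem_Ici.1 hs])).continuousAt.continuousWithinAt
    · intro s hs
      rw [interior_Ici] at hs
      exact (hD s (by linarith [Set.mem_Ioi.1 hs])).differentiableAt.differentiableWithinAt
    · intro s hs
      rw [interior_Ici] at hs
      rw [(hD s (by linarith [Set.mem_Ioi.1 hs])).deriv]
      have h2 := h s (le_of_lt hs)
      have h3 : k * (A / k) = A := by field_simp
      have : 0 ≤ Real.exp (k * s) * (f' s - (A - k * f s)) :=
        mul_nonneg (Real.exp_pos _).le (by linarith)
      have e : Real.exp (k * s) * k * (f s - A / k) + Real.exp (k * s) * f' s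
        = Real.exp (k * s) * (f' s - (k * (A / k) - k * f s)) := by ring
      rw [e, h3]; exact this
  have h4 := hm (Set.mem_Ici.2 le_rfl) (Set.mem_Ici.2 ht) ht
  simp only at h4
  by_contra hcon
  push Not at hcon
  obtain ⟨c1, c2⟩ := lt_min_iff.1 hcon
  have e1 : Real.exp (k * 1) ≤ Real.exp (k * t) := Real.exp_le_exp.2 (by nlinarith)
  have e2 := Real.exp_pos (k * 1)
  have e3 : Real.exp (k * t) * (f t - A / k) ≤ Real.exp (k * 1) * (f t - A / k) := by
    nlinarith
  nlinarith

/-- contraction lemma -/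
lemma cd_contr {f e : ℝ → ℝ} {θ : ℝ} (h0 : 0 < θ) (h1 : θ < 1)
    (hf : ∀ t, 1 ≤ t → 0 ≤ f t) (hc : ContinuousOn f (Set.Ici 1))
    (hs : ∀ t, 1 ≤ t → f (t + 1) ≤ θ * f t + e t) (he : Tendsto e atTop (𝓝 0)) :
    Tendsto f atTop (𝓝 0) := by
  rw [Metric.tendsto_atTop]
  intro ε hε
  have hev : ∀ᶠ t in atTop, e t < (1 - θ) * (ε / 2) :=
    he.eventually_lt_const (mul_pos (by linarith) (by linarith))
  obtain ⟨T0, hT0⟩ := eventually_atTop.1 hev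
  set T := max T0 1 with hT
  have hT1 : 1 ≤ T := le_max_right _ _
  have hT2 : T0 ≤ T := le_max_left _ _
  obtain ⟨M, hM⟩ := (isCompact_Icc (a := T) (b := T + 1)).exists_bound_of_continuousOn
    (hc.mono (fun x hx => le_trans hT1 hx.1))
  have hind : ∀ n : ℕ, ∀ s ∈ Set.Icc T (T+1), f (s + n) ≤ θ ^ n * M + ε / 2 := by
    intro n
    induction n with
    | zero =>
      intro s hs'
      have := le_trans (le_abs_self _) (hM s hs')
      simp; linarith
    | succ n ih =>
      intro s hs'
      have hn : (0:ℝ) ≤ n := Nat.cast_nonneg n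
      have a1 := hs (s + n) (by linarith [hs'.1])
      have a2 := hT0 (s + n) (by linarith [hs'.1])
      have a3 := mul_le_mul_of_nonneg_left (ih s hs') h0.le
      push_cast
      rw [← add_assoc, pow_succ]
      nlinarith
  have hp : Tendsto (fun n : ℕ => θ ^ n * M) atTop (𝓝 0) := by
    simpa using (tendsto_pow_atTop_nhds_zero_of_lt_one h0.le h1).mul_const M
  obtain ⟨N, hN⟩ := eventually_atTop.1 (hp.eventually_lt_const (by linarith : (0:ℝ) < ε / 2))
  refine ⟨T + N, fun t ht => ?_⟩
  have hN0 : (0:ℝ) ≤ N := Nat.cast_nonneg N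
  have htT : 0 ≤ t - T := by linarith
  have b1 := Nat.floor_le htT
  have b2 := Nat.lt_floor_add_one (t - T)
  have b3 : N ≤ ⌊t - T⌋₊ := Nat.le_floor (by linarith)
  have b4 := hind ⌊t - T⌋₊ (t - ⌊t - T⌋₊) ⟨by linarith, by linarith⟩
  have b5 := hN _ b3
  rw [sub_add_cancel] at b4
  rw [Real.dist_eq, sub_zero, abs_of_nonneg (hf t (by linarith))]
  linarith

/-- the final ODE argument -/
lemma cd_ode {U U' y y' β : ℝ → ℝ} {c K : ℝ} (hc : 0 < c)
    (hU : ∀ t, 0 < t → HasDerivAt U (U' t) t) (hy : ∀ t, 0 < t → HasDerivAt y (y' t) t)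
    (hβc : ContinuousOn β (Set.Ioi 0)) (hβ : ∀ t, 0 < t → 0 ≤ β t)
    (hU0 : ∀ t, 0 < t → 0 ≤ U t)
    (hy0 : ∀ t, 1 ≤ t → y t ≤ 0) (hyK : ∀ t, 1 ≤ t → -K ≤ y t)
    (hin : ∀ t, 1 ≤ t → U' t ≤ -(c * (1 - y' t)) * U t + β t)
    (hlim : Tendsto (fun t => ∫ s in t..(t+1), β s) atTop (𝓝 0)) :
    Tendsto U atTop (𝓝 0) := by
  set f : ℝ → ℝ := fun t => Real.exp (-(c * y t)) * U t with hf
  have hfc : ContinuousOn f (Set.Ici 1) := by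
    intro t ht
    have ht' : 0 < t := by linarith [Set.mem_Ici.1 ht]
    have h1 := (hU t ht').continuousAt
    have h2 := (hy t ht').continuousAt
    exact (((h2.const_mul c).neg.rexp).mul h1).continuousWithinAt
  have hf0 : ∀ t, 1 ≤ t → 0 ≤ f t := fun t ht =>
    mul_nonneg (Real.exp_pos _).le (hU0 t (by linarith))
  have hD : ∀ t, 0 < t → HasDerivAt (fun t => Real.exp (c * (t - y t)) * U t)
      (Real.exp (c * (t - y t)) * (c * (1 - y' t)) * U t + Real.exp (c * (t - y t)) * U' t) t := by
    intro t ht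
    exact ((((hasDerivAt_id t).sub (hy t ht)).const_mul c).exp).mul (hU t ht)
  have hstep : ∀ t, 1 ≤ t → f (t + 1) ≤ Real.exp (-c) * f t
      + Real.exp (c * K) * ∫ s in t..(t+1), β s := by
    intro t ht
    have hβI : ContinuousOn β (Set.Icc t (t+1)) := hβc.mono (fun s hs => by
      simp only [Set.mem_Ioi]; linarith [hs.1])
    have key := intervalIntegral.sub_le_integral_of_hasDeriv_right_of_le
      (a := t) (b := t + 1) (g := fun t => Real.exp (c * (t - y t)) * U t)
      (g' := fun t => Real.exp (c * (t - y t)) * (c * (1 - y' t)) * U t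
        + Real.exp (c * (t - y t)) * U' t)
      (φ := fun s => (Real.exp (c * (t + 1)) * Real.exp (c * K)) * β s)
      (by linarith)
      (fun s hs => (hD s (by linarith [hs.1])).continuousAt.continuousWithinAt)
      (fun s hs => (hD s (by linarith [hs.1])).hasDerivWithinAt)
      ((hβI.const_mul _).integrableOn_Icc) (by
        intro s hs
        have hs1 : 1 ≤ s := by linarith [hs.1]
        have i1 := hin s hs1
        have i2 : Real.exp (c * (s - y s)) ≤ Real.exp (c * (t + 1)) * Real.exp (c * K) := by
          rw [← Real.exp_add, Real.exp_le_exp]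
          have := hyK s hs1
          have := hs.2
          nlinarith
        have i3 := hβ s (by linarith)
        have i4 := mul_le_mul_of_nonneg_left i1 (Real.exp_pos (c * (s - y s))).le
        have i5 := mul_le_mul_of_nonneg_right i2 i3
        nlinarith)
    rw [intervalIntegral.integral_const_mul] at key
    have k1 : ∀ s, Real.exp (c * (s - y s)) * U s = Real.exp (c * s) * f s := by
      intro s
      rw [hf]; simp only
      rw [← mul_assoc, ← Real.exp_add]; ring_nf
    rw [k1, k1] at key
    have k2 : Real.exp (c * t) = Real.exp (c * (t+1)) * Real.exp (-c) := by
      rw [← Real.exp_add]; ring_nf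
    rw [k2] at key
    have k3 := Real.exp_pos (c * (t+1))
    have k4 : Real.exp (c * (t+1)) * f (t+1) ≤ Real.exp (c * (t+1)) * (Real.exp (-c) * f t
      + Real.exp (c * K) * ∫ s in t..(t+1), β s) := by linarith
    exact le_of_mul_le_mul_left k4 k3
  have hft : Tendsto f atTop (𝓝 0) := by
    refine cd_contr (Real.exp_pos (-c)) (Real.exp_lt_one_iff.2 (by linarith)) hf0 hfc hstep ?_
    simpa using hlim.const_mul (Real.exp (c * K))
  refine tendsto_of_tendsto_of_tendsto_of_le_of_le' tendsto_const_nhds hft ?_ ?_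
  · filter_upwards [eventually_ge_atTop 1] with t ht using hU0 t (by linarith)
  · filter_upwards [eventually_ge_atTop 1] with t ht
    have h1 : 1 ≤ Real.exp (-(c * y t)) := by
      apply Real.one_le_exp
      have := hy0 t ht
      nlinarith
    have h2 := hU0 t (by linarith)
    rw [hf]; simp only
    nlinarith

/-- spatial estimate at a fixed time -/
lemma cd_space {a b m : ℝ} (hab : a < b) {v vx vxx vt : ℝ → ℝ} (hm : 0 < m)
    (hv : ∀ x ∈ Set.Icc a b, 0 < v x)
    (hvx : ∀ x ∈ Set.Icc a b, HasDerivAt v (vx x) x)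
    (hvxx : ∀ x ∈ Set.Icc a b, HasDerivAt vx (vxx x) x)
    (hcxx : ContinuousOn vxx (Set.Icc a b)) (hct : ContinuousOn vt (Set.Icc a b))
    (ha : vx a = 0) (hb : vx b = 0)
    (hin : ∀ x ∈ Set.Ioo a b, vxx x - v x ≤ vt x)
    (hmx : ∃ x ∈ Set.Icc a b, m ≤ v x) :
    ∀ x ∈ Set.Icc a b, Real.log m - Real.log (1 + m) - 5 / 4 * (b - a)
      - (∫ x in a..b, vt x / (v x * (1 + v x))) ≤ Real.log (v x) - Real.log (1 + v x) := by
  have hcv : ContinuousOn v (Set.Icc a b) := HasDerivAt.continuousOn hvx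
  have hcx : ContinuousOn vx (Set.Icc a b) := HasDerivAt.continuousOn hvxx
  have hne : ∀ x ∈ Set.Icc a b, v x * (1 + v x) ≠ 0 := fun x hx => by
    have := hv x hx; positivity
  have hcden : ContinuousOn (fun x => v x * (1 + v x)) (Set.Icc a b) := by fun_prop
  set r : ℝ → ℝ := fun x => vx x / (v x * (1 + v x)) with hr
  have hcr : ContinuousOn r (Set.Icc a b) := hcx.div hcden hne
  set d : ℝ → ℝ := fun x => (vxx x * (v x * (1 + v x)) - vx x * (vx x * (1 + v x) + v x * vx x))
    / (v x * (1 + v x)) ^ 2 with hd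
  have hrd : ∀ x ∈ Set.Icc a b, HasDerivAt r (d x) x := by
    intro x hx
    exact (hvxx x hx).div ((hvx x hx).mul ((hvx x hx).const_add 1)) (hne x hx)
  have hcd : ContinuousOn d (Set.Icc a b) := by
    refine ContinuousOn.div (by fun_prop) (by fun_prop) (fun x hx => pow_ne_zero 2 (hne x hx))
  have hcd2 : ContinuousOn (fun x => vt x / (v x * (1 + v x))) (Set.Icc a b) :=
    hct.div hcden hne
  have hint0 : ∫ x in a..b, d x = 0 := by
    rw [intervalIntegral.integral_eq_sub_of_hasDerivAt (f := r)
      (by rwa [Set.uIcc_of_le hab.le]) (cd_int hab hcd)]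
    simp [hr, ha, hb]
  have hcr2 : ContinuousOn (fun x => r x ^ 2) (Set.Icc a b) := hcr.pow 2
  have hD : (∫ x in a..b, r x ^ 2) - (b - a) ≤ ∫ x in a..b, vt x / (v x * (1 + v x)) := by
    have e1 : (∫ x in a..b, (d x + r x ^ 2 - 1)) = (∫ x in a..b, r x ^ 2) - (b - a) := by
      rw [intervalIntegral.integral_sub ((cd_int hab hcd).add (cd_int hab hcr2))
        intervalIntegrable_const, intervalIntegral.integral_add (cd_int hab hcd)
        (cd_int hab hcr2), hint0]
      simp
    rw [← e1]
    refine intervalIntegral.integral_mono_on_of_le_Ioo hab.le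
      (((cd_int hab hcd).add (cd_int hab hcr2)).sub intervalIntegrable_const)
      (cd_int hab hcd2) ?_
    intro x hx
    have hx' := Set.Ioo_subset_Icc_self hx
    have p := hv x hx'
    have q := hin x hx
    have s1 : (vxx x - v x) / (v x * (1 + v x)) ≤ vt x / (v x * (1 + v x)) :=
      div_le_div_of_nonneg_right q (by positivity)
    refine le_trans ?_ s1
    have s2 : (vxx x - v x) / (v x * (1 + v x)) - (d x + r x ^ 2 - 1)
        = (2 * v x * vx x ^ 2) / (v x * (1 + v x)) ^ 2 + v x / (1 + v x) := by
      simp only [hd, hr]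
      field_simp
      ring
    have s3 : 0 ≤ (2 * v x * vx x ^ 2) / (v x * (1 + v x)) ^ 2 + v x / (1 + v x) := by positivity
    linarith
  obtain ⟨z, hz, hmz⟩ := hmx
  intro x hx
  have hsub : Set.uIcc x z ⊆ Set.Icc a b := by
    rw [← Set.uIcc_of_le hab.le]
    exact Set.uIcc_subset_uIcc (by rwa [Set.uIcc_of_le hab.le]) (by rwa [Set.uIcc_of_le hab.le])
  have hg : ∀ x ∈ Set.Icc a b, HasDerivAt (fun x => Real.log (v x) - Real.log (1 + v x)) (r x) x := by
    intro x hx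
    have p := hv x hx
    have := ((hvx x hx).log p.ne').sub (((hvx x hx).const_add 1).log (by positivity))
    refine this.congr_deriv (Eq.symm ?_)
    change vx x / (v x * (1 + v x)) = _
    field_simp
    ring
  have hftc := intervalIntegral.integral_eq_sub_of_hasDerivAt (a := x) (b := z)
    (f := fun x => Real.log (v x) - Real.log (1 + v x)) (f' := r)
    (fun w hw => hg w (hsub hw)) ((hcr.mono hsub).intervalIntegrable)
  have hbd : (∫ w in x..z, r w) ≤ (∫ x in a..b, r x ^ 2) + (b - a) / 4 := by
    have t1 : (∫ w in x..z, r w) ≤ ∫ w in Set.uIoc x z, ‖r w‖ :=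
      le_trans (Real.le_norm_self _) intervalIntegral.norm_integral_le_integral_norm_uIoc
    have t2 : (∫ w in Set.uIoc x z, ‖r w‖) ≤ ∫ w in Set.Icc a b, ‖r w‖ := by
      refine setIntegral_mono_set (hcr.norm.integrableOn_Icc)
        (Filter.Eventually.of_forall fun w => norm_nonneg _) ?_
      exact (Set.uIoc_subset_uIcc.trans hsub).eventuallyLE
    have t3 : (∫ w in Set.Icc a b, ‖r w‖) = ∫ w in a..b, ‖r w‖ := by
      rw [intervalIntegral.integral_of_le hab.le, integral_Icc_eq_integral_Ioc]
    have t4 : (∫ w in a..b, ‖r w‖) ≤ ∫ w in a..b, (r w ^ 2 + 1 / 4) := by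
      refine intervalIntegral.integral_mono_on hab.le (cd_int hab hcr.norm)
        ((cd_int hab hcr2).add intervalIntegrable_const) ?_
      intro w _
      rw [Real.norm_eq_abs, ← sq_abs]
      nlinarith [sq_nonneg (|r w| - 1 / 2)]
    have t5 : (∫ w in a..b, (r w ^ 2 + 1 / 4)) = (∫ x in a..b, r x ^ 2) + (b - a) / 4 := by
      rw [intervalIntegral.integral_add (cd_int hab hcr2) intervalIntegrable_const]
      simp; ring
    linarith
  have hL : Real.log m - Real.log (1 + m) ≤ Real.log (v z) - Real.log (1 + v z) := by
    have p := hv z hz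
    rw [← Real.log_div (by positivity) (by positivity),
      ← Real.log_div (by positivity) (by positivity)]
    apply Real.log_le_log (by positivity)
    rw [div_le_div_iff₀ (by positivity) (by positivity)]
    nlinarith
  linarith

/-- Lemma 4.4 (decay of the total mass `∫_Ω u(·,t)` under (H2) and (H1')). -/
theorem mass_decay_of_u
    (a b χ : ℝ) (hab : a < b) (hχ : 0 < χ)
    (B1 B2 : ℝ → ℝ → ℝ) (hB1 : HypB a b B1) (hB2 : HypB a b B2)
    (u0 v0 : ℝ → ℝ) (hinit : HypInit a b u0 v0)
    (u v : ℝ → ℝ → ℝ) (hsol : CrimeSol a b χ B1 B2 u0 v0 u v ⊤)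
    (hH2 : HypH2 a b B2) (hH1' : HypH1' a b B1) :
    Filter.Tendsto (fun t : ℝ => ∫ x in Set.Ioo a b, u x t)
      Filter.atTop (nhds 0) := by
  obtain ⟨c, hc, hB2c⟩ := hH2
  have hI' : It' ⊤ = Set.Ioi (0:ℝ) := by
    ext t; simp [It']
  have hmem : ∀ {t : ℝ}, 0 < t → t ∈ It' ⊤ := fun ht => by rw [hI']; exact ht
  have hsubI : Set.Icc a b ×ˢ Set.Ioi (0:ℝ) ⊆ Set.Icc a b ×ˢ It ⊤ := by
    rintro ⟨x, t⟩ ⟨hx, ht⟩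
    exact ⟨hx, by simpa [It] using le_of_lt ht⟩
  have cu := hsol.u_cont.mono hsubI
  have cv := hsol.v_cont.mono hsubI
  have cu21 := hsol.u_cont21
  have cv21 := hsol.v_cont21
  rw [hI'] at cu21 cv21
  have cux : ContinuousOn (fun p : ℝ × ℝ => pdx u p.1 p.2) (Set.Icc a b ×ˢ Set.Ioi (0:ℝ)) := cu21.fst
  have cuxx : ContinuousOn (fun p : ℝ × ℝ => pdx (pdx u) p.1 p.2) (Set.Icc a b ×ˢ Set.Ioi (0:ℝ)) :=
    cu21.snd.fst
  have cut : ContinuousOn (fun p : ℝ × ℝ => pdt u p.1 p.2) (Set.Icc a b ×ˢ Set.Ioi (0:ℝ)) :=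
    cu21.snd.snd
  have cvx : ContinuousOn (fun p : ℝ × ℝ => pdx v p.1 p.2) (Set.Icc a b ×ˢ Set.Ioi (0:ℝ)) := cv21.fst
  have cvxx : ContinuousOn (fun p : ℝ × ℝ => pdx (pdx v) p.1 p.2) (Set.Icc a b ×ˢ Set.Ioi (0:ℝ)) :=
    cv21.snd.fst
  have cvt : ContinuousOn (fun p : ℝ × ℝ => pdt v p.1 p.2) (Set.Icc a b ×ˢ Set.Ioi (0:ℝ)) :=
    cv21.snd.snd
  have upos : ∀ x ∈ Set.Icc a b, ∀ t, 0 < t → 0 < u x t := fun x hx t ht =>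
    hsol.u_pos x hx t (hmem ht)
  have vpos : ∀ x ∈ Set.Icc a b, ∀ t, 0 < t → 0 < v x t := fun x hx t ht =>
    hsol.v_pos x hx t (hmem ht)
  have dux : ∀ x ∈ Set.Icc a b, ∀ t, 0 < t → HasDerivAt (fun y => u y t) (pdx u x t) x :=
    fun x hx t ht => (hsol.u_reg x hx t (hmem ht)).1.hasDerivAt
  have duxx : ∀ x ∈ Set.Icc a b, ∀ t, 0 < t →
      HasDerivAt (fun y => pdx u y t) (pdx (pdx u) x t) x :=
    fun x hx t ht => (hsol.u_reg x hx t (hmem ht)).2.1.hasDerivAt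
  have dut : ∀ x ∈ Set.Icc a b, ∀ t, 0 < t → HasDerivAt (fun s => u x s) (pdt u x t) t :=
    fun x hx t ht => (hsol.u_reg x hx t (hmem ht)).2.2.hasDerivAt
  have dvx : ∀ x ∈ Set.Icc a b, ∀ t, 0 < t → HasDerivAt (fun y => v y t) (pdx v x t) x :=
    fun x hx t ht => (hsol.v_reg x hx t (hmem ht)).1.hasDerivAt
  have dvxx : ∀ x ∈ Set.Icc a b, ∀ t, 0 < t →
      HasDerivAt (fun y => pdx v y t) (pdx (pdx v) x t) x :=
    fun x hx t ht => (hsol.v_reg x hx t (hmem ht)).2.1.hasDerivAt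
  have dvt : ∀ x ∈ Set.Icc a b, ∀ t, 0 < t → HasDerivAt (fun s => v x s) (pdt v x t) t :=
    fun x hx t ht => (hsol.v_reg x hx t (hmem ht)).2.2.hasDerivAt
  have hℓ : 0 < b - a := by linarith
  have hIoo : ∀ f g : ℝ → ℝ, (∀ x ∈ Set.Ioo a b, f x = g x) →
      ∫ x in Set.Ioo a b, f x = ∫ x in a..b, g x := by
    intro f g h
    rw [intervalIntegral.integral_of_le hab.le, integral_Ioc_eq_integral_Ioo]
    exact setIntegral_congr_fun measurableSet_Ioo h
  -- spatial integrals of second derivatives vanish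
  have ivxx : ∀ t, 0 < t → ∫ x in a..b, pdx (pdx v) x t = 0 := by
    intro t ht
    rw [intervalIntegral.integral_eq_sub_of_hasDerivAt (f := fun y => pdx v y t)
      (by rw [Set.uIcc_of_le hab.le]; exact fun x hx => dvxx x hx t ht)
      (cd_int hab (cd_slice cvxx ht))]
    simp [hsol.v_bc t (hmem ht)]
  have iuxx : ∀ t, 0 < t → ∫ x in a..b, pdx (pdx u) x t = 0 := by
    intro t ht
    rw [intervalIntegral.integral_eq_sub_of_hasDerivAt (f := fun y => pdx u y t)
      (by rw [Set.uIcc_of_le hab.le]; exact fun x hx => duxx x hx t ht)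
      (cd_int hab (cd_slice cuxx ht))]
    simp [hsol.u_bc t (hmem ht)]
  -- the taxis term
  let w : ℝ → ℝ → ℝ := fun x t =>
    (pdx u x t * v x t - u x t * pdx v x t) / v x t ^ 2 * pdx v x t
      + u x t / v x t * pdx (pdx v) x t
  have dw : ∀ x ∈ Set.Icc a b, ∀ t, 0 < t →
      HasDerivAt (fun y => u y t / v y t * pdx v y t) (w x t) x := by
    intro x hx t ht
    exact ((dux x hx t ht).div (dvx x hx t ht) (vpos x hx t ht).ne').mul (dvxx x hx t ht)
  have vne : ∀ p ∈ Set.Icc a b ×ˢ Set.Ioi (0:ℝ), v p.1 p.2 ≠ 0 := fun p hp =>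
    (vpos p.1 hp.1 p.2 hp.2).ne'
  have cw : ContinuousOn (fun p : ℝ × ℝ => w p.1 p.2) (Set.Icc a b ×ˢ Set.Ioi (0:ℝ)) :=
    ((((cux.mul cv).sub (cu.mul cvx)).div (cv.pow 2)
      (fun p hp => pow_ne_zero 2 (vne p hp))).mul cvx).add ((cu.div cv vne).mul cvxx)
  have iw : ∀ t, 0 < t → ∫ x in a..b, w x t = 0 := by
    intro t ht
    rw [intervalIntegral.integral_eq_sub_of_hasDerivAt (f := fun y => u y t / v y t * pdx v y t)
      (by rw [Set.uIcc_of_le hab.le]; exact fun x hx => dw x hx t ht)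
      (cd_int hab (cd_slice cw ht))]
    simp [hsol.v_bc t (hmem ht)]
  have cuv : ContinuousOn (fun p : ℝ × ℝ => u p.1 p.2 * v p.1 p.2)
    (Set.Icc a b ×ˢ Set.Ioi (0:ℝ)) := cu.mul cv
  let β2 : ℝ → ℝ → ℝ := fun x t => pdt v x t - pdx (pdx v) x t - u x t * v x t + v x t
  let β1 : ℝ → ℝ → ℝ := fun x t => pdt u x t - pdx (pdx u) x t + χ * w x t + u x t * v x t
  have cβ1 : ContinuousOn (fun p : ℝ × ℝ => β1 p.1 p.2) (Set.Icc a b ×ˢ Set.Ioi (0:ℝ)) :=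
    ((cut.sub cuxx).add (continuousOn_const.mul cw)).add cuv
  have eB2 : ∀ t, 0 < t → ∀ x ∈ Set.Ioo a b, B2 x t = β2 x t := by
    intro t ht x hx
    have := hsol.v_eq x hx t (hmem ht)
    simp only [β2]; linarith
  have eB1 : ∀ t, 0 < t → ∀ x ∈ Set.Ioo a b, B1 x t = β1 x t := by
    intro t ht x hx
    have h1 := hsol.u_eq x hx t (hmem ht)
    have h2 : pdx (fun y s => u y s / v y s * pdx v y s) x t = w x t :=
      (dw x (Set.Ioo_subset_Icc_self hx) t ht).deriv
    rw [h2] at h1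
    simp only [β1]; linarith
  have I : ∀ {F : ℝ → ℝ → ℝ}, ContinuousOn (fun p : ℝ × ℝ => F p.1 p.2)
      (Set.Icc a b ×ˢ Set.Ioi (0:ℝ)) → ∀ {t : ℝ}, 0 < t →
      IntervalIntegrable (fun x => F x t) volume a b := fun hF _ ht => cd_int hab (cd_slice hF ht)
  -- masses
  have dm : ∀ t, 0 < t → HasDerivAt (fun s => ∫ x in a..b, v x s) (∫ x in a..b, pdt v x t) t :=
    fun t ht => cd_deriv hab cv cvt dvt ht
  have dU : ∀ t, 0 < t → HasDerivAt (fun s => ∫ x in a..b, u x s) (∫ x in a..b, pdt u x t) t :=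
    fun t ht => cd_deriv hab cu cut dut ht
  have iuv : ∀ t, 0 < t → 0 ≤ ∫ x in a..b, u x t * v x t := fun t ht =>
    intervalIntegral.integral_nonneg hab.le fun x hx =>
      (mul_pos (upos x hx t ht) (vpos x hx t ht)).le
  have m_in : ∀ t, 1 ≤ t → c - 1 * (∫ x in a..b, v x t) ≤ ∫ x in a..b, pdt v x t := by
    intro t ht1
    have ht : 0 < t := by linarith
    have h1 := hB2c t ht
    rw [hIoo _ (fun x => β2 x t) (eB2 t ht)] at h1
    have h2 : (∫ x in a..b, β2 x t) = (∫ x in a..b, pdt v x t) - (∫ x in a..b, pdx (pdx v) x t)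
        - (∫ x in a..b, u x t * v x t) + ∫ x in a..b, v x t := by
      simp only [β2]
      rw [intervalIntegral.integral_add (((I cvt ht).sub (I cvxx ht)).sub
          (I (F := fun x t => u x t * v x t) cuv ht)) (I cv ht),
        intervalIntegral.integral_sub ((I cvt ht).sub (I cvxx ht))
          (I (F := fun x t => u x t * v x t) cuv ht),
        intervalIntegral.integral_sub (I cvt ht) (I cvxx ht)]
    rw [h2, ivxx t ht] at h1
    have := iuv t ht
    linarith
  have β1_eq : ∀ t, 0 < t → (∫ x in a..b, β1 x t) = (∫ x in a..b, pdt u x t)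
      + ∫ x in a..b, u x t * v x t := by
    intro t ht
    simp only [β1]
    rw [intervalIntegral.integral_add (((I cut ht).sub (I cuxx ht)).add
        ((I cw ht).const_mul χ)) (I (F := fun x t => u x t * v x t) cuv ht),
      intervalIntegral.integral_add ((I cut ht).sub (I cuxx ht)) ((I cw ht).const_mul χ),
      intervalIntegral.integral_sub (I cut ht) (I cuxx ht),
      intervalIntegral.integral_const_mul, iw t ht, iuxx t ht]
    ring
  -- lower bound for the mass of v
  obtain ⟨m0, hm0, hm0v⟩ : ∃ m0 : ℝ, 0 < m0 ∧ ∀ t, 1 ≤ t → m0 ≤ ∫ x in a..b, v x t := by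
    refine ⟨min (∫ x in a..b, v x 1) (c / 1), lt_min ?_ (by simpa using hc), fun t ht =>
      cd_barrier one_pos dm m_in ht⟩
    exact intervalIntegral.intervalIntegral_pos_of_pos_on (I cv one_pos)
      (fun x hx => vpos x (Set.Ioo_subset_Icc_self hx) 1 one_pos) hab
  set m : ℝ := m0 / (b - a) with hmdef
  have hm : 0 < m := by positivity
  have hmx : ∀ t, 1 ≤ t → ∃ x ∈ Set.Icc a b, m ≤ v x t := by
    intro t ht1
    have ht : 0 < t := by linarith
    by_contra hcon
    push Not at hcon
    have h1 : ∫ x in a..b, v x t < ∫ x in a..b, m := by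
      refine intervalIntegral.integral_lt_integral_of_continuousOn_of_le_of_exists_lt hab
        (cd_slice cv ht) continuousOn_const
        (fun x hx => (hcon x (Set.Ioc_subset_Icc_self hx)).le)
        ⟨a, Set.left_mem_Icc.2 hab.le, hcon a (Set.left_mem_Icc.2 hab.le)⟩
    rw [intervalIntegral.integral_const, smul_eq_mul, hmdef, mul_div_cancel₀ _ hℓ.ne'] at h1
    linarith [hm0v t ht1]
  -- the functional y
  let q : ℝ → ℝ → ℝ := fun x t => Real.log (v x t) - Real.log (1 + v x t)
  let q' : ℝ → ℝ → ℝ := fun x t => pdt v x t / (v x t * (1 + v x t))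
  have cq : ContinuousOn (fun p : ℝ × ℝ => q p.1 p.2) (Set.Icc a b ×ˢ Set.Ioi (0:ℝ)) :=
    (cv.log vne).sub ((continuousOn_const.add cv).log (fun p hp => by
      have := vpos p.1 hp.1 p.2 hp.2
      exact (by linarith : (0:ℝ) < 1 + v p.1 p.2).ne'))
  have cq' : ContinuousOn (fun p : ℝ × ℝ => q' p.1 p.2) (Set.Icc a b ×ˢ Set.Ioi (0:ℝ)) :=
    cvt.div (cv.mul (continuousOn_const.add cv)) (fun p hp => by
      have := vpos p.1 hp.1 p.2 hp.2
      exact (mul_pos this (by linarith : (0:ℝ) < 1 + v p.1 p.2)).ne')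
  have dq : ∀ x ∈ Set.Icc a b, ∀ t, 0 < t → HasDerivAt (fun s => q x s) (q' x t) t := by
    intro x hx t ht
    have p := vpos x hx t ht
    have := ((dvt x hx t ht).log p.ne').sub (((dvt x hx t ht).const_add 1).log (by positivity))
    refine this.congr_deriv (Eq.symm ?_)
    simp only [q']
    field_simp
    ring
  have dy : ∀ t, 0 < t → HasDerivAt (fun s => ∫ x in a..b, q x s) (∫ x in a..b, q' x t) t :=
    fun t ht => cd_deriv hab cq cq' dq ht
  set L : ℝ := Real.log m - Real.log (1 + m) - 5 / 4 * (b - a) with hL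
  have hspace : ∀ t, 1 ≤ t → ∀ x ∈ Set.Icc a b, L - (∫ x in a..b, q' x t) ≤ q x t := by
    intro t ht1
    have ht : 0 < t := by linarith
    refine cd_space hab hm (fun x hx => vpos x hx t ht) (fun x hx => dvx x hx t ht)
      (fun x hx => dvxx x hx t ht) (cd_slice cvxx ht) (cd_slice cvt ht)
      (hsol.v_bc t (hmem ht)).1 (hsol.v_bc t (hmem ht)).2 ?_ (hmx t ht1)
    intro x hx
    have hx' := Set.Ioo_subset_Icc_self hx
    have h1 := hsol.v_eq x hx t (hmem ht)
    have h2 := hB2.1 x t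
    have h3 := mul_pos (upos x hx' t ht) (vpos x hx' t ht)
    linarith
  have y_in : ∀ t, 1 ≤ t → L - (1 / (b - a)) * (∫ x in a..b, q x t) ≤ ∫ x in a..b, q' x t := by
    intro t ht1
    have ht : 0 < t := by linarith
    have h1 : (∫ x in a..b, (L - ∫ x in a..b, q' x t)) ≤ ∫ x in a..b, q x t :=
      intervalIntegral.integral_mono_on hab.le intervalIntegrable_const (I cq ht)
        (fun x hx => hspace t ht1 x hx)
    rw [intervalIntegral.integral_const, smul_eq_mul] at h1
    have h2 : L - (∫ x in a..b, q' x t) ≤ (1 / (b - a)) * (∫ x in a..b, q x t) := by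
      rw [one_div, inv_mul_eq_div, le_div_iff₀ hℓ]; linarith
    linarith
  have y_low := fun t (ht : 1 ≤ t) => cd_barrier (one_div_pos.2 hℓ) dy y_in ht
  have y_up : ∀ t, 1 ≤ t → ∫ x in a..b, q x t ≤ 0 := by
    intro t ht1
    have ht : 0 < t := by linarith
    have h1 : (∫ x in a..b, q x t) ≤ ∫ x in a..b, (0:ℝ) :=
      intervalIntegral.integral_mono_on hab.le (I cq ht) intervalIntegrable_const
        (fun x hx => by
          have p := vpos x hx t ht
          have := Real.log_le_log p (by linarith : v x t ≤ 1 + v x t)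
          simp only [q]; linarith)
    simpa using h1
  have v_low : ∀ t, 1 ≤ t → ∀ x ∈ Set.Icc a b,
      Real.exp L * (1 - ∫ x in a..b, q' x t) ≤ v x t := by
    intro t ht1 x hx
    have p := vpos x hx t (by linarith)
    have h1 := hspace t ht1 x hx
    have h2 : 0 ≤ Real.log (1 + v x t) := Real.log_nonneg (by linarith)
    have h3 : L - (∫ x in a..b, q' x t) ≤ Real.log (v x t) := by
      simp only [q] at h1; linarith
    have h4 : Real.exp (L - (∫ x in a..b, q' x t)) ≤ v x t := by
      rw [← Real.exp_log p]; exact Real.exp_le_exp.2 h3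
    have h5 := Real.add_one_le_exp (-(∫ x in a..b, q' x t))
    have h6 : Real.exp (L - (∫ x in a..b, q' x t))
        = Real.exp L * Real.exp (-(∫ x in a..b, q' x t)) := by
      rw [← Real.exp_add]; ring_nf
    rw [h6] at h4
    refine le_trans ?_ h4
    exact mul_le_mul_of_nonneg_left (by linarith) (Real.exp_pos _).le
  -- conclusion
  have hfin : Tendsto (fun s => ∫ x in a..b, u x s) atTop (𝓝 0) := by
    refine cd_ode (c := Real.exp L) (β := fun t => ∫ x in a..b, β1 x t)
      (K := -min (∫ x in a..b, q x 1) (L / (1 / (b - a)))) (Real.exp_pos L) dU dy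
      ?_ ?_ ?_ y_up ?_ ?_ ?_
    · exact fun t ht => (cd_cont hab cβ1 ht).continuousWithinAt
    · intro t ht
      rw [← hIoo _ (fun x => β1 x t) (eB1 t ht)]
      exact integral_nonneg fun x => hB1.1 x t
    · intro t ht
      exact intervalIntegral.integral_nonneg hab.le fun x hx => (upos x hx t ht).le
    · intro t ht
      rw [neg_neg]; exact y_low t ht
    · intro t ht1
      have ht : 0 < t := by linarith
      have h1 := β1_eq t ht
      have h2 : (∫ x in a..b, (Real.exp L * (1 - ∫ x in a..b, q' x t)) * u x t)
          ≤ ∫ x in a..b, u x t * v x t :=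
        intervalIntegral.integral_mono_on hab.le ((I cu ht).const_mul _)
          (I (F := fun x t => u x t * v x t) cuv ht) (fun x hx => by
            rw [mul_comm]
            exact mul_le_mul_of_nonneg_left (v_low t ht1 x hx) (upos x hx t ht).le)
      rw [intervalIntegral.integral_const_mul] at h2
      linarith
    · refine hH1'.congr' ?_
      filter_upwards [eventually_ge_atTop 1] with t ht
      refine intervalIntegral.integral_congr fun s hs => ?_
      rw [Set.uIcc_of_le (by linarith)] at hs
      exact hIoo _ _ (eB1 s (by linarith [hs.1]))
  exact hfin.congr fun t => (hIoo _ _ (fun x _ => rfl)).symm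
end
end

section
/- Suppose χ > 0 satisfies χ < √(6√3 + 9)/2, and let p₀ := (2√3 − 3)/3. Then p₀ ∈ (0,1), p₀ < 1/χ², and φ₁(p₀) > φ₃(p₀), where φ₁(p) := (p+1)/(1−p) and φ₃(p) := ((1−p)/(2p)) · (1 − √(1 − pχ²)). -/
open Real MeasureTheory Filter Topology Set
open scoped ENNReal NNReal

noncomputable section

/-- Lemma 5.1 (the constant `p₀ = (2√3 − 3)/3` satisfies `p₀ ∈ (0,1)`,
`p₀ < 1/χ²` and `φ₁(p₀) > φ₃(p₀)` whenever `χ < √(6√3+9)/2`). -/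
theorem p0_properties
    (χ : ℝ) (hχ : 0 < χ) (hχ' : χ < Real.sqrt (6 * Real.sqrt 3 + 9) / 2) :
    p0 ∈ Set.Ioo (0:ℝ) 1 ∧ p0 < 1 / χ^2 ∧ phi3 χ p0 < phi1 p0 := by
  have h3 : Real.sqrt 3 ^ 2 = 3 := Real.sq_sqrt (by norm_num)
  have h3p : 0 ≤ Real.sqrt 3 := Real.sqrt_nonneg 3
  have hp : p0 = (2 * Real.sqrt 3 - 3) / 3 := rfl
  have hroot : (1 - p0) ^ 2 = 4 * p0 * (p0 + 1) := by
    rw [hp]; nlinarith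
  have hpos : 0 < p0 := by rw [hp]; nlinarith
  have hlt : p0 < 1 := by rw [hp]; nlinarith
  have hχ2 : χ ^ 2 < (6 * Real.sqrt 3 + 9) / 4 := by
    have h := Real.sq_sqrt (show 0 ≤ 6 * Real.sqrt 3 + 9 by positivity)
    nlinarith
  have hprod : p0 * ((6 * Real.sqrt 3 + 9) / 4) = 3 / 4 := by
    rw [hp]; nlinarith
  have hpχ : p0 * χ ^ 2 < 3 / 4 := by
    rw [← hprod]; exact mul_lt_mul_of_pos_left hχ2 hpos
  refine ⟨⟨hpos, hlt⟩, ?_, ?_⟩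
  · rw [lt_div_iff₀ (by positivity)]; linarith
  · have hs : 1 / 2 < Real.sqrt (1 - p0 * χ ^ 2) := by
      apply Real.lt_sqrt_of_sq_lt; linarith
    have h1p : 0 < 1 - p0 := by linarith
    have heq : phi1 p0 = (1 - p0) / (2 * p0) * (1 / 2) := by
      unfold phi1
      field_simp
      linarith
    rw [heq]
    unfold phi3
    apply mul_lt_mul_of_pos_left _ (by positivity)
    linarith
end
end
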